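/- Let α > 0 be fixed and let f : ℝ → ℝ be bounded and continuous. With E_N(m) the expected number of real eigenvalues of the product of m independent N×N Gaussian matrices, for any sequence of positive integers (m_N) indexed by even N with m_N/N → α as N → ∞, one has (1/E_N(m_N)) · E[ Σ_x f(x) ] → f(0) as N → ∞, where the sum Σ_x runs over the real roots x of the characteristic polynomial of the product matrix, counted with multiplicity. (Equivalently, the normalized density of real eigenvalues converges weakly to the Dirac delta at 0.) -/

import Mathlib

open MeasureTheory ProbabilityTheory Filter

/-- The error function `erf x = (2/√π) ∫_0^x e^{-s²} ds`. -/
noncomputable def erf (x : ℝ) : ℝ :=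
  (2 / Real.sqrt Real.pi) * ∫ s in (0:ℝ)..x, Real.exp (-s ^ 2)

/-- `c(α) = ∫_0^1 erf(√(α/(8t))) dt`. -/
noncomputable def cFun (α : ℝ) : ℝ :=
  ∫ t in (0:ℝ)..1, erf (Real.sqrt (α / (8 * t)))

/-- The joint law of `m` independent `N × N` matrices with i.i.d. real Gaussian
entries of mean `0` and variance `1/N`. -/
noncomputable def ensembleMeasure (N m : ℕ) :
    Measure (Fin m → Fin N → Fin N → ℝ) :=
  Measure.pi fun _ =>
    Measure.pi fun _ => Measure.pi fun _ => gaussianReal 0 (1 / N)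

/-- The product matrix `P = X_1 ⋯ X_m`. -/
noncomputable def prodMatrix (N m : ℕ) (ω : Fin m → Fin N → Fin N → ℝ) :
    Matrix (Fin N) (Fin N) ℝ :=
  (List.ofFn fun i => Matrix.of (ω i)).prod

/-- The number of real eigenvalues of a matrix, i.e. the number of real roots of
its characteristic polynomial counted with multiplicity. -/
noncomputable def numRealEigs (N : ℕ) (P : Matrix (Fin N) (Fin N) ℝ) : ℕ :=
  (Matrix.charpoly P).roots.card

/-- The expected number of real eigenvalues of the product of `m` independent
`N × N` Gaussian matrices. -/
noncomputable def EN (N m : ℕ) : ℝ :=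
  ∫ ω, (numRealEigs N (prodMatrix N m ω) : ℝ) ∂(ensembleMeasure N m)

/-- The variance of the number of real eigenvalues. -/
noncomputable def VN (N m : ℕ) : ℝ :=
  variance (fun ω => (numRealEigs N (prodMatrix N m ω) : ℝ)) (ensembleMeasure N m)

/-- The linear statistic `Σ_x f(x)` over the multiset of real roots of the
characteristic polynomial of `P`, counted with multiplicity. -/
noncomputable def linearStat (N : ℕ) (f : ℝ → ℝ) (P : Matrix (Fin N) (Fin N) ℝ) : ℝ :=
  ((Matrix.charpoly P).roots.map f).sum

set_option linter.unusedSectionVars false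

namespace RealEigs

open scoped InnerProductSpace ENNReal

section LinearAlgebra

variable {n : Type*} [Fintype n] [DecidableEq n]

/-- The matrix with the rows of `M` indexed by `S` and the other rows taken from `B`. -/
def mix (S : Finset n) (M B : Matrix n n ℝ) : Matrix n n ℝ :=
  Matrix.of fun a b => if a ∈ S then M a b else B a b

lemma mix_of_mem {S : Finset n} {a : n} (ha : a ∈ S) (M B : Matrix n n ℝ) :
    mix S M B a = M a := by
  ext b; simp [mix, ha]

lemma mix_of_notMem {S : Finset n} {a : n} (ha : a ∉ S) (M B : Matrix n n ℝ) :
    mix S M B a = B a := by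
  ext b; simp [mix, ha]

/-- The principal minor of `M` with index set `S`, realised as the determinant of the matrix
obtained from `M` by replacing the rows outside `S` with those of the identity. -/
noncomputable def pm (S : Finset n) (M : Matrix n n ℝ) : ℝ :=
  (mix S M 1).det

lemma pm_eq_submatrix (S : Finset n) (M : Matrix n n ℝ) :
    pm S M = (M.submatrix (Subtype.val : S → n) (Subtype.val : S → n)).det := by
  rw [← Matrix.det_piecewise_one_eq_submatrix_det M S, pm]
  congr 1
  ext a b
  by_cases ha : a ∈ S <;> simp [mix, Finset.piecewise, ha]

lemma pm_univ (M : Matrix n n ℝ) : pm Finset.univ M = M.det := by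
  rw [pm]; congr 1; ext a b; simp [mix]

lemma pm_empty (M : Matrix n n ℝ) : pm ∅ M = 1 := by
  have : mix ∅ M 1 = 1 := by ext a b; simp [mix]
  rw [pm, this, Matrix.det_one]

lemma pm_transpose (S : Finset n) (M : Matrix n n ℝ) : pm S M.transpose = pm S M := by
  rw [pm_eq_submatrix, pm_eq_submatrix, ← Matrix.det_transpose]; rfl

lemma pm_one (S : Finset n) : pm S (1 : Matrix n n ℝ) = 1 := by
  have : mix S (1 : Matrix n n ℝ) 1 = 1 := by ext a b; simp [mix]
  rw [pm, this, Matrix.det_one]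

lemma pm_congr {S : Finset n} {A B : Matrix n n ℝ} (h : ∀ a ∈ S, ∀ b ∈ S, A a b = B a b) :
    pm S A = pm S B := by
  rw [pm_eq_submatrix, pm_eq_submatrix]
  congr 1
  ext a b
  exact h a a.2 b b.2

lemma pm_smul (S : Finset n) (c : ℝ) (M : Matrix n n ℝ) :
    pm S (c • M) = c ^ S.card * pm S M := by
  rw [pm_eq_submatrix, pm_eq_submatrix, Matrix.submatrix_smul, Pi.smul_apply, Pi.smul_apply,
    Matrix.det_smul, Fintype.card_coe]

lemma pm_mul_of_right {S : Finset n} (A : Matrix n n ℝ) {B : Matrix n n ℝ}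
    (h : ∀ a ∉ S, ∀ b ∈ S, B a b = 0) : pm S (A * B) = pm S A * pm S B := by
  rw [pm_eq_submatrix, pm_eq_submatrix, pm_eq_submatrix, ← Matrix.det_mul]
  congr 1
  ext a b
  simp only [Matrix.submatrix_apply, Matrix.mul_apply]
  rw [Finset.sum_coe_sort S (fun i => A a i * B i b)]
  refine (Finset.sum_subset (Finset.subset_univ S) fun i _ hi => ?_).symm
  rw [h i hi b b.2, mul_zero]

lemma pm_mul_of_left {S : Finset n} {A : Matrix n n ℝ} (B : Matrix n n ℝ)
    (h : ∀ a ∈ S, ∀ b ∉ S, A a b = 0) : pm S (A * B) = pm S A * pm S B := by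
  rw [← pm_transpose, Matrix.transpose_mul, pm_mul_of_right, pm_transpose, pm_transpose, mul_comm]
  exact fun a ha b hb => h b hb a ha

/-- A principal minor is the linear functional of any of its rows. -/
lemma pm_insert_eq_functional {L : Finset n} {c : n} (hc : c ∉ L) (M : Matrix n n ℝ) :
    ∃ φ : (n → ℝ) →ₗ[ℝ] ℝ, φ (M c) = pm (insert c L) M ∧ (∀ a ∈ L, φ (M a) = 0) ∧
      (∀ a ∉ insert c L, φ (Pi.single a 1) = 0) ∧ φ (Pi.single c 1) = pm L M := by
  set A : Matrix n n ℝ := mix L M 1 with hA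
  refine ⟨Matrix.detRowAlternating.toMultilinearMap.toLinearMap A c, ?_, ?_, ?_, ?_⟩
  · change (A.updateRow c (M c)).det = _
    rw [pm]
    congr 1
    ext a b
    by_cases hac : a = c
    · subst hac; simp [mix]
    · by_cases haL : a ∈ L <;> simp [hA, mix, hac, haL]
  · intro a ha
    have hac : a ≠ c := fun h => hc (h ▸ ha)
    change (A.updateRow c (M a)).det = _
    refine Matrix.det_zero_of_row_eq hac ?_
    rw [Matrix.updateRow_ne hac, Matrix.updateRow_self]
    ext b
    simp [hA, mix, ha]
  · intro a ha
    have hac : a ≠ c := fun h => ha (h ▸ Finset.mem_insert_self _ _)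
    have haL : a ∉ L := fun h => ha (Finset.mem_insert_of_mem h)
    change (A.updateRow c (Pi.single a 1)).det = _
    refine Matrix.det_zero_of_row_eq hac ?_
    rw [Matrix.updateRow_ne hac, Matrix.updateRow_self]
    ext b
    simp [hA, mix, haL, Matrix.one_apply, Pi.single_apply, eq_comm]
  · change (A.updateRow c (Pi.single c 1)).det = _
    rw [pm]
    congr 1
    ext a b
    by_cases hac : a = c
    · subst hac
      simp [mix, hc, Matrix.one_apply, Pi.single_apply, eq_comm]
    · simp [Matrix.updateRow_ne hac, hA]

end LinearAlgebra

section Volume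

variable {n : Type*} [Fintype n] [DecidableEq n]
variable {E : Type*} [NormedAddCommGroup E] [InnerProductSpace ℝ E] [FiniteDimensional ℝ E]

/-- Gram determinant of the subfamily of `v` indexed by `S`. -/
noncomputable def gramDet (v : n → E) (S : Finset n) : ℝ :=
  pm S (Matrix.of fun a b => ⟪v a, v b⟫_ℝ)

/-- Distance of `x` to the span of the subfamily of `v` indexed by `L`. -/
noncomputable def distSpan (v : n → E) (L : Finset n) (x : E) : ℝ :=
  ‖(Submodule.span ℝ (v '' L))ᗮ.starProjection x‖

lemma gramDet_insert (v : n → E) {L : Finset n} {c : n} (hc : c ∉ L) :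
    gramDet v (insert c L) = gramDet v L * distSpan v L (v c) ^ 2 := by
  obtain ⟨φ, h1, h2, h3, h4⟩ :=
    pm_insert_eq_functional hc (Matrix.of fun a b => ⟪v a, v b⟫_ℝ)
  set W := Submodule.span ℝ (v '' L) with hW
  let ψ : E →ₗ[ℝ] ℝ := φ ∘ₗ LinearMap.pi fun b => (innerₗ E).flip (v b)
  have hψ : ∀ x, ψ x = φ (fun b => ⟪x, v b⟫_ℝ) := fun x => rfl
  have hψW : ∀ x ∈ W, ψ x = 0 := by
    intro x hx
    have : W ≤ LinearMap.ker ψ := by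
      rw [hW, Submodule.span_le]
      rintro _ ⟨a, ha, rfl⟩
      exact h2 a ha
    exact this hx
  set q := Wᗮ.starProjection (v c) with hq
  have hqmem : q ∈ Wᗮ := Submodule.starProjection_apply_mem _ _
  have hdecomp : v c = W.starProjection (v c) + q := by
    rw [hq, Submodule.starProjection_orthogonal]; simp
  have hψc : ψ (v c) = ψ q := by
    conv_lhs => rw [hdecomp, map_add, hψW _ (Submodule.starProjection_apply_mem _ _), zero_add]
  have hqL : ∀ a ∈ L, ⟪q, v a⟫_ℝ = 0 := fun a ha =>
    Submodule.inner_left_of_mem_orthogonal (Submodule.subset_span (Set.mem_image_of_mem v ha)) hqmem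
  have hqc : ⟪q, v c⟫_ℝ = ‖q‖ ^ 2 := by
    rw [hdecomp, inner_add_right,
      Submodule.inner_left_of_mem_orthogonal (Submodule.starProjection_apply_mem _ _) hqmem,
      zero_add, real_inner_self_eq_norm_sq]
  have hsum : (fun b => ⟪q, v b⟫_ℝ) = ∑ b, ⟪q, v b⟫_ℝ • (Pi.single b 1 : n → ℝ) := by
    ext b; simp [Finset.sum_apply, Pi.single_apply]
  have : gramDet v (insert c L) = ψ (v c) := h1.symm
  rw [this, hψc, hψ, hsum, map_sum, Finset.sum_eq_single c, map_smul, h4, hqc, smul_eq_mul,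
    mul_comm]
  · rfl
  · intro b _ hb
    rw [map_smul]
    by_cases hbL : b ∈ L
    · rw [hqL b hbL, zero_smul]
    · rw [h3 b (by simp [hb, hbL]), smul_zero]
  · simp

lemma gramDet_nonneg (v : n → E) (S : Finset n) : 0 ≤ gramDet v S := by
  induction S using Finset.induction_on with
  | empty => rw [gramDet, pm_empty]; exact zero_le_one
  | insert c L hc ih => rw [gramDet_insert v hc]; positivity

/-- Volume of the parallelepiped spanned by the subfamily of `v` indexed by `S`. -/
noncomputable def vol (v : n → E) (S : Finset n) : ℝ := √(gramDet v S)

lemma vol_nonneg (v : n → E) (S : Finset n) : 0 ≤ vol v S := Real.sqrt_nonneg _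

lemma vol_empty (v : n → E) : vol v ∅ = 1 := by simp [vol, gramDet, pm_empty]

lemma vol_insert (v : n → E) {L : Finset n} {c : n} (hc : c ∉ L) :
    vol v (insert c L) = vol v L * distSpan v L (v c) := by
  rw [vol, gramDet_insert v hc, Real.sqrt_mul (gramDet_nonneg _ _),
    Real.sqrt_sq (show 0 ≤ distSpan v L (v c) from norm_nonneg _), vol]

lemma vol_congr {v w : n → E} {S : Finset n} (h : ∀ a ∈ S, v a = w a) : vol v S = vol w S := by
  rw [vol, vol, gramDet, gramDet]
  congr 1
  refine pm_congr fun a ha b hb => ?_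
  simp [h a ha, h b hb]

lemma distSpan_congr {v w : n → E} {S : Finset n} (h : ∀ a ∈ S, v a = w a) (x : E) :
    distSpan v S x = distSpan w S x := by
  have : v '' S = w '' S := Set.image_congr h
  simp only [distSpan, this]

lemma distSpan_le (v : n → E) (L : Finset n) (x : E) : distSpan v L x ≤ ‖x‖ :=
  Submodule.norm_starProjection_apply_le _ _

lemma vol_union_le (v : n → E) (S T : Finset n) (hT : ∀ a ∈ T, ‖v a‖ ≤ 1) :
    vol v (S ∪ T) ≤ vol v S := by
  induction T using Finset.induction_on with
  | empty => simp
  | insert c T hc ih =>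
    have ih := ih fun a ha => hT a (Finset.mem_insert_of_mem ha)
    by_cases hcS : c ∈ S ∪ T
    · rwa [Finset.union_insert, Finset.insert_eq_of_mem hcS]
    · rw [Finset.union_insert, vol_insert v hcS]
      calc _ ≤ vol v (S ∪ T) * 1 := by
            gcongr
            · exact vol_nonneg _ _
            · exact (distSpan_le _ _ _).trans (hT c (Finset.mem_insert_self _ _))
        _ ≤ _ := by rwa [mul_one]

lemma vol_orthonormal (v : n → E) (S : Finset n)
    (h : ∀ a ∈ S, ∀ b ∈ S, ⟪v a, v b⟫_ℝ = if a = b then 1 else 0) : vol v S = 1 := by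
  have : gramDet v S = pm S (1 : Matrix n n ℝ) :=
    pm_congr fun a ha b hb => by simp [h a ha b hb, Matrix.one_apply]
  rw [vol, this, pm_one, Real.sqrt_one]

lemma vol_ne_zero_iff_linearIndependent (v : n → E) (S : Finset n) :
    vol v S ≠ 0 ↔ LinearIndependent ℝ (fun a : S => v a) := by
  rw [vol, ne_eq, Real.sqrt_eq_zero (gramDet_nonneg _ _), gramDet, pm_eq_submatrix]
  exact Matrix.det_gram_ne_zero_iff_linearIndependent (𝕜 := ℝ) (v := fun a : S => v a)

end Volume

section RowVolume

variable {n : Type*} [Fintype n] [DecidableEq n]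

/-- The rows of a matrix as vectors of a Euclidean space. -/
noncomputable def rowVec (M : Matrix n n ℝ) (a : n) : EuclideanSpace ℝ n := WithLp.toLp 2 (M a)

/-- Volume spanned by the rows of `M` indexed by `S`. -/
noncomputable def rowVol (S : Finset n) (M : Matrix n n ℝ) : ℝ := vol (rowVec M) S

lemma inner_rowVec (M : Matrix n n ℝ) (a b : n) :
    ⟪rowVec M a, rowVec M b⟫_ℝ = (M * M.transpose) a b := by
  simp [rowVec, Matrix.mul_apply, PiLp.inner_apply, mul_comm]

lemma rowVol_eq (S : Finset n) (M : Matrix n n ℝ) :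
    rowVol S M = √(pm S (M * M.transpose)) := by
  rw [rowVol, vol, gramDet]
  congr 1
  exact pm_congr fun a _ b _ => inner_rowVec M a b

lemma rowVol_nonneg (S : Finset n) (M : Matrix n n ℝ) : 0 ≤ rowVol S M := vol_nonneg _ _

lemma rowVol_univ (M : Matrix n n ℝ) : rowVol Finset.univ M = |M.det| := by
  rw [rowVol_eq, pm_univ, Matrix.det_mul, Matrix.det_transpose, Real.sqrt_mul_self_eq_abs]

lemma abs_pm_le_rowVol (S : Finset n) (M : Matrix n n ℝ) : |pm S M| ≤ rowVol S M := by
  set Y : Matrix n n ℝ := mix S M 1 with hY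
  have h1 : |pm S M| = vol (rowVec Y) (S ∪ Sᶜ) := by
    rw [Finset.union_compl]; exact (rowVol_univ Y).symm
  have h2 : rowVol S M = vol (rowVec Y) S := by
    refine vol_congr fun a ha => ?_
    rw [rowVec, rowVec, hY, mix_of_mem ha]
  rw [h1, h2]
  refine vol_union_le _ _ _ fun a ha => ?_
  have ha : a ∉ S := by simpa using ha
  have : rowVec Y a = EuclideanSpace.single a 1 := by
    ext b
    rw [rowVec, hY, mix_of_notMem ha]
    simp [Matrix.one_apply, eq_comm]
  rw [this]; simp

end RowVolume

section Rotation

variable {n : Type*} [Fintype n] [DecidableEq n]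

/-- Volume spanned by the columns of `M` indexed by `S`. -/
noncomputable def colVol (S : Finset n) (M : Matrix n n ℝ) : ℝ := rowVol S M.transpose

lemma colVol_nonneg (S : Finset n) (M : Matrix n n ℝ) : 0 ≤ colVol S M := rowVol_nonneg _ _

lemma colVol_eq (S : Finset n) (M : Matrix n n ℝ) :
    colVol S M = √(pm S (M.transpose * M)) := by
  rw [colVol, rowVol_eq, Matrix.transpose_transpose]

lemma abs_pm_le_colVol (S : Finset n) (M : Matrix n n ℝ) : |pm S M| ≤ colVol S M := by
  rw [← pm_transpose]; exact abs_pm_le_rowVol S _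

lemma linearIndependent_rowVec {M : Matrix n n ℝ} (hM : M.det ≠ 0) :
    LinearIndependent ℝ (rowVec M) := by
  have h : vol (rowVec M) Finset.univ ≠ 0 := by
    change rowVol _ _ ≠ 0
    rw [rowVol_univ]; simpa using hM
  rw [vol_ne_zero_iff_linearIndependent] at h
  exact (linearIndependent_equiv (Equiv.subtypeUnivEquiv Finset.mem_univ)).1 h

lemma rowVol_ne_zero {M : Matrix n n ℝ} (hM : M.det ≠ 0) (S : Finset n) : rowVol S M ≠ 0 := by
  rw [rowVol, vol_ne_zero_iff_linearIndependent]
  exact (linearIndependent_rowVec hM).comp _ Subtype.val_injective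

lemma colVol_ne_zero {M : Matrix n n ℝ} (hM : M.det ≠ 0) (S : Finset n) : colVol S M ≠ 0 :=
  rowVol_ne_zero (by rwa [Matrix.det_transpose]) S

/-- Block QR decomposition: an invertible matrix is the product of an orthogonal matrix and a
matrix whose columns in `S` are supported on `S`. -/
lemma exists_block_qr {M : Matrix n n ℝ} (hM : M.det ≠ 0) (S : Finset n) :
    ∃ O U : Matrix n n ℝ, O.transpose * O = 1 ∧ M = O * U ∧ ∀ a ∉ S, ∀ b ∈ S, U a b = 0 := by
  set v : n → EuclideanSpace ℝ n := rowVec M.transpose with hv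
  have hli : LinearIndependent ℝ v := linearIndependent_rowVec (by rwa [Matrix.det_transpose])
  set W := Submodule.span ℝ (Set.range fun a : S => v a) with hW
  have hdim : Module.finrank ℝ W = S.card := by
    have := finrank_span_eq_card (R := ℝ) (b := fun a : S => v a)
      (hli.comp _ Subtype.val_injective)
    rw [hW, this, Fintype.card_coe]
  let e : Fin (Module.finrank ℝ W) ≃ S := Fintype.equivOfCardEq (by simp [hdim])
  let bW : OrthonormalBasis S ℝ W := (stdOrthonormalBasis ℝ W).reindex e
  let w : n → EuclideanSpace ℝ n := fun a => if h : a ∈ S then (bW ⟨a, h⟩ : EuclideanSpace ℝ n) else 0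
  have hw : ∀ a : S, w a = bW a := fun a => by simp [w]
  have hort : Orthonormal ℝ ((S : Set n).domRestrict w) := by
    have h2 := bW.orthonormal.comp_linearIsometry W.subtypeₗᵢ
    have h3 : (S : Set n).domRestrict w = W.subtypeₗᵢ ∘ bW := by
      funext a
      exact hw a
    exact h3 ▸ h2
  obtain ⟨b, hb⟩ := hort.exists_orthonormalBasis_extension_of_card_eq (by simp)
  have hbW : ∀ a ∉ S, ∀ x ∈ W, ⟪b a, x⟫_ℝ = 0 := by
    intro a ha x hx
    have : x = ((∑ i, bW.repr ⟨x, hx⟩ i • bW i : W) : EuclideanSpace ℝ n) := by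
      rw [bW.sum_repr]
    rw [this]
    simp only [Submodule.coe_sum, Submodule.coe_smul, inner_sum, inner_smul_right]
    refine Finset.sum_eq_zero fun i _ => ?_
    rw [← hw i, ← hb i i.2, b.orthonormal.inner_eq_zero (by rintro rfl; exact ha i.2), mul_zero]
  let O : Matrix n n ℝ := Matrix.of fun a c => b c a
  have hOO : O.transpose * O = 1 := by
    ext a c
    have := b.inner_eq_ite a c
    simp only [PiLp.inner_apply, RCLike.inner_apply, conj_trivial] at this
    simp only [Matrix.mul_apply, Matrix.transpose_apply, O, Matrix.of_apply, Matrix.one_apply]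
    rw [← this]
    exact Finset.sum_congr rfl fun i _ => mul_comm _ _
  refine ⟨O, O.transpose * M, hOO, ?_, ?_⟩
  · rw [← Matrix.mul_assoc, mul_eq_one_comm.1 hOO, Matrix.one_mul]
  · intro a ha c hc
    have := hbW a ha (v c) (Submodule.subset_span ⟨⟨c, hc⟩, rfl⟩)
    simp only [PiLp.inner_apply, RCLike.inner_apply, conj_trivial, hv, rowVec] at this
    simp only [Matrix.mul_apply, Matrix.transpose_apply, O, Matrix.of_apply]
    rw [← this]
    exact Finset.sum_congr rfl fun i _ => mul_comm _ _

lemma exists_rotation {M : Matrix n n ℝ} (hM : M.det ≠ 0) (S : Finset n) :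
    ∃ O : Matrix n n ℝ, O.transpose * O = 1 ∧ ∀ X : Matrix n n ℝ,
      colVol S (X * M) = colVol S (X * O) * colVol S M ∧
      |pm S (X * M)| = |pm S (X * O)| * colVol S M ∧
      |(X * M).det| = |(X * O).det| * |M.det| := by
  obtain ⟨O, U, hO, hMU, hU⟩ := exists_block_qr hM S
  have hMcol : colVol S M = |pm S U| := by
    rw [colVol_eq, hMU, Matrix.transpose_mul, Matrix.mul_assoc, ← Matrix.mul_assoc O.transpose, hO,
      Matrix.one_mul, pm_mul_of_right _ hU, pm_transpose, Real.sqrt_mul_self_eq_abs]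
  have hdO : |O.det| = 1 := by
    have := congrArg Matrix.det hO
    rw [Matrix.det_mul, Matrix.det_transpose, Matrix.det_one] at this
    rw [← Real.sqrt_mul_self_eq_abs, this, Real.sqrt_one]
  refine ⟨O, hO, fun X => ⟨?_, ?_, ?_⟩⟩
  · rw [hMcol, hMU, ← Matrix.mul_assoc, colVol_eq, colVol_eq, Matrix.transpose_mul,
      Matrix.mul_assoc, pm_mul_of_left, ← Matrix.mul_assoc, pm_mul_of_right _ hU, pm_transpose,
      ← Real.sqrt_mul_self_eq_abs, ← Real.sqrt_mul']
    · congr 1; ring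
    · exact mul_self_nonneg _
    · exact fun a ha b hb => hU b hb a ha
  · rw [hMcol, hMU, ← Matrix.mul_assoc, pm_mul_of_right _ hU, abs_mul]
  · rw [Matrix.det_mul, Matrix.det_mul, abs_mul, abs_mul, hdO, mul_one]

end Rotation

section Gaussian

variable {E F : Type*} [NormedAddCommGroup E] [InnerProductSpace ℝ E] [FiniteDimensional ℝ E]
  [MeasurableSpace E] [BorelSpace E] [NormedAddCommGroup F] [InnerProductSpace ℝ F]
  [FiniteDimensional ℝ F] [MeasurableSpace F] [BorelSpace F]

lemma stdGaussian_map_coisometry (A : E →L[ℝ] F) (B : F → E)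
    (hAB : ∀ x t, ⟪A x, t⟫_ℝ = ⟪x, B t⟫_ℝ) (hB : ∀ t, ‖B t‖ = ‖t‖) :
    (stdGaussian E).map A = stdGaussian F := by
  have : IsProbabilityMeasure ((stdGaussian E).map A) :=
    Measure.isProbabilityMeasure_map A.continuous.aemeasurable
  apply Measure.ext_of_charFun
  ext t
  rw [charFun_apply, integral_map A.continuous.aemeasurable
    (Measurable.aestronglyMeasurable (by fun_prop))]
  simp_rw [hAB]
  rw [← charFun_apply, charFun_stdGaussian, charFun_stdGaussian, hB]

variable (n : Type*) [Fintype n]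

/-- The standard Gaussian measure on `n → ℝ`. -/
noncomputable def gauss : Measure (n → ℝ) := Measure.pi fun _ => gaussianReal 0 1

/-- The law of a square matrix with independent standard Gaussian entries. -/
noncomputable def gaussMat : Measure (n → n → ℝ) := Measure.pi fun _ => gauss n

instance : IsProbabilityMeasure (gauss n) := by unfold gauss; infer_instance
instance : IsProbabilityMeasure (gaussMat n) := by unfold gaussMat; infer_instance

variable {n}

lemma map_toLp_gauss : (gauss n).map (WithLp.toLp 2) = stdGaussian (EuclideanSpace ℝ n) :=
  map_pi_eq_stdGaussian

lemma lintegral_gauss_toLp (g : EuclideanSpace ℝ n → ℝ≥0∞) (hg : Measurable g) :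
    ∫⁻ x, g (WithLp.toLp 2 x) ∂gauss n = ∫⁻ y, g y ∂stdGaussian (EuclideanSpace ℝ n) := by
  rw [← map_toLp_gauss, lintegral_map hg (by fun_prop)]

lemma measurePreserving_vecMul [DecidableEq n] {O : Matrix n n ℝ} (hO : O.transpose * O = 1) :
    MeasurePreserving (fun x : n → ℝ => Matrix.vecMul x O) (gauss n) (gauss n) := by
  have hmeas : Measurable (fun x : n → ℝ => Matrix.vecMul x O) := by
    refine Continuous.measurable ?_
    fun_prop
  refine ⟨hmeas, ?_⟩
  have hOO : O * O.transpose = 1 := mul_eq_one_comm.1 hO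
  let A : EuclideanSpace ℝ n →L[ℝ] EuclideanSpace ℝ n :=
    LinearMap.toContinuousLinearMap (Matrix.toLpLin 2 2 O.transpose)
  have hA : ∀ x : EuclideanSpace ℝ n, A x = WithLp.toLp 2 (Matrix.vecMul (x.ofLp) O) := by
    intro x
    simp [A, Matrix.toLpLin_apply, Matrix.mulVec_transpose]
  have key : (stdGaussian (EuclideanSpace ℝ n)).map A = stdGaussian (EuclideanSpace ℝ n) := by
    refine stdGaussian_map_coisometry A (fun t => WithLp.toLp 2 (Matrix.mulVec O t.ofLp)) ?_ ?_
    · intro x t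
      rw [hA]
      simp only [EuclideanSpace.inner_eq_star_dotProduct, star_trivial]
      rw [dotProduct_comm, ← Matrix.dotProduct_mulVec, dotProduct_comm]
    · intro t
      have : ‖WithLp.toLp 2 (Matrix.mulVec O t.ofLp)‖ ^ 2 = ‖t‖ ^ 2 := by
        rw [← real_inner_self_eq_norm_sq, ← real_inner_self_eq_norm_sq]
        simp only [EuclideanSpace.inner_eq_star_dotProduct, star_trivial]
        rw [Matrix.dotProduct_mulVec, Matrix.vecMul_mulVec, hO, Matrix.vecMul_one]
      exact (sq_eq_sq₀ (norm_nonneg _) (norm_nonneg _)).1 this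
  have h1 : ((gauss n).map fun x => Matrix.vecMul x O).map (WithLp.toLp 2)
      = (gauss n).map (WithLp.toLp 2) := by
    rw [map_toLp_gauss, ← key, ← map_toLp_gauss, Measure.map_map (by fun_prop) hmeas,
      Measure.map_map (by fun_prop) (by fun_prop)]
    congr 1
    ext1 x
    simp [hA]
  have hid : ∀ μ : Measure (n → ℝ),
      (μ.map (WithLp.toLp 2)).map (WithLp.ofLp : EuclideanSpace ℝ n → n → ℝ) = μ := by
    intro μ
    rw [Measure.map_map (by fun_prop) (by fun_prop)]
    exact Measure.map_id
  rw [← hid (Measure.map _ _), h1, hid]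

lemma measurePreserving_mul_right [DecidableEq n] {O : Matrix n n ℝ} (hO : O.transpose * O = 1) :
    MeasurePreserving (fun (X : n → n → ℝ) a b => (Matrix.of X * O) a b)
      (gaussMat n) (gaussMat n) :=
  measurePreserving_pi _ _ fun _ => measurePreserving_vecMul hO

lemma measurePreserving_transpose :
    MeasurePreserving (fun (X : n → n → ℝ) a b => X b a) (gaussMat n) (gaussMat n) := by
  have hsw : MeasurePreserving (fun (Z : n × n → ℝ) (p : n × n) => Z p.swap)
      (Measure.pi fun _ => gaussianReal 0 1) (Measure.pi fun _ => gaussianReal 0 1) :=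
    measurePreserving_piCongrLeft (fun _ : n × n => gaussianReal 0 1) (Equiv.prodComm n n)
  have hc : MeasurePreserving (fun (Z : n × n → ℝ) a b => Z (a, b))
      (Measure.pi fun _ => gaussianReal 0 1) (gaussMat n) := by
    refine ⟨by fun_prop, ?_⟩
    have := Measure.infinitePi_map_curry (fun _ _ : n => gaussianReal 0 1)
    simp only [Measure.infinitePi_eq_pi] at this
    exact this
  have hc' : MeasurePreserving (fun (X : n → n → ℝ) (p : n × n) => X p.1 p.2)
      (gaussMat n) (Measure.pi fun _ => gaussianReal 0 1) := by
    refine ⟨by fun_prop, ?_⟩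
    rw [← hc.map_eq, Measure.map_map (by fun_prop) (by fun_prop)]
    exact Measure.map_id
  exact hc.comp (hsw.comp hc')

end Gaussian

section Resample

variable {ι : Type*} [Fintype ι] [DecidableEq ι] {α : Type*} [MeasurableSpace α]
  (μ : Measure α) [IsProbabilityMeasure μ]

lemma measurePreserving_update (c : ι) :
    MeasurePreserving (fun p : (ι → α) × α => Function.update p.1 c p.2)
      ((Measure.pi fun _ => μ).prod μ) (Measure.pi fun _ => μ) := by
  have hm : Measurable (fun p : (ι → α) × α => Function.update p.1 c p.2) := by
    refine measurable_pi_iff.2 fun i => ?_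
    by_cases h : i = c
    · subst h; simpa using measurable_snd
    · simp only [Function.update_of_ne h]; fun_prop
  refine ⟨hm, (Measure.pi_eq fun s hs => ?_).symm⟩
  rw [Measure.map_apply hm (MeasurableSet.univ_pi hs)]
  have : (fun p : (ι → α) × α => Function.update p.1 c p.2) ⁻¹' Set.pi Set.univ s
      = (Set.pi Set.univ (Function.update s c Set.univ)) ×ˢ s c := by
    ext ⟨x, y⟩
    simp only [Set.mem_preimage, Set.mem_pi, Set.mem_univ, true_imp_iff, Set.mem_prod]
    constructor
    · intro h
      refine ⟨fun i => ?_, by simpa using h c⟩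
      by_cases hi : i = c
      · subst hi; simp
      · simpa [hi] using h i
    · rintro ⟨h, h'⟩ i
      by_cases hi : i = c
      · subst hi; simpa using h'
      · simpa [hi] using h i
  rw [this, Measure.prod_prod, Measure.pi_pi, ← Finset.prod_erase_mul _ _ (Finset.mem_univ c),
    ← Finset.prod_erase_mul _ (fun i => μ (s i)) (Finset.mem_univ c)]
  simp only [Function.update_self, measure_univ, mul_one]
  congr 1
  exact Finset.prod_congr rfl fun i hi => by rw [Function.update_of_ne (Finset.ne_of_mem_erase hi)]

lemma lintegral_resample (c : ι) (f : (ι → α) → ℝ≥0∞) (hf : Measurable f) :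
    ∫⁻ x, f x ∂(Measure.pi fun _ => μ)
      = ∫⁻ x, ∫⁻ y, f (Function.update x c y) ∂μ ∂(Measure.pi fun _ => μ) := by
  have h := measurePreserving_update μ c
  rw [← h.lintegral_comp hf]
  exact lintegral_prod _ (hf.comp h.measurable).aemeasurable

lemma ae_of_ae_resample (c : ι) {p : (ι → α) → Prop} (hp : MeasurableSet {x | p x})
    (h : ∀ᵐ x ∂(Measure.pi fun _ => μ), ∀ᵐ y ∂μ, p (Function.update x c y)) :
    ∀ᵐ x ∂(Measure.pi fun _ : ι => μ), p x := by
  have hm := measurePreserving_update μ c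
  rw [← hm.map_eq, ae_map_iff hm.measurable.aemeasurable hp]
  exact (Measure.ae_prod_iff_ae_ae (hm.measurable hp)).2 h

end Resample

section Chi

/-- Moment of order `t` of the norm of a standard Gaussian vector in dimension `d`. -/
noncomputable def chiMoment (d : ℕ) (t : ℝ) : ℝ≥0∞ :=
  ∫⁻ y, ENNReal.ofReal ‖y‖ ^ t ∂stdGaussian (EuclideanSpace ℝ (Fin d))

variable {n : Type*} [Fintype n] [DecidableEq n]

lemma lintegral_distSpan (v : n → EuclideanSpace ℝ n) {L : Finset n} (hv : vol v L ≠ 0)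
    (g : ℝ → ℝ≥0∞) (hg : Measurable g) :
    ∫⁻ x, g (distSpan v L x) ∂stdGaussian (EuclideanSpace ℝ n)
      = ∫⁻ y, g ‖y‖ ∂stdGaussian (EuclideanSpace ℝ (Fin (Fintype.card n - L.card))) := by
  set W := Submodule.span ℝ (v '' L) with hW
  have hdimW : Module.finrank ℝ W = L.card := by
    have := finrank_span_eq_card (R := ℝ) (b := fun a : L => v a)
      ((vol_ne_zero_iff_linearIndependent v L).1 hv)
    rw [hW, ← Fintype.card_coe L, ← this]
    have hset : v '' L = Set.range fun a : L => v a := by ext x; simp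
    rw [hset]
  have hdim : Module.finrank ℝ Wᗮ = Fintype.card n - L.card := by
    have := W.finrank_add_finrank_orthogonal
    rw [hdimW, finrank_euclideanSpace] at this
    omega
  let e : Wᗮ ≃ₗᵢ[ℝ] EuclideanSpace ℝ (Fin (Fintype.card n - L.card)) :=
    ((stdOrthonormalBasis ℝ Wᗮ).reindex (finCongr hdim)).repr
  let A : EuclideanSpace ℝ n →L[ℝ] EuclideanSpace ℝ (Fin (Fintype.card n - L.card)) :=
    e.toContinuousLinearEquiv.toContinuousLinearMap ∘L Wᗮ.orthogonalProjectionOnto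
  have hA : (stdGaussian (EuclideanSpace ℝ n)).map A = stdGaussian _ := by
    refine stdGaussian_map_coisometry A (fun t => (e.symm t : EuclideanSpace ℝ n)) ?_ ?_
    · intro x t
      have : ⟪e (Wᗮ.orthogonalProjectionOnto x), t⟫_ℝ
          = ⟪Wᗮ.orthogonalProjectionOnto x, e.symm t⟫_ℝ := by
        rw [← e.inner_map_map, e.apply_symm_apply]
      exact this.trans (Submodule.inner_orthogonalProjectionOnto_eq_of_mem_right _ _)
    · intro t
      exact (e.symm.norm_map t)
  rw [← hA, lintegral_map (by fun_prop) (by fun_prop)]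
  refine lintegral_congr fun x => ?_
  congr 1
  change _ = ‖e (Wᗮ.orthogonalProjectionOnto x)‖
  rw [e.norm_map]
  rfl

lemma ae_norm_ne_zero {d : ℕ} (hd : d ≠ 0) :
    ∀ᵐ y ∂stdGaussian (EuclideanSpace ℝ (Fin d)), ‖y‖ ≠ 0 := by
  have : Nonempty (Fin d) := Fin.pos_iff_nonempty.1 (Nat.pos_of_ne_zero hd)
  have hms : MeasurableSet {y : EuclideanSpace ℝ (Fin d) | ‖y‖ ≠ 0} :=
    (measurableSet_eq_fun (by fun_prop) (by fun_prop)).compl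
  rw [← map_toLp_gauss, ae_map_iff (by fun_prop) hms]
  have h0 : ∀ᵐ x ∂gauss (Fin d), x ≠ 0 := by
    have : NullSingletonClass (gaussianReal 0 1) := nullSingletonClass_gaussianReal one_ne_zero
    have : NullSingletonClass (gauss (Fin d)) := by
      unfold gauss
      exact Measure.pi_nullSingletonClass (Classical.arbitrary _)
    exact Measure.ae_ne _ _
  filter_upwards [h0] with x hx h
  exact hx (by simpa using norm_eq_zero.1 h)

lemma ae_distSpan_ne_zero (v : n → EuclideanSpace ℝ n) {L : Finset n} (hv : vol v L ≠ 0)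
    (hL : L.card < Fintype.card n) :
    ∀ᵐ x ∂stdGaussian (EuclideanSpace ℝ n), distSpan v L x ≠ 0 := by
  have hg : Measurable (Set.indicator {(0 : ℝ)} (fun _ => (1 : ℝ≥0∞))) :=
    measurable_const.indicator (measurableSet_singleton 0)
  have h := lintegral_distSpan v hv _ hg
  have h0 : ∫⁻ y, Set.indicator {(0 : ℝ)} (fun _ => (1 : ℝ≥0∞)) ‖y‖
      ∂stdGaussian (EuclideanSpace ℝ (Fin (Fintype.card n - L.card))) = 0 := by
    rw [lintegral_eq_zero_iff (by fun_prop)]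
    filter_upwards [ae_norm_ne_zero (d := Fintype.card n - L.card) (by omega)] with y hy
    exact Set.indicator_of_notMem (by simpa using hy) _
  have hcont : Measurable (fun x => distSpan v L x) := by unfold distSpan; fun_prop
  rw [h0, lintegral_eq_zero_iff (by fun_prop)] at h
  filter_upwards [h] with x hx h'
  simp [h'] at hx

end Chi

section Peel

variable {n : Type*} [Fintype n] [DecidableEq n]

@[fun_prop]
lemma continuous_pm (S : Finset n) : Continuous (pm S : Matrix n n ℝ → ℝ) := by
  refine Continuous.matrix_det (continuous_pi fun a => continuous_pi fun b => ?_)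
  by_cases ha : a ∈ S
  · simp only [mix, Matrix.of_apply, ha, if_true]; fun_prop
  · simp only [mix, Matrix.of_apply, ha, if_false]; fun_prop

@[fun_prop]
lemma continuous_rowVol (S : Finset n) : Continuous (rowVol S : Matrix n n ℝ → ℝ) := by
  have : (rowVol S : Matrix n n ℝ → ℝ) = fun M => √(pm S (M * M.transpose)) :=
    funext fun M => rowVol_eq S M
  rw [this]; fun_prop

@[fun_prop]
lemma continuous_colVol (S : Finset n) : Continuous (colVol S : Matrix n n ℝ → ℝ) := by
  unfold colVol; fun_prop

lemma continuous_mix (T : Finset n) (B : Matrix n n ℝ) :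
    Continuous (fun X : n → n → ℝ => mix T (Matrix.of X) B) := by
  refine continuous_pi fun a => continuous_pi fun b => ?_
  by_cases ha : a ∈ T
  · simp only [mix, Matrix.of_apply, ha, if_true]; fun_prop
  · simp only [mix, Matrix.of_apply, ha, if_false]; fun_prop

lemma peel_row (T : Finset n) (B : Matrix n n ℝ) {S L : Finset n} {c : n} (hSL : S ⊆ L)
    (hc : c ∉ L) (hcT : c ∈ T)
    (hL : ∀ᵐ X ∂gaussMat n, rowVol L (mix T (Matrix.of X) B) ≠ 0) :
    (∀ᵐ X ∂gaussMat n, rowVol (insert c L) (mix T (Matrix.of X) B) ≠ 0) ∧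
    ∀ t : ℝ, ∫⁻ X, ENNReal.ofReal (rowVol (insert c L) (mix T (Matrix.of X) B) /
        rowVol S (mix T (Matrix.of X) B)) ^ t ∂gaussMat n
      = (∫⁻ X, ENNReal.ofReal (rowVol L (mix T (Matrix.of X) B) /
        rowVol S (mix T (Matrix.of X) B)) ^ t ∂gaussMat n)
        * chiMoment (Fintype.card n - L.card) t := by
  set Y : (n → n → ℝ) → Matrix n n ℝ := fun X => mix T (Matrix.of X) B with hY
  have hYc : Continuous Y := continuous_mix T B
  have hrow : ∀ X y a, a ≠ c → rowVec (Y (Function.update X c y)) a = rowVec (Y X) a := by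
    intro X y a ha
    ext b
    simp [rowVec, hY, mix, Function.update_of_ne ha]
  have hrowc : ∀ X y, rowVec (Y (Function.update X c y)) c = WithLp.toLp 2 y := by
    intro X y
    ext b
    simp [rowVec, hY, mix, hcT]
  have hne : ∀ {R : Finset n}, R ⊆ L → ∀ a ∈ R, a ≠ c := fun hR a ha h => hc (hR (h ▸ ha))
  have hvol : ∀ {R : Finset n}, R ⊆ L → ∀ X y,
      rowVol R (Y (Function.update X c y)) = rowVol R (Y X) := fun hR X y =>
    vol_congr fun a ha => hrow X y a (hne hR a ha)
  have hins : ∀ X y, rowVol (insert c L) (Y (Function.update X c y))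
      = rowVol L (Y X) * distSpan (rowVec (Y X)) L (WithLp.toLp 2 y) := by
    intro X y
    rw [rowVol, vol_insert _ hc, hrowc,
      distSpan_congr (fun a ha => hrow X y a (hne subset_rfl a ha))]
    congr 1
    exact hvol subset_rfl X y
  have hcard : L.card < Fintype.card n :=
    Finset.card_lt_card (Finset.ssubset_univ_iff.2 fun h => hc (h ▸ Finset.mem_univ c))
  constructor
  · refine ae_of_ae_resample (gauss n) c ?_ ?_
    · exact (measurableSet_eq_fun ((continuous_rowVol _).comp hYc).measurable measurable_const).compl
    · filter_upwards [hL] with X hX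
      have := ae_distSpan_ne_zero (rowVec (Y X)) hX hcard
      rw [← map_toLp_gauss] at this
      filter_upwards [ae_of_ae_map (by fun_prop) this] with y hy
      change rowVol (insert c L) (Y (Function.update X c y)) ≠ 0
      rw [hins]
      exact mul_ne_zero hX hy
  · intro t
    have hmeas : ∀ R R' : Finset n, Measurable fun X : n → n → ℝ =>
        ENNReal.ofReal (rowVol R (Y X) / rowVol R' (Y X)) ^ t := by
      intro R R'
      have h1 : Measurable fun X : n → n → ℝ => rowVol R (Y X) :=
        ((continuous_rowVol _).comp hYc).measurable
      have h2 : Measurable fun X : n → n → ℝ => rowVol R' (Y X) :=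
        ((continuous_rowVol _).comp hYc).measurable
      fun_prop
    rw [gaussMat, lintegral_resample (gauss n) c _ (hmeas _ _), ← lintegral_mul_const _ (hmeas _ _)]
    refine lintegral_congr_ae ?_
    filter_upwards [hL] with X hX
    have : ∀ y, ENNReal.ofReal (rowVol (insert c L) (Y (Function.update X c y)) /
        rowVol S (Y (Function.update X c y))) ^ t
        = ENNReal.ofReal (rowVol L (Y X) / rowVol S (Y X)) ^ t *
          ENNReal.ofReal (distSpan (rowVec (Y X)) L (WithLp.toLp 2 y)) ^ t := by
      intro y
      rw [hins, hvol hSL, mul_div_right_comm, ENNReal.ofReal_mul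
        (div_nonneg (rowVol_nonneg _ _) (rowVol_nonneg _ _)),
        ENNReal.mul_rpow_of_ne_top ENNReal.ofReal_ne_top ENNReal.ofReal_ne_top]
    simp_rw [this]
    have hd : Measurable (fun x => distSpan (rowVec (Y X)) L x) := by unfold distSpan; fun_prop
    rw [lintegral_const_mul _ (by fun_prop),
      lintegral_gauss_toLp (fun x => ENNReal.ofReal (distSpan (rowVec (Y X)) L x) ^ t)
        (by fun_prop),
      lintegral_distSpan (rowVec (Y X)) hX (fun r => ENNReal.ofReal r ^ t) (by fun_prop), chiMoment]

/-- Moments of the ratio of the volumes spanned by two nested families of rows. -/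
lemma lintegral_rowVol_ratio (T : Finset n) (B : Matrix n n ℝ) {S L : Finset n} (hSL : S ⊆ L)
    (hT : L \ S ⊆ T) (hS : ∀ᵐ X ∂gaussMat n, rowVol S (mix T (Matrix.of X) B) ≠ 0) :
    (∀ᵐ X ∂gaussMat n, rowVol L (mix T (Matrix.of X) B) ≠ 0) ∧
    ∀ t : ℝ, ∫⁻ X, ENNReal.ofReal (rowVol L (mix T (Matrix.of X) B) /
        rowVol S (mix T (Matrix.of X) B)) ^ t ∂gaussMat n
      = ∏ d ∈ Finset.Ioc (Fintype.card n - L.card) (Fintype.card n - S.card), chiMoment d t := by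
  obtain ⟨D, hD⟩ : ∃ D, D = L \ S := ⟨_, rfl⟩
  induction D using Finset.induction_on generalizing L with
  | empty =>
    have : L = S := (Finset.sdiff_eq_empty_iff_subset.1 hD.symm).antisymm hSL
    subst this
    refine ⟨hS, fun t => ?_⟩
    simp only [Finset.Ioc_self, Finset.prod_empty]
    rw [lintegral_congr_ae (g := fun _ => 1)]
    · simp
    · filter_upwards [hS] with X hX
      simp [div_self hX]
  | insert c D hc ih =>
    have hcL : c ∈ L \ S := hD ▸ Finset.mem_insert_self c D
    have hcL' := Finset.mem_sdiff.1 hcL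
    have hins : L = insert c (L.erase c) := (Finset.insert_erase hcL'.1).symm
    have hS' : S ⊆ L.erase c := fun a ha =>
      Finset.mem_erase.2 ⟨fun h => hcL'.2 (h ▸ ha), hSL ha⟩
    have hD' : D = L.erase c \ S := by
      rw [Finset.erase_sdiff_comm, ← hD, Finset.erase_insert hc]
    obtain ⟨ih1, ih2⟩ := ih hS' ((Finset.sdiff_subset_sdiff (Finset.erase_subset _ _)
      subset_rfl).trans hT) hD'
    obtain ⟨h1, h2⟩ := peel_row T B hS' (Finset.notMem_erase c L) (hT hcL) ih1
    rw [← hins] at h1 h2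
    refine ⟨h1, fun t => ?_⟩
    rw [h2 t, ih2 t]
    have hcard : L.card = (L.erase c).card + 1 := (Finset.card_erase_add_one hcL'.1).symm
    have hle := Finset.card_le_card hS'
    have hle2 : L.card ≤ Fintype.card n := Finset.card_le_univ L
    have hset : Finset.Ioc (Fintype.card n - L.card) (Fintype.card n - S.card)
        = insert (Fintype.card n - (L.erase c).card)
          (Finset.Ioc (Fintype.card n - (L.erase c).card) (Fintype.card n - S.card)) := by
      ext d
      simp only [Finset.mem_insert, Finset.mem_Ioc]
      omega
    rw [hset, Finset.prod_insert (by simp), mul_comm]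

lemma mix_univ (X B : Matrix n n ℝ) : mix Finset.univ X B = X := by
  ext a b; simp [mix]

lemma ae_rowVol_ne_zero (L : Finset n) : ∀ᵐ X ∂gaussMat n, rowVol L (Matrix.of X) ≠ 0 := by
  have := (lintegral_rowVol_ratio (n := n) Finset.univ 1 (Finset.empty_subset L)
    (Finset.subset_univ _) (by simp [rowVol, vol_empty])).1
  simpa only [mix_univ] using this

lemma ae_det_ne_zero : ∀ᵐ X ∂gaussMat n, (Matrix.of X).det ≠ 0 := by
  filter_upwards [ae_rowVol_ne_zero (n := n) Finset.univ] with X hX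
  rw [rowVol_univ] at hX
  simpa using hX

lemma lintegral_rowVol_div (S L : Finset n) (hSL : S ⊆ L) (t : ℝ) :
    ∫⁻ X, ENNReal.ofReal (rowVol L (Matrix.of X) / rowVol S (Matrix.of X)) ^ t ∂gaussMat n
      = ∏ d ∈ Finset.Ioc (Fintype.card n - L.card) (Fintype.card n - S.card), chiMoment d t := by
  have h := (lintegral_rowVol_ratio (n := n) Finset.univ 1 hSL (Finset.subset_univ _)
    (by simpa only [mix_univ] using ae_rowVol_ne_zero S)).2 t
  simpa only [mix_univ] using h

lemma lintegral_colVol_div (S L : Finset n) (hSL : S ⊆ L) (t : ℝ) :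
    ∫⁻ X, ENNReal.ofReal (colVol L (Matrix.of X) / colVol S (Matrix.of X)) ^ t ∂gaussMat n
      = ∏ d ∈ Finset.Ioc (Fintype.card n - L.card) (Fintype.card n - S.card), chiMoment d t := by
  rw [← lintegral_rowVol_div S L hSL t, ← measurePreserving_transpose.lintegral_comp]
  · rfl
  · have h1 : Measurable fun X : n → n → ℝ => rowVol L (Matrix.of X) :=
      Continuous.measurable (by fun_prop)
    have h2 : Measurable fun X : n → n → ℝ => rowVol S (Matrix.of X) :=
      Continuous.measurable (by fun_prop)
    fun_prop

lemma pm_moment (S : Finset n) :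
    (∀ᵐ X ∂gaussMat n, pm S (Matrix.of X) ≠ 0) ∧
    ∀ t : ℝ, ∫⁻ X, ENNReal.ofReal |pm S (Matrix.of X)| ^ t ∂gaussMat n
      = ∏ d ∈ Finset.Ioc 0 S.card, chiMoment d t := by
  have h1 : ∀ X : Matrix n n ℝ, rowVol Sᶜ (mix S X 1) = 1 := by
    intro X
    refine vol_orthonormal _ _ fun a ha b hb => ?_
    have ha : a ∉ S := by simpa using ha
    have hb : b ∉ S := by simpa using hb
    rw [rowVec, rowVec, mix_of_notMem ha, mix_of_notMem hb]
    simp [PiLp.inner_apply, Matrix.one_apply, eq_comm]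
  have h2 : ∀ X : Matrix n n ℝ, rowVol Finset.univ (mix S X 1) = |pm S X| := fun X =>
    rowVol_univ _
  have h := lintegral_rowVol_ratio (n := n) S 1 (Finset.subset_univ Sᶜ)
    (by simp) (by simp [h1])
  simp only [h1, h2, div_one, Finset.card_univ, Nat.sub_self, Finset.card_compl] at h
  rw [Nat.sub_sub_self (Finset.card_le_univ S)] at h
  simpa using h

end Peel

section Products

lemma lintegral_pi_cons {α : Type*} [MeasurableSpace α] (μ : Measure α) [IsProbabilityMeasure μ]
    {m : ℕ} (F : (Fin (m + 1) → α) → ℝ≥0∞) (hF : Measurable F) :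
    ∫⁻ ω, F ω ∂(Measure.pi fun _ => μ)
      = ∫⁻ ω, ∫⁻ x, F (Fin.cons x ω) ∂μ ∂(Measure.pi fun _ : Fin m => μ) := by
  have h := (measurePreserving_piFinSuccAbove (fun _ : Fin (m + 1) => μ) 0).symm
  rw [← h.lintegral_comp hF]
  have hm := hF.comp (MeasurableEquiv.piFinSuccAbove (fun _ : Fin (m + 1) => α) 0).symm.measurable
  refine (lintegral_prod_symm' _ hm).trans ?_
  refine lintegral_congr fun ω => lintegral_congr fun x => ?_
  simp [MeasurableEquiv.piFinSuccAbove, Fin.consEquiv]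

variable {n : Type*} [Fintype n] [DecidableEq n]

/-- The law of `m` independent matrices with independent standard Gaussian entries. -/
noncomputable def gaussTuple (n : Type*) [Fintype n] (m : ℕ) : Measure (Fin m → n → n → ℝ) :=
  Measure.pi fun _ => gaussMat n

instance (m : ℕ) : IsProbabilityMeasure (gaussTuple n m) := by
  unfold gaussTuple; infer_instance

/-- The product of a tuple of matrices. -/
noncomputable def matProd {m : ℕ} (ω : Fin m → n → n → ℝ) : Matrix n n ℝ :=
  (List.ofFn fun i => Matrix.of (ω i)).prod

@[simp] lemma matProd_zero (ω : Fin 0 → n → n → ℝ) : matProd ω = 1 := by simp [matProd]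

@[simp] lemma matProd_cons {m : ℕ} (x : n → n → ℝ) (ω : Fin m → n → n → ℝ) :
    matProd (Fin.cons x ω : Fin (m + 1) → n → n → ℝ) = Matrix.of x * matProd ω := by
  simp [matProd, List.ofFn_succ]

@[fun_prop]
lemma continuous_matProd {m : ℕ} :
    Continuous (matProd : (Fin m → n → n → ℝ) → Matrix n n ℝ) := by
  unfold matProd
  refine (continuous_list_prod (List.ofFn fun i : Fin m => i) (f := fun i (ω : Fin m → n → n → ℝ) =>
    Matrix.of (ω i)) fun i _ => by fun_prop).congr fun ω => ?_
  simp [List.map_ofFn]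
  rfl

lemma lintegral_gaussTuple_succ {m : ℕ} (F : Matrix n n ℝ → ℝ≥0∞)
    (hF : Measurable fun ω : Fin (m + 1) → n → n → ℝ => F (matProd ω)) :
    ∫⁻ ω, F (matProd ω) ∂gaussTuple n (m + 1)
      = ∫⁻ ω, ∫⁻ X, F (Matrix.of X * matProd ω) ∂gaussMat n ∂gaussTuple n m := by
  refine (lintegral_pi_cons (gaussMat n) _ hF).trans ?_
  simp only [matProd_cons]
  rfl

lemma ae_det_matProd_ne_zero (m : ℕ) : ∀ᵐ ω ∂gaussTuple n m, (matProd ω).det ≠ 0 := by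
  have : ∀ i, ∀ᵐ ω ∂gaussTuple n m, (Matrix.of (ω i)).det ≠ 0 := fun i =>
    (measurePreserving_eval (fun _ : Fin m => gaussMat n) i).quasiMeasurePreserving.ae ae_det_ne_zero
  filter_upwards [ae_all_iff.2 this] with ω hω
  rw [matProd, ← Matrix.coe_detMonoidHom, map_list_prod]
  refine List.prod_ne_zero ?_
  simpa [List.mem_ofFn] using hω

lemma colVol_one (S : Finset n) : colVol S (1 : Matrix n n ℝ) = 1 := by
  rw [colVol, Matrix.transpose_one]
  refine vol_orthonormal _ _ fun a _ b _ => ?_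
  simp [rowVec, PiLp.inner_apply, Matrix.one_apply, eq_comm]

lemma lintegral_rotate {A : Matrix n n ℝ} (hA : A.det ≠ 0) (S : Finset n)
    (Φ : ℝ → ℝ → ℝ → ℝ≥0∞) (hΦ : Measurable fun p : ℝ × ℝ × ℝ => Φ p.1 p.2.1 p.2.2) :
    ∫⁻ X, Φ (colVol S (Matrix.of X * A)) |pm S (Matrix.of X * A)| |(Matrix.of X * A).det| ∂gaussMat n
      = ∫⁻ X, Φ (colVol S (Matrix.of X) * colVol S A) (|pm S (Matrix.of X)| * colVol S A)
          (|(Matrix.of X).det| * |A.det|) ∂gaussMat n := by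
  obtain ⟨O, hO, h⟩ := exists_rotation hA S
  have hm : Measurable fun X : n → n → ℝ => Φ (colVol S (Matrix.of X) * colVol S A)
      (|pm S (Matrix.of X)| * colVol S A) (|(Matrix.of X).det| * |A.det|) := by
    have hc : Continuous fun X : n → n → ℝ => ((colVol S (Matrix.of X) * colVol S A,
      |pm S (Matrix.of X)| * colVol S A, |(Matrix.of X).det| * |A.det|) : ℝ × ℝ × ℝ) := by fun_prop
    exact hΦ.comp hc.measurable
  rw [← (measurePreserving_mul_right hO).lintegral_comp hm]
  refine lintegral_congr fun X => ?_
  obtain ⟨h1, h2, h3⟩ := h (Matrix.of X)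
  rw [h1, h2, h3]
  rfl

end Products

section Moments

variable {n : Type*} [Fintype n] [DecidableEq n]

lemma lintegral_pm_det_succ (S : Finset n) (a b : ℝ) (m : ℕ) :
    ∫⁻ ω, ENNReal.ofReal |pm S (matProd ω)| ^ a * ENNReal.ofReal |(matProd ω).det| ^ b
        ∂gaussTuple n (m + 1)
      = (∫⁻ X, ENNReal.ofReal |pm S (Matrix.of X)| ^ a * ENNReal.ofReal |(Matrix.of X).det| ^ b
          ∂gaussMat n) *
        ∫⁻ ω, ENNReal.ofReal (colVol S (matProd ω)) ^ a * ENNReal.ofReal |(matProd ω).det| ^ b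
          ∂gaussTuple n m := by
  have hc1 : Continuous fun ω : Fin (m + 1) → n → n → ℝ => |pm S (matProd ω)| := by fun_prop
  have hc2 : Continuous fun ω : Fin (m + 1) → n → n → ℝ => |(matProd ω).det| := by fun_prop
  have hc3 : Continuous fun ω : Fin m → n → n → ℝ => colVol S (matProd ω) := by fun_prop
  have hc4 : Continuous fun ω : Fin m → n → n → ℝ => |(matProd ω).det| := by fun_prop
  have hc5 : Continuous fun X : n → n → ℝ => |pm S (Matrix.of X)| := by fun_prop
  have hc6 : Continuous fun X : n → n → ℝ => |(Matrix.of X).det| := by fun_prop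
  have := hc1.measurable
  have := hc2.measurable
  have := hc3.measurable
  have := hc4.measurable
  have := hc5.measurable
  have := hc6.measurable
  rw [lintegral_gaussTuple_succ (fun P => ENNReal.ofReal |pm S P| ^ a * ENNReal.ofReal |P.det| ^ b)
    (by fun_prop), ← lintegral_const_mul _ (by fun_prop)]
  refine lintegral_congr_ae ?_
  filter_upwards [ae_det_matProd_ne_zero (n := n) m] with ω hω
  rw [lintegral_rotate hω S (fun _ y z => ENNReal.ofReal y ^ a * ENNReal.ofReal z ^ b)
    (by fun_prop), ← lintegral_mul_const _ (by fun_prop)]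
  refine lintegral_congr fun X => ?_
  rw [ENNReal.ofReal_mul (abs_nonneg _), ENNReal.ofReal_mul (abs_nonneg _),
    ENNReal.mul_rpow_of_ne_top ENNReal.ofReal_ne_top ENNReal.ofReal_ne_top,
    ENNReal.mul_rpow_of_ne_top ENNReal.ofReal_ne_top ENNReal.ofReal_ne_top, mul_mul_mul_comm]

lemma lintegral_colVol_det (S : Finset n) (a b : ℝ) (m : ℕ) :
    ∫⁻ ω, ENNReal.ofReal (colVol S (matProd ω)) ^ a * ENNReal.ofReal |(matProd ω).det| ^ b
        ∂gaussTuple n m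
      = (∫⁻ X, ENNReal.ofReal (colVol S (Matrix.of X)) ^ a * ENNReal.ofReal |(Matrix.of X).det| ^ b
          ∂gaussMat n) ^ m := by
  induction m with
  | zero => simp [colVol_one]
  | succ m ih =>
    have hc1 : Continuous fun ω : Fin (m + 1) → n → n → ℝ => colVol S (matProd ω) := by fun_prop
    have hc2 : Continuous fun ω : Fin (m + 1) → n → n → ℝ => |(matProd ω).det| := by fun_prop
    have hc3 : Continuous fun ω : Fin m → n → n → ℝ => colVol S (matProd ω) := by fun_prop
    have hc4 : Continuous fun ω : Fin m → n → n → ℝ => |(matProd ω).det| := by fun_prop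
    have hc5 : Continuous fun X : n → n → ℝ => colVol S (Matrix.of X) := by fun_prop
    have hc6 : Continuous fun X : n → n → ℝ => |(Matrix.of X).det| := by fun_prop
    have := hc1.measurable
    have := hc2.measurable
    have := hc3.measurable
    have := hc4.measurable
    have := hc5.measurable
    have := hc6.measurable
    rw [pow_succ', ← ih, lintegral_gaussTuple_succ
      (fun P => ENNReal.ofReal (colVol S P) ^ a * ENNReal.ofReal |P.det| ^ b)
      (by fun_prop), ← lintegral_const_mul _ (by fun_prop)]
    refine lintegral_congr_ae ?_
    filter_upwards [ae_det_matProd_ne_zero (n := n) m] with ω hω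
    rw [lintegral_rotate hω S (fun y _ z => ENNReal.ofReal y ^ a * ENNReal.ofReal z ^ b)
      (by fun_prop), ← lintegral_mul_const _ (by fun_prop)]
    refine lintegral_congr fun X => ?_
    rw [ENNReal.ofReal_mul (colVol_nonneg _ _), ENNReal.ofReal_mul (abs_nonneg _),
      ENNReal.mul_rpow_of_ne_top ENNReal.ofReal_ne_top ENNReal.ofReal_ne_top,
      ENNReal.mul_rpow_of_ne_top ENNReal.ofReal_ne_top ENNReal.ofReal_ne_top, mul_mul_mul_comm]

/-- The moments of the ratio of the volume of a family of columns to the absolute determinant. -/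
lemma lintegral_colVol_det_ratio (S : Finset n) (t : ℝ) :
    ∫⁻ X, ENNReal.ofReal (colVol S (Matrix.of X)) ^ (-t) * ENNReal.ofReal |(Matrix.of X).det| ^ t
      ∂gaussMat n = ∏ d ∈ Finset.Ioc 0 (Fintype.card n - S.card), chiMoment d t := by
  have h := lintegral_colVol_div S Finset.univ (Finset.subset_univ S) t
  rw [Finset.card_univ, Nat.sub_self] at h
  rw [← h]
  refine lintegral_congr_ae ?_
  filter_upwards [ae_det_ne_zero (n := n)] with X hX
  have hu : colVol Finset.univ (Matrix.of X) = |(Matrix.of X).det| := by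
    rw [colVol, rowVol_univ, Matrix.det_transpose]
  have hS : 0 < colVol S (Matrix.of X) := (colVol_nonneg _ _).lt_of_ne' (colVol_ne_zero hX S)
  rw [hu, div_eq_mul_inv, ENNReal.ofReal_mul (abs_nonneg _), ENNReal.ofReal_inv_of_pos hS,
    ENNReal.mul_rpow_of_ne_zero, ENNReal.inv_rpow, ENNReal.rpow_neg, mul_comm]
  · simpa using hX
  · simp

lemma lintegral_colVol_moment (S : Finset n) (t : ℝ) :
    ∫⁻ X, ENNReal.ofReal (colVol S (Matrix.of X)) ^ t ∂gaussMat n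
      = ∏ d ∈ Finset.Ioc (Fintype.card n - S.card) (Fintype.card n), chiMoment d t := by
  have h := lintegral_colVol_div ∅ S (Finset.empty_subset S) t
  simpa [colVol, rowVol, vol_empty] using h

end Moments

section ChiMoments

lemma lintegral_rpow_le_rpow_lintegral {α : Type*} [MeasurableSpace α] {μ : Measure α}
    [IsProbabilityMeasure μ] {f : α → ℝ≥0∞} (hf : Measurable f) {p : ℝ} (h0 : 0 ≤ p) (h1 : p ≤ 1) :
    ∫⁻ a, f a ^ p ∂μ ≤ (∫⁻ a, f a ∂μ) ^ p := by
  have := ENNReal.lintegral_mul_norm_pow_le (μ := μ) hf.aemeasurable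
    (measurable_const (a := (1 : ℝ≥0∞))).aemeasurable h0 (sub_nonneg.2 h1) (by ring)
  simpa using this

lemma lintegral_norm_succ (d : ℕ) (g : ℝ → ℝ≥0∞) (hg : Measurable g) :
    ∫⁻ z, g ‖z‖ ∂stdGaussian (EuclideanSpace ℝ (Fin (d + 1)))
      = ∫⁻ y, ∫⁻ x, g √(x ^ 2 + ‖y‖ ^ 2) ∂gaussianReal 0 1
          ∂stdGaussian (EuclideanSpace ℝ (Fin d)) := by
  rw [← lintegral_gauss_toLp (fun z => g ‖z‖) (by fun_prop)]
  have hm : Measurable fun y : EuclideanSpace ℝ (Fin d) =>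
      ∫⁻ x, g √(x ^ 2 + ‖y‖ ^ 2) ∂gaussianReal 0 1 := by
    refine Measurable.lintegral_prod_right' (f := fun p : EuclideanSpace ℝ (Fin d) × ℝ =>
      g √(p.2 ^ 2 + ‖p.1‖ ^ 2)) ?_
    fun_prop
  rw [← lintegral_gauss_toLp (fun y : EuclideanSpace ℝ (Fin d) =>
    ∫⁻ x, g √(x ^ 2 + ‖y‖ ^ 2) ∂gaussianReal 0 1) hm]
  refine (lintegral_pi_cons (gaussianReal 0 1) (fun z => g ‖(WithLp.toLp 2 z :
    EuclideanSpace ℝ (Fin (d + 1)))‖) (by fun_prop)).trans ?_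
  refine lintegral_congr fun y => lintegral_congr fun x => ?_
  congr 1
  rw [EuclideanSpace.norm_eq, Fin.sum_univ_succ, EuclideanSpace.norm_sq_eq]
  simp

lemma chiMoment_zero_exp (d : ℕ) : chiMoment d 0 = 1 := by simp [chiMoment]

lemma chiMoment_succ_le {d : ℕ} {s : ℝ} (hs : 0 ≤ s) :
    chiMoment (d + 1) (-s) ≤ chiMoment d (-s) := by
  unfold chiMoment
  rw [lintegral_norm_succ d (fun r => ENNReal.ofReal r ^ (-s)) (by fun_prop)]
  refine lintegral_mono fun y => ?_
  refine (lintegral_mono (g := fun _ => ENNReal.ofReal ‖y‖ ^ (-s)) fun x => ?_).trans (by simp)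
  simp only [ENNReal.rpow_neg]
  gcongr
  exact Real.le_sqrt_of_sq_le (by nlinarith [sq_nonneg x])

lemma lintegral_sq_gaussianReal : ∫⁻ x, ENNReal.ofReal (x ^ 2) ∂gaussianReal 0 1 = 1 := by
  have hi : Integrable (fun x : ℝ => x ^ 2) (gaussianReal 0 1) :=
    (memLp_id_gaussianReal 2).integrable_sq
  rw [← ofReal_integral_eq_lintegral_ofReal hi (ae_of_all _ fun x => sq_nonneg x)]
  have h := variance_id_gaussianReal (μ := 0) (v := 1)
  rw [variance_eq_integral (by fun_prop)] at h
  simp only [id, integral_id_gaussianReal, sub_zero] at h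
  rw [h]; simp

lemma chiMoment_two (d : ℕ) : chiMoment d 2 = d := by
  induction d with
  | zero =>
    simp [chiMoment, Subsingleton.elim _ (0 : EuclideanSpace ℝ (Fin 0))]
  | succ d ih =>
    unfold chiMoment at ih ⊢
    rw [lintegral_norm_succ d (fun r => ENNReal.ofReal r ^ (2 : ℝ)) (by fun_prop)]
    have : ∀ y : EuclideanSpace ℝ (Fin d), ∫⁻ x, ENNReal.ofReal √(x ^ 2 + ‖y‖ ^ 2) ^ (2 : ℝ)
        ∂gaussianReal 0 1 = 1 + ENNReal.ofReal ‖y‖ ^ (2 : ℝ) := by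
      intro y
      have h : ∀ x : ℝ, ENNReal.ofReal √(x ^ 2 + ‖y‖ ^ 2) ^ (2 : ℝ)
          = ENNReal.ofReal (x ^ 2) + ENNReal.ofReal ‖y‖ ^ (2 : ℝ) := by
        intro x
        rw [ENNReal.rpow_two, ENNReal.rpow_two, ← ENNReal.ofReal_pow (Real.sqrt_nonneg _),
          ← ENNReal.ofReal_pow (norm_nonneg _), Real.sq_sqrt (by positivity),
          ENNReal.ofReal_add (by positivity) (by positivity)]
      simp_rw [h]
      rw [lintegral_add_right _ measurable_const, lintegral_sq_gaussianReal]
      simp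
    simp_rw [this]
    rw [lintegral_add_left measurable_const, ih]
    simp [add_comm]

lemma chiMoment_le_rpow (d : ℕ) {t : ℝ} (h0 : 0 ≤ t) (h2 : t ≤ 2) :
    chiMoment d t ≤ (d : ℝ≥0∞) ^ (t / 2) := by
  rw [← chiMoment_two d]
  refine le_trans (le_of_eq ?_) (lintegral_rpow_le_rpow_lintegral (p := t / 2) (by fun_prop)
    (by linarith) (by linarith))
  unfold chiMoment
  refine lintegral_congr fun y => ?_
  rw [← ENNReal.rpow_mul]
  congr 1; ring

lemma chiMoment_neg_le_rpow (d : ℕ) {t : ℝ} (h0 : 0 ≤ t) (h2 : t ≤ 2) :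
    chiMoment d (-t) ≤ (chiMoment d (-2)) ^ (t / 2) := by
  refine le_trans (le_of_eq ?_) (lintegral_rpow_le_rpow_lintegral (p := t / 2) (by fun_prop)
    (by linarith) (by linarith))
  unfold chiMoment
  refine lintegral_congr fun y => ?_
  rw [← ENNReal.rpow_mul]
  congr 1; ring

lemma lintegral_exp_neg_sq_gaussianReal {l : ℝ} (hl : 0 ≤ l) :
    ∫⁻ x, ENNReal.ofReal (Real.exp (-l * x ^ 2 / 2)) ∂gaussianReal 0 1
      = ENNReal.ofReal ((1 + l) ^ (-1 / 2 : ℝ)) := by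
  have hl1 : 0 < 1 + l := by linarith
  let v : NNReal := ⟨(1 + l)⁻¹, by positivity⟩
  have hv : (v : ℝ) = (1 + l)⁻¹ := rfl
  have hv0 : v ≠ 0 := by
    intro h
    have := congrArg NNReal.toReal h
    rw [hv] at this
    exact (inv_ne_zero hl1.ne') (by simpa using this)
  rw [gaussianReal_of_var_ne_zero _ one_ne_zero,
    lintegral_withDensity_eq_lintegral_mul _ (measurable_gaussianPDF _ _) (by fun_prop)]
  have : ∀ x : ℝ, (gaussianPDF 0 1 * fun x => ENNReal.ofReal (Real.exp (-l * x ^ 2 / 2))) x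
      = ENNReal.ofReal ((1 + l) ^ (-1 / 2 : ℝ)) * gaussianPDF 0 v x := by
    intro x
    simp only [Pi.mul_apply, gaussianPDF, gaussianPDFReal]
    rw [← ENNReal.ofReal_mul (by positivity), ← ENNReal.ofReal_mul (by positivity)]
    congr 1
    rw [hv, mul_assoc, ← Real.exp_add]
    have h1 : (1 + l) ^ (-1 / 2 : ℝ) = (√(1 + l))⁻¹ := by
      rw [Real.sqrt_eq_rpow, ← Real.rpow_neg hl1.le]; norm_num
    rw [h1, ← mul_assoc]
    congr 1
    · rw [← mul_inv, ← Real.sqrt_mul hl1.le]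
      congr 2
      field_simp
      simp
    · congr 1
      field_simp
      simp
      ring
  simp_rw [this]
  rw [lintegral_const_mul _ (measurable_gaussianPDF _ _), lintegral_gaussianPDF_eq_one _ hv0,
    mul_one]

lemma lintegral_exp_neg_norm_sq (d : ℕ) {l : ℝ} (hl : 0 ≤ l) :
    ∫⁻ y, ENNReal.ofReal (Real.exp (-l * ‖y‖ ^ 2 / 2)) ∂stdGaussian (EuclideanSpace ℝ (Fin d))
      = ENNReal.ofReal ((1 + l) ^ (-(d : ℝ) / 2)) := by
  have hl1 : 0 < 1 + l := by linarith
  induction d with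
  | zero => simp [Subsingleton.elim _ (0 : EuclideanSpace ℝ (Fin 0))]
  | succ d ih =>
    rw [lintegral_norm_succ d (fun r => ENNReal.ofReal (Real.exp (-l * r ^ 2 / 2))) (by fun_prop)]
    have : ∀ y : EuclideanSpace ℝ (Fin d), ∫⁻ x, ENNReal.ofReal
        (Real.exp (-l * √(x ^ 2 + ‖y‖ ^ 2) ^ 2 / 2)) ∂gaussianReal 0 1
        = ENNReal.ofReal ((1 + l) ^ (-1 / 2 : ℝ)) *
          ENNReal.ofReal (Real.exp (-l * ‖y‖ ^ 2 / 2)) := by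
      intro y
      rw [← lintegral_exp_neg_sq_gaussianReal hl, ← lintegral_mul_const _ (by fun_prop)]
      refine lintegral_congr fun x => ?_
      rw [← ENNReal.ofReal_mul (Real.exp_nonneg _), ← Real.exp_add, Real.sq_sqrt (by positivity)]
      congr 2; ring
    simp_rw [this]
    rw [lintegral_const_mul _ (by fun_prop), ih, ← ENNReal.ofReal_mul (by positivity),
      ← Real.rpow_add hl1]
    congr 2; push_cast; ring

lemma lintegral_Ioi_exp_half {r : ℝ} (hr : 0 < r) :
    ∫⁻ l in Set.Ioi (0 : ℝ), ENNReal.ofReal (Real.exp (-l * r ^ 2 / 2)) * 2⁻¹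
      = ENNReal.ofReal r ^ (-2 : ℝ) := by
  have hneg : -(r ^ 2 / 2) < 0 := by have := pow_pos hr 2; linarith
  have h := integral_exp_mul_Ioi hneg 0
  have hi := integrableOn_exp_mul_Ioi hneg 0
  rw [lintegral_mul_const _ (by fun_prop)]
  have : ∀ l : ℝ, -l * r ^ 2 / 2 = -(r ^ 2 / 2) * l := fun l => by ring
  simp_rw [this]
  rw [← ofReal_integral_eq_lintegral_ofReal hi (ae_of_all _ fun x => Real.exp_nonneg _), h,
    ENNReal.rpow_neg, ENNReal.rpow_two, ← ENNReal.ofReal_pow hr.le,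
    ← ENNReal.ofReal_inv_of_pos (by positivity)]
  have h2 : (2⁻¹ : ℝ≥0∞) = ENNReal.ofReal 2⁻¹ := by
    rw [ENNReal.ofReal_inv_of_pos (by norm_num)]; simp
  rw [h2, ← ENNReal.ofReal_mul (by simp; positivity)]
  congr 1
  simp
  field_simp

lemma lintegral_Ioi_one_add_rpow {a : ℝ} (ha : 1 < a) :
    ∫⁻ l in Set.Ioi (0 : ℝ), ENNReal.ofReal ((1 + l) ^ (-a)) = ENNReal.ofReal (1 / (a - 1)) := by
  have hd : ∀ x ∈ Set.Ici (0 : ℝ), HasDerivAt (fun l => -(1 / (a - 1)) * (1 + l) ^ (1 - a))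
      ((1 + x) ^ (-a)) x := by
    intro x hx
    have hx' : (0 : ℝ) < 1 + x := by have := Set.mem_Ici.1 hx; linarith
    have h := ((hasDerivAt_id x).const_add 1).rpow_const (p := 1 - a) (Or.inl hx'.ne')
    have ha1 : a - 1 ≠ 0 := by linarith
    refine (h.const_mul (-(1 / (a - 1)))).congr_deriv ?_
    simp only [id]
    rw [show 1 - a - 1 = -a by ring]
    field_simp
    ring
  have hpos : ∀ x ∈ Set.Ioi (0 : ℝ), 0 ≤ (1 + x) ^ (-a) := fun x hx =>
    Real.rpow_nonneg (by have := Set.mem_Ioi.1 hx; linarith) _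
  have ht : Tendsto (fun l : ℝ => -(1 / (a - 1)) * (1 + l) ^ (1 - a)) atTop (nhds 0) := by
    have h1 : Tendsto (fun l : ℝ => (1 + l) ^ (-(a - 1))) atTop (nhds 0) :=
      (tendsto_rpow_neg_atTop (by linarith)).comp (tendsto_atTop_add_const_left _ _ tendsto_id)
    simpa using h1.const_mul (-(1 / (a - 1)))
  have hintegr := integrableOn_Ioi_deriv_of_nonneg' hd hpos ht
  rw [← ofReal_integral_eq_lintegral_ofReal hintegr
    ((ae_restrict_iff' measurableSet_Ioi).2 (ae_of_all _ hpos)),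
    integral_Ioi_of_hasDerivAt_of_nonneg' hd hpos ht]
  simp

lemma chiMoment_neg_two {d : ℕ} (hd : 3 ≤ d) :
    chiMoment d (-2) = ENNReal.ofReal (1 / ((d : ℝ) - 2)) := by
  have hd' : (3 : ℝ) ≤ d := by exact_mod_cast hd
  unfold chiMoment
  rw [lintegral_congr_ae (g := fun y => ∫⁻ l in Set.Ioi (0 : ℝ),
    ENNReal.ofReal (Real.exp (-l * ‖y‖ ^ 2 / 2)) * 2⁻¹)]
  · rw [lintegral_lintegral_swap (by fun_prop)]
    have : ∀ l ∈ Set.Ioi (0 : ℝ), ∫⁻ y : EuclideanSpace ℝ (Fin d),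
        ENNReal.ofReal (Real.exp (-l * ‖y‖ ^ 2 / 2)) * 2⁻¹ ∂stdGaussian _
        = ENNReal.ofReal ((1 + l) ^ (-((d : ℝ) / 2))) * 2⁻¹ := by
      intro l hl
      rw [lintegral_mul_const _ (by fun_prop), lintegral_exp_neg_norm_sq d (Set.mem_Ioi.1 hl).le,
        neg_div]
    rw [setLIntegral_congr_fun measurableSet_Ioi this, lintegral_mul_const _ (by fun_prop),
      lintegral_Ioi_one_add_rpow (by linarith)]
    have h2 : (2⁻¹ : ℝ≥0∞) = ENNReal.ofReal 2⁻¹ := by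
      rw [ENNReal.ofReal_inv_of_pos (by norm_num)]; simp
    rw [h2, ← ENNReal.ofReal_mul (by apply div_nonneg <;> linarith)]
    congr 1
    have : (d : ℝ) - 2 ≠ 0 := by linarith
    have : (d : ℝ) / 2 - 1 ≠ 0 := by linarith
    field_simp
  · filter_upwards [ae_norm_ne_zero (d := d) (by omega)] with y hy
    exact (lintegral_Ioi_exp_half ((norm_nonneg y).lt_of_ne' hy)).symm

end ChiMoments

section ChiLog

lemma gaussianReal_le_volume : gaussianReal 0 1 ≤ (volume : Measure ℝ) := by
  rw [gaussianReal_of_var_ne_zero _ one_ne_zero]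
  calc volume.withDensity (gaussianPDF 0 1) ≤ volume.withDensity 1 := by
        refine withDensity_mono (ae_of_all _ fun x => ?_)
        rw [gaussianPDF, gaussianPDFReal, Pi.one_apply, ENNReal.ofReal_le_one]
        refine mul_le_one₀ (inv_le_one_of_one_le₀ ?_) (Real.exp_nonneg _) (Real.exp_le_one_iff.2 ?_)
        · rw [Real.one_le_sqrt]
          simp
          nlinarith [Real.pi_gt_three]
        · simp only [sub_zero, NNReal.coe_one, mul_one]
          nlinarith [sq_nonneg x]
    _ = volume := withDensity_one

lemma lintegral_abs_rpow_neg_lt_top {s : ℝ} (h0 : 0 ≤ s) (h1 : s < 1) :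
    ∫⁻ x, ENNReal.ofReal |x| ^ (-s) ∂gaussianReal 0 1 < ⊤ := by
  set G : ℝ → ℝ≥0∞ := (Set.Ioc (0 : ℝ) 1).indicator fun x => ENNReal.ofReal x ^ (-s) with hG
  have hGm : Measurable G := Measurable.indicator (by fun_prop) measurableSet_Ioc
  have hGfin : ∫⁻ x, G x ∂gaussianReal 0 1 < ⊤ := by
    refine (lintegral_mono' gaussianReal_le_volume le_rfl).trans_lt ?_
    rw [hG, lintegral_indicator measurableSet_Ioc]
    have h := (intervalIntegrable_iff_integrableOn_Ioc_of_le zero_le_one).1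
      (intervalIntegral.intervalIntegrable_rpow' (a := 0) (b := 1) (r := -s) (by linarith))
    refine lt_of_eq_of_lt ?_ h.2
    refine setLIntegral_congr_fun measurableSet_Ioc fun x hx => ?_
    simp only
    rw [ENNReal.ofReal_rpow_of_pos hx.1, Real.enorm_eq_ofReal (Real.rpow_nonneg hx.1.le _)]
  have hsym : ∫⁻ x, G (-x) ∂gaussianReal 0 1 = ∫⁻ x, G x ∂gaussianReal 0 1 := by
    have h : (gaussianReal 0 1).map (fun x => -x) = gaussianReal 0 1 := by
      rw [gaussianReal_map_neg]; simp
    conv_rhs => rw [← h, lintegral_map hGm (by fun_prop)]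
  have hbound : ∀ᵐ x ∂gaussianReal 0 1, ENNReal.ofReal |x| ^ (-s) ≤ (G x + G (-x)) + 1 := by
    have : NullSingletonClass (gaussianReal 0 1) := nullSingletonClass_gaussianReal one_ne_zero
    filter_upwards [Measure.ae_ne (gaussianReal 0 1) 0] with x hx
    by_cases h : |x| ≤ 1
    · rcases lt_or_gt_of_ne hx with hx' | hx'
      · have : G (-x) = ENNReal.ofReal |x| ^ (-s) := by
          rw [abs_of_neg hx'] at h ⊢
          exact Set.indicator_of_mem (Set.mem_Ioc.2 ⟨by linarith, h⟩) _
        rw [← this]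
        exact le_trans le_add_self le_self_add
      · have : G x = ENNReal.ofReal |x| ^ (-s) := by
          rw [abs_of_pos hx'] at h ⊢
          exact Set.indicator_of_mem (Set.mem_Ioc.2 ⟨by linarith, h⟩) _
        rw [← this]
        exact le_trans le_self_add le_self_add
    · refine le_trans ?_ le_add_self
      rw [ENNReal.rpow_neg]
      refine ENNReal.inv_le_one.2 ?_
      have h1 : (1 : ℝ≥0∞) ≤ ENNReal.ofReal |x| := by rw [ENNReal.one_le_ofReal]; linarith
      simpa using ENNReal.rpow_le_rpow h1 h0
  refine (lintegral_mono_ae hbound).trans_lt ?_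
  rw [lintegral_add_right _ measurable_const, lintegral_add_left hGm, hsym]
  simp [hGfin]

lemma chiMoment_lt_top {d : ℕ} (hd : d ≠ 0) {t : ℝ} (h1 : -1 < t) (h2 : t ≤ 2) :
    chiMoment d t < ⊤ := by
  rcases le_total 0 t with h0 | h0
  · refine (chiMoment_le_rpow d h0 h2).trans_lt ?_
    exact ENNReal.rpow_lt_top_of_nonneg (by linarith) (ENNReal.natCast_ne_top d)
  · obtain ⟨s, rfl⟩ : ∃ s, t = -s := ⟨-t, by ring⟩
    obtain ⟨k, rfl⟩ := Nat.exists_eq_succ_of_ne_zero hd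
    clear hd
    induction k with
    | zero =>
      rw [chiMoment, lintegral_norm_succ 0 (fun r => ENNReal.ofReal r ^ (-s)) (by fun_prop)]
      have : ∀ y : EuclideanSpace ℝ (Fin 0), ‖y‖ = 0 := fun y => by
        simp [Subsingleton.elim y 0]
      simpa [this, Real.sqrt_sq_eq_abs] using
        lintegral_abs_rpow_neg_lt_top (s := s) (by linarith) (by linarith)
    | succ k ih => exact (chiMoment_succ_le (by linarith)).trans_lt ih

/-- The real-valued moment of order `t` of the norm of a standard Gaussian vector. -/
noncomputable def chiReal (d : ℕ) (t : ℝ) : ℝ := (chiMoment d t).toReal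

lemma ofReal_chiReal {d : ℕ} (hd : d ≠ 0) {t : ℝ} (h1 : -1 < t) (h2 : t ≤ 2) :
    ENNReal.ofReal (chiReal d t) = chiMoment d t :=
  ENNReal.ofReal_toReal (chiMoment_lt_top hd h1 h2).ne

lemma chiReal_zero (d : ℕ) : chiReal d 0 = 1 := by simp [chiReal, chiMoment_zero_exp]

lemma exp_mul_log_norm_ae {d : ℕ} (hd : d ≠ 0) (t : ℝ) :
    ∀ᵐ y ∂stdGaussian (EuclideanSpace ℝ (Fin d)),
      ENNReal.ofReal (Real.exp (t * Real.log ‖y‖)) = ENNReal.ofReal ‖y‖ ^ t := by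
  filter_upwards [ae_norm_ne_zero hd] with y hy
  have hy' : 0 < ‖y‖ := (norm_nonneg y).lt_of_ne' hy
  rw [ENNReal.ofReal_rpow_of_pos hy', Real.rpow_def_of_pos hy', mul_comm]

lemma mem_integrableExpSet_log_norm {d : ℕ} (hd : d ≠ 0) {t : ℝ} (h1 : -1 < t) (h2 : t ≤ 2) :
    t ∈ integrableExpSet (fun y => Real.log ‖y‖) (stdGaussian (EuclideanSpace ℝ (Fin d))) := by
  refine ⟨Measurable.aestronglyMeasurable (by fun_prop), ?_⟩
  rw [hasFiniteIntegral_iff_ofReal (ae_of_all _ fun _ => Real.exp_nonneg _),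
    lintegral_congr_ae (exp_mul_log_norm_ae hd t)]
  exact chiMoment_lt_top hd h1 h2

lemma mgf_log_norm {d : ℕ} (hd : d ≠ 0) :
    mgf (fun y => Real.log ‖y‖) (stdGaussian (EuclideanSpace ℝ (Fin d))) = chiReal d := by
  ext t
  rw [mgf, integral_eq_lintegral_of_nonneg_ae (ae_of_all _ fun _ => Real.exp_nonneg _)
    (Measurable.aestronglyMeasurable (by fun_prop)), lintegral_congr_ae (exp_mul_log_norm_ae hd t)]
  rfl

lemma zero_mem_interior_integrableExpSet {d : ℕ} (hd : d ≠ 0) :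
    0 ∈ interior (integrableExpSet (fun y => Real.log ‖y‖)
      (stdGaussian (EuclideanSpace ℝ (Fin d)))) := by
  refine mem_interior.2 ⟨Set.Ioo (-1) 1, fun t ht => ?_, isOpen_Ioo, by norm_num⟩
  exact mem_integrableExpSet_log_norm hd ht.1 (by linarith [ht.2])

/-- The expected logarithm of the norm of a standard Gaussian vector. -/
noncomputable def chiLog (d : ℕ) : ℝ :=
  ∫ y, Real.log ‖y‖ ∂stdGaussian (EuclideanSpace ℝ (Fin d))

lemma integrable_log_norm {d : ℕ} (hd : d ≠ 0) :
    Integrable (fun y => Real.log ‖y‖) (stdGaussian (EuclideanSpace ℝ (Fin d))) :=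
  memLp_one_iff_integrable.1
    (memLp_of_mem_interior_integrableExpSet (zero_mem_interior_integrableExpSet hd) 1)

lemma hasDerivAt_chiReal {d : ℕ} (hd : d ≠ 0) : HasDerivAt (chiReal d) (chiLog d) 0 := by
  have h := hasDerivAt_mgf (zero_mem_interior_integrableExpSet hd)
  rw [mgf_log_norm hd] at h
  simpa [chiLog] using h

lemma chiReal_pos {d : ℕ} (hd : d ≠ 0) {t : ℝ} (h1 : -1 < t) (h2 : t ≤ 2) : 0 < chiReal d t := by
  rw [← mgf_log_norm hd]
  exact mgf_pos (mem_integrableExpSet_log_norm hd h1 h2)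

lemma map_norm_succ (d : ℕ) :
    (stdGaussian (EuclideanSpace ℝ (Fin (d + 1)))).map (fun z => ‖z‖)
      = ((stdGaussian (EuclideanSpace ℝ (Fin d))).prod (gaussianReal 0 1)).map
          fun p => √(p.2 ^ 2 + ‖p.1‖ ^ 2) := by
  refine Measure.ext_of_lintegral _ fun g hg => ?_
  rw [lintegral_map hg (by fun_prop), lintegral_map hg (by fun_prop), lintegral_norm_succ d g hg,
    lintegral_prod _ (by fun_prop)]

lemma chiLog_lt_succ {d : ℕ} (hd : d ≠ 0) : chiLog d < chiLog (d + 1) := by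
  set μ := stdGaussian (EuclideanSpace ℝ (Fin d))
  set γ := gaussianReal 0 1
  have h1 : chiLog (d + 1) = ∫ p, Real.log √(p.2 ^ 2 + ‖p.1‖ ^ 2) ∂(μ.prod γ) := by
    rw [chiLog, ← integral_map (φ := fun z : EuclideanSpace ℝ (Fin (d + 1)) => ‖z‖)
      (f := Real.log) (by fun_prop) (by fun_prop), map_norm_succ,
      integral_map (by fun_prop) (by fun_prop)]
  have hi1 : Integrable (fun p : EuclideanSpace ℝ (Fin d) × ℝ =>
      Real.log √(p.2 ^ 2 + ‖p.1‖ ^ 2)) (μ.prod γ) := by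
    have := integrable_log_norm (d := d + 1) (by omega)
    rw [show (fun y : EuclideanSpace ℝ (Fin (d + 1)) => Real.log ‖y‖)
      = Real.log ∘ (fun z => ‖z‖) from rfl,
      ← integrable_map_measure (by fun_prop) (by fun_prop), map_norm_succ,
      integrable_map_measure (by fun_prop) (by fun_prop)] at this
    exact this
  have hi2 : Integrable (fun p : EuclideanSpace ℝ (Fin d) × ℝ => Real.log ‖p.1‖) (μ.prod γ) :=
    (integrable_log_norm hd).comp_fst γ
  have h2 : chiLog d = ∫ p, Real.log ‖p.1‖ ∂(μ.prod γ) := by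
    rw [integral_prod _ hi2]; simp [chiLog, γ, μ]
  have hae : ∀ᵐ p ∂(μ.prod γ), 0 < Real.log √(p.2 ^ 2 + ‖p.1‖ ^ 2) - Real.log ‖p.1‖ := by
    have : NullSingletonClass γ := nullSingletonClass_gaussianReal one_ne_zero
    have e1 : ∀ᵐ p ∂(μ.prod γ), ‖p.1‖ ≠ 0 :=
      Measure.quasiMeasurePreserving_fst.ae (ae_norm_ne_zero hd)
    have e2 : ∀ᵐ p ∂(μ.prod γ), p.2 ≠ 0 :=
      Measure.quasiMeasurePreserving_snd.ae (Measure.ae_ne γ 0)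
    filter_upwards [e1, e2] with p hp1 hp2
    have hp : 0 < ‖p.1‖ := (norm_nonneg _).lt_of_ne' hp1
    refine sub_pos.2 (Real.log_lt_log hp (Real.lt_sqrt_of_sq_lt ?_))
    have : 0 < p.2 ^ 2 := by positivity
    linarith
  rw [← sub_pos, h1, h2, ← integral_sub hi1 hi2]
  rw [integral_pos_iff_support_of_nonneg_ae (hae.mono fun p hp => hp.le) (hi1.sub hi2)]
  have : (Function.support fun p : EuclideanSpace ℝ (Fin d) × ℝ =>
      Real.log √(p.2 ^ 2 + ‖p.1‖ ^ 2) - Real.log ‖p.1‖) =ᵐ[μ.prod γ] Set.univ :=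
    eventuallyEq_univ.2 (hae.mono fun p hp => hp.ne')
  rw [measure_congr this]
  simp

lemma eventually_neg_of_hasDerivAt {G : ℝ → ℝ} {c : ℝ} (h : HasDerivAt G c 0) (h0 : G 0 = 0)
    (hc : c < 0) : ∀ᶠ s in nhdsWithin (0 : ℝ) (Set.Ioi 0), G s < 0 := by
  have ht := (hasDerivAt_iff_tendsto_slope.1 h).mono_left
    (nhdsWithin_mono 0 (fun x (hx : 0 < x) => hx.ne'))
  filter_upwards [ht.eventually (gt_mem_nhds hc), self_mem_nhdsWithin] with s hs hs0
  rw [slope_def_field, h0, sub_zero, sub_zero] at hs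
  have hs0 : 0 < s := hs0
  rcases div_neg_iff.1 hs with h' | h'
  · linarith [h'.2]
  · exact h'.1

lemma exists_good_exponent {j : ℕ} (hj : j ≠ 0) : ∃ s : ℝ, 0 < s ∧ s ≤ 1 / 4 ∧
    chiReal (j + 1) (-s) < chiReal j (-s) ∧
    √(chiReal (j + 1) (-s) / chiReal j (-s)) *
      ((∏ d ∈ Finset.Ioc 0 j, chiReal d s) * ∏ d ∈ Finset.Ioc 0 j, chiReal d (-s)) < 1 := by
  have hneg : ∀ {d : ℕ}, d ≠ 0 → HasDerivAt (fun s => chiReal d (-s)) (-chiLog d) 0 := by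
    intro d hd
    have h := hasDerivAt_chiReal hd
    rw [← neg_zero] at h
    exact (h.comp (0 : ℝ) (hasDerivAt_neg' (0 : ℝ))).congr_deriv (by ring)
  have hlt := chiLog_lt_succ hj
  have hA := eventually_neg_of_hasDerivAt
    (G := fun s => chiReal (j + 1) (-s) - chiReal j (-s)) ((hneg (Nat.succ_ne_zero j)).sub (hneg hj))
    (by simp [chiReal_zero]) (by linarith)
  have hw : ∀ d ∈ Finset.Ioc 0 j, HasDerivAt (fun s => (chiReal d s * chiReal d (-s)) ^ 2) 0 0 := by
    intro d hd
    have hd0 : d ≠ 0 := by have := Finset.mem_Ioc.1 hd; omega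
    have := ((hasDerivAt_chiReal hd0).fun_mul (hneg hd0)).fun_pow 2
    refine this.congr_deriv ?_
    simp [chiReal_zero]
  have hprod : HasDerivAt (fun s => ∏ d ∈ Finset.Ioc 0 j, (chiReal d s * chiReal d (-s)) ^ 2) 0 0 := by
    refine (HasDerivAt.fun_finsetProd hw).congr_deriv ?_
    simp
  have hB := eventually_neg_of_hasDerivAt
    (G := fun s => chiReal (j + 1) (-s) *
      (∏ d ∈ Finset.Ioc 0 j, (chiReal d s * chiReal d (-s)) ^ 2) - chiReal j (-s))
    (((hneg (Nat.succ_ne_zero j)).fun_mul hprod).fun_sub (hneg hj))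
    (by simp [chiReal_zero]) (by simp [chiReal_zero]; linarith)
  have hC : ∀ᶠ s in nhdsWithin (0 : ℝ) (Set.Ioi 0), s < 1 / 4 :=
    nhdsWithin_le_nhds (gt_mem_nhds (by norm_num))
  obtain ⟨s, ⟨⟨hs1, hs2⟩, hs3⟩, hs0⟩ := (((hA.and hB).and hC).and self_mem_nhdsWithin).exists
  have hs0 : 0 < s := hs0
  have hv : 0 < chiReal j (-s) := chiReal_pos hj (by linarith) (by linarith)
  have hv' : 0 < chiReal (j + 1) (-s) := chiReal_pos (by omega) (by linarith) (by linarith)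
  refine ⟨s, hs0, hs3.le, by linarith, ?_⟩
  rw [← Finset.prod_mul_distrib]
  set W := ∏ d ∈ Finset.Ioc 0 j, chiReal d s * chiReal d (-s) with hW
  have hWp : 0 < W := Finset.prod_pos fun d hd => by
    have hd0 : d ≠ 0 := by have := Finset.mem_Ioc.1 hd; omega
    exact mul_pos (chiReal_pos hd0 (by linarith) (by linarith))
      (chiReal_pos hd0 (by linarith) (by linarith))
  rw [Finset.prod_pow, ← hW] at hs2
  refine lt_of_pow_lt_pow_left₀ 2 zero_le_one ?_
  rw [mul_pow, Real.sq_sqrt (by positivity), one_pow, div_mul_eq_mul_div, div_lt_one hv]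
  linarith

lemma chiReal_anti {s : ℝ} (h0 : 0 ≤ s) (h1 : s < 1) {d e : ℕ} (hd : d ≠ 0) (hde : d ≤ e) :
    chiReal e (-s) ≤ chiReal d (-s) := by
  induction e, hde using Nat.le_induction with
  | base => exact le_rfl
  | succ e he ih =>
    refine le_trans ?_ ih
    exact ENNReal.toReal_mono (chiMoment_lt_top (by omega) (by linarith) (by linarith)).ne
      (chiMoment_succ_le h0)

end ChiLog

section PolyBound

lemma chiMoment_mul_neg_le {d : ℕ} (hd : 3 ≤ d) {s : ℝ} (h0 : 0 ≤ s) (h1 : s ≤ 1) :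
    chiMoment d (2 * s) * chiMoment d (-(2 * s)) ≤ ENNReal.ofReal ((d : ℝ) / ((d : ℝ) - 2)) := by
  have hd' : (3 : ℝ) ≤ d := by exact_mod_cast hd
  have ha := chiMoment_le_rpow d (t := 2 * s) (by linarith) (by linarith)
  have hb := chiMoment_neg_le_rpow d (t := 2 * s) (by linarith) (by linarith)
  rw [chiMoment_neg_two hd] at hb
  refine (mul_le_mul' ha hb).trans ?_
  rw [← ENNReal.ofReal_natCast, ← ENNReal.mul_rpow_of_nonneg _ _ (by linarith),
    ← ENNReal.ofReal_mul (by positivity)]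
  have hge : (1 : ℝ≥0∞) ≤ ENNReal.ofReal ((d : ℝ) * (1 / ((d : ℝ) - 2))) := by
    rw [ENNReal.one_le_ofReal, mul_one_div, one_le_div (by linarith)]
    linarith
  calc _ ≤ ENNReal.ofReal ((d : ℝ) * (1 / ((d : ℝ) - 2))) ^ (1 : ℝ) :=
        ENNReal.rpow_le_rpow_of_exponent_le hge (by linarith)
    _ = _ := by rw [ENNReal.rpow_one, mul_one_div]

lemma prod_chiMoment_mul_neg_le {s : ℝ} (h0 : 0 ≤ s) (h1 : s ≤ 1 / 4) :
    ∃ K : ℝ≥0∞, K ≠ ⊤ ∧ ∀ M : ℕ, 2 ≤ M →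
      ∏ d ∈ Finset.Ioc 0 M, chiMoment d (2 * s) * chiMoment d (-(2 * s))
        ≤ K * ENNReal.ofReal (M * (M - 1)) := by
  refine ⟨∏ d ∈ Finset.Ioc 0 2, chiMoment d (2 * s) * chiMoment d (-(2 * s)), ?_, ?_⟩
  · refine ENNReal.prod_ne_top fun d hd => ?_
    have hd0 : d ≠ 0 := by have := Finset.mem_Ioc.1 hd; omega
    exact ENNReal.mul_ne_top (chiMoment_lt_top hd0 (by linarith) (by linarith)).ne
      (chiMoment_lt_top hd0 (by linarith) (by linarith)).ne
  · intro M hM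
    induction M, hM using Nat.le_induction with
    | base =>
      refine le_mul_of_one_le_right' ?_
      rw [ENNReal.one_le_ofReal]; norm_num
    | succ M hM ih =>
      have hM' : (2 : ℝ) ≤ M := by exact_mod_cast hM
      rw [← Finset.insert_Ioc_right_eq_Ioc_add_one (Nat.zero_le M), Finset.prod_insert (by simp)]
      refine (mul_le_mul' (chiMoment_mul_neg_le (d := M + 1) (by omega) h0 (by linarith)) ih).trans ?_
      rw [mul_left_comm, ← ENNReal.ofReal_mul (by push_cast; apply div_nonneg <;> linarith)]
      refine mul_le_mul' le_rfl (ENNReal.ofReal_le_ofReal ?_)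
      push_cast
      rw [div_mul_eq_mul_div, div_le_iff₀ (by linarith)]
      apply le_of_eq; ring

lemma prod_chiMoment_le {j : ℕ} {s : ℝ} (h0 : 0 ≤ s) (h1 : s ≤ 1 / 4) :
    ∃ K : ℝ≥0∞, K ≠ ⊤ ∧ ∀ N : ℕ, j + 2 ≤ N →
      (∏ d ∈ Finset.Ioc 0 N, chiMoment d (2 * s)) *
        (∏ d ∈ Finset.Ioc 0 (N - j), chiMoment d (-(2 * s))) ≤ K * (N : ℝ≥0∞) ^ (j + 2) := by
  obtain ⟨K, hK, h⟩ := prod_chiMoment_mul_neg_le h0 h1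
  refine ⟨K, hK, fun N hN => ?_⟩
  have hN1 : (1 : ℝ≥0∞) ≤ N := by exact_mod_cast (by omega : 1 ≤ N)
  have hsplit : ∏ d ∈ Finset.Ioc 0 N, chiMoment d (2 * s)
      = (∏ d ∈ Finset.Ioc 0 (N - j), chiMoment d (2 * s)) *
        ∏ d ∈ Finset.Ioc (N - j) N, chiMoment d (2 * s) := by
    rw [Finset.prod_Ioc_consecutive _ (Nat.zero_le _) (Nat.sub_le N j)]
  have htail : ∏ d ∈ Finset.Ioc (N - j) N, chiMoment d (2 * s) ≤ (N : ℝ≥0∞) ^ j := by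
    refine (Finset.prod_le_pow_card _ _ (N : ℝ≥0∞) fun d hd => ?_).trans (le_of_eq ?_)
    · refine (chiMoment_le_rpow d (by linarith) (by linarith)).trans ?_
      have hdN : d ≤ N := (Finset.mem_Ioc.1 hd).2
      calc (d : ℝ≥0∞) ^ (2 * s / 2) ≤ (N : ℝ≥0∞) ^ (2 * s / 2) := by gcongr
        _ ≤ (N : ℝ≥0∞) ^ (1 : ℝ) := ENNReal.rpow_le_rpow_of_exponent_le hN1 (by linarith)
        _ = N := ENNReal.rpow_one _
    · rw [Nat.card_Ioc]; congr 1; omega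
  have hmain := h (N - j) (by omega)
  rw [Finset.prod_mul_distrib] at hmain
  calc _ = ((∏ d ∈ Finset.Ioc 0 (N - j), chiMoment d (2 * s)) *
        (∏ d ∈ Finset.Ioc 0 (N - j), chiMoment d (-(2 * s)))) *
        ∏ d ∈ Finset.Ioc (N - j) N, chiMoment d (2 * s) := by rw [hsplit]; ring
    _ ≤ (K * (N : ℝ≥0∞) ^ 2) * (N : ℝ≥0∞) ^ j := by
        refine mul_le_mul' (hmain.trans (mul_le_mul' le_rfl ?_)) htail
        rw [← ENNReal.ofReal_natCast, ← ENNReal.ofReal_pow (Nat.cast_nonneg _)]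
        refine ENNReal.ofReal_le_ofReal ?_
        have h1 : ((N - j : ℕ) : ℝ) ≤ N := by exact_mod_cast Nat.sub_le N j
        have h2 : (0 : ℝ) ≤ ((N - j : ℕ) : ℝ) := Nat.cast_nonneg _
        nlinarith
    _ = _ := by ring

end PolyBound

section AntiConcentration

lemma gaussianPDFReal_le_inv {v : NNReal} (hv : v ≠ 0) {a x : ℝ} (ha : 0 < a) (hx : a / 2 ≤ |x|) :
    gaussianPDFReal 0 v x ≤ a⁻¹ := by
  have hv' : (0 : ℝ) < v := by exact_mod_cast pos_iff_ne_zero.2 hv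
  set w := √(v : ℝ) with hw
  have hwp : 0 < w := Real.sqrt_pos.2 hv'
  have hw2 : w ^ 2 = v := Real.sq_sqrt hv'.le
  have hsq : a ^ 2 / 4 ≤ x ^ 2 := by
    rw [← sq_abs x]; nlinarith
  have hz : 0 < a / w := by positivity
  have h1 : a / w / 2 ≤ Real.exp (x ^ 2 / (2 * v)) := by
    have h2 : (a / w) ^ 2 / 8 ≤ x ^ 2 / (2 * v) := by
      rw [div_pow, hw2, div_div, div_le_div_iff₀ (by positivity) (by positivity)]
      nlinarith
    have h3 := Real.add_one_le_exp (x ^ 2 / (2 * v))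
    nlinarith [sq_nonneg (a / w - 2)]
  have h4 : 2 * w ≤ √(2 * Real.pi * v) := by
    refine Real.le_sqrt_of_sq_le ?_
    rw [mul_pow, hw2]
    nlinarith [Real.pi_gt_three]
  rw [gaussianPDFReal, sub_zero, neg_div, Real.exp_neg, ← mul_inv]
  refine inv_anti₀ ha ?_
  calc a = (2 * w) * (a / w / 2) := by field_simp
    _ ≤ _ := mul_le_mul h4 h1 (by positivity) (by positivity)

lemma gaussianReal_near_le (v : NNReal) (a : ℝ) {t : ℝ} (h1 : t ≤ 1 / 2) :
    gaussianReal 0 v {x | |a + x| < t * |a|} ≤ ENNReal.ofReal (2 * t) := by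
  rcases eq_or_ne a 0 with rfl | ha
  · have : {x : ℝ | |0 + x| < t * |(0 : ℝ)|} = ∅ := by
      ext x
      simp [(abs_nonneg x).not_gt]
    rw [this, measure_empty]
    exact zero_le
  have ha' : 0 < |a| := abs_pos.2 ha
  rcases eq_or_ne v 0 with rfl | hv
  · have : ¬ |a| < t * |a| := by nlinarith
    rw [gaussianReal_zero_var, Measure.dirac_apply' _
      (measurableSet_lt (by fun_prop) (by fun_prop))]
    simp [this]
  · rw [gaussianReal_apply _ hv]
    have hset : {x | |a + x| < t * |a|} = Set.Ioo (-a - t * |a|) (-a + t * |a|) := by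
      ext x
      simp only [Set.mem_ofPred_eq, abs_lt, Set.mem_Ioo]
      constructor <;> rintro ⟨h, h'⟩ <;> constructor <;> linarith
    calc ∫⁻ x in {x | |a + x| < t * |a|}, gaussianPDF 0 v x
        ≤ ∫⁻ _ in {x | |a + x| < t * |a|}, ENNReal.ofReal |a|⁻¹ := by
          refine setLIntegral_mono measurable_const fun x hx => ENNReal.ofReal_le_ofReal ?_
          refine gaussianPDFReal_le_inv hv ha' ?_
          have hx : |a + x| < t * |a| := hx
          have h2 : |a| ≤ |a + x| + |x| := by
            have := abs_sub (a + x) x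
            simpa using this
          nlinarith
      _ = ENNReal.ofReal (2 * t) := by
          rw [setLIntegral_const, hset, Real.volume_Ioo, ← ENNReal.ofReal_mul (by positivity)]
          congr 1
          field_simp
          ring

variable {n : Type*} [Fintype n] [DecidableEq n]

lemma gauss_linear_near_le (φ : (n → ℝ) →ₗ[ℝ] ℝ) (a : ℝ) {t : ℝ} (h1 : t ≤ 1 / 2) :
    gauss n {y | |a + φ y| < t * |a|} ≤ ENNReal.ofReal (2 * t) := by
  let L : StrongDual ℝ (EuclideanSpace ℝ n) :=
    (LinearMap.toContinuousLinearMap φ).comp (EuclideanSpace.equiv n ℝ).toContinuousLinearMap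
  have hL : ∀ y : n → ℝ, L (WithLp.toLp 2 y) = φ y := fun y => rfl
  have hmap := IsGaussian.map_eq_gaussianReal (μ := stdGaussian (EuclideanSpace ℝ n)) L
  rw [integral_strongDual_stdGaussian] at hmap
  have hms : MeasurableSet {x : ℝ | |a + x| < t * |a|} :=
    measurableSet_lt (by fun_prop) (by fun_prop)
  have h := gaussianReal_near_le (Var[L; stdGaussian (EuclideanSpace ℝ n)]).toNNReal a h1
  rw [← hmap, Measure.map_apply (by fun_prop) hms, ← map_toLp_gauss,
    Measure.map_apply (by fun_prop) (L.continuous.measurable hms)] at h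
  exact h

lemma pm_updateRow_of_notMem {S : Finset n} {c : n} (hc : c ∉ S) (M : Matrix n n ℝ) (w : n → ℝ) :
    pm S (M.updateRow c w) = pm S M := by
  refine pm_congr fun a ha b _ => ?_
  have hac : a ≠ c := fun h => hc (h ▸ ha)
  rw [Matrix.updateRow_ne hac]

lemma exists_pm_updateRow {S : Finset n} {c : n} (hc : c ∈ S) (M : Matrix n n ℝ) :
    ∃ φ : (n → ℝ) →ₗ[ℝ] ℝ, ∀ w, pm S (M.updateRow c w) = φ w := by
  refine ⟨Matrix.detRowAlternating.toMultilinearMap.toLinearMap (mix S M 1) c, fun w => ?_⟩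
  change _ = ((mix S M 1).updateRow c w).det
  rw [pm]
  congr 1
  ext a b
  by_cases ha : a = c
  · subst ha; simp [mix, hc]
  · simp [mix, ha]

lemma of_update_mul (X : n → n → ℝ) (c : n) (y : n → ℝ) (Q : Matrix n n ℝ) :
    Matrix.of (Function.update X c y) * Q
      = (Matrix.of X * Q).updateRow c (Matrix.vecMul y Q) := by
  ext a b
  by_cases ha : a = c
  · subst ha; simp [Matrix.mul_apply, Matrix.vecMul, dotProduct]
  · simp [Matrix.mul_apply, ha]

/-- The sum of the principal minors of size `k` with index set disjoint from `L`. -/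
noncomputable def esymAvoid (k : ℕ) (L : Finset n) (M : Matrix n n ℝ) : ℝ :=
  ∑ S ∈ (Finset.univ.powersetCard k).filter (fun S => Disjoint S L), pm S M

@[fun_prop]
lemma continuous_esymAvoid (k : ℕ) (L : Finset n) :
    Continuous (esymAvoid k L : Matrix n n ℝ → ℝ) := by
  unfold esymAvoid; fun_prop

lemma esymAvoid_compl (C : Finset n) (M : Matrix n n ℝ) :
    esymAvoid (Fintype.card n - C.card) C M = pm Cᶜ M := by
  rw [esymAvoid, Finset.sum_eq_single_of_mem Cᶜ]
  · simp [Finset.mem_powersetCard, Finset.card_compl, disjoint_compl_left]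
  · intro S hS hne
    simp only [Finset.mem_filter, Finset.mem_powersetCard] at hS
    refine absurd (Finset.eq_of_subset_of_card_le ?_ ?_) hne
    · exact Finset.subset_compl_iff_disjoint_right.2 hS.2
    · rw [hS.1.2, Finset.card_compl]

lemma exists_esymAvoid_update (k : ℕ) {L : Finset n} (c : n) (X : n → n → ℝ)
    (Q : Matrix n n ℝ) : ∃ φ : (n → ℝ) →ₗ[ℝ] ℝ, ∀ y,
      esymAvoid k L (Matrix.of (Function.update X c y) * Q)
        = esymAvoid k (insert c L) (Matrix.of X * Q) + φ y := by
  choose! ψ hψ using fun (S : Finset n) (hS : c ∈ S) =>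
    exists_pm_updateRow hS (Matrix.of X * Q)
  refine ⟨(∑ S ∈ ((Finset.univ.powersetCard k).filter (fun S => Disjoint S L)).filter
    (fun S => c ∈ S), ψ S) ∘ₗ Q.vecMulLinear, fun y => ?_⟩
  rw [of_update_mul, esymAvoid, ← Finset.sum_filter_add_sum_filter_not _ (fun S => c ∈ S), add_comm]
  congr 1
  · rw [esymAvoid]
    refine Finset.sum_congr ?_ fun S hS => pm_updateRow_of_notMem
      (Finset.disjoint_insert_right.1 (Finset.mem_filter.1 hS).2).1 _ _
    ext S
    simp only [Finset.mem_filter, Finset.disjoint_insert_right]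
    tauto
  · simp only [LinearMap.comp_apply, LinearMap.sum_apply, Matrix.vecMulLinear_apply]
    exact Finset.sum_congr rfl fun S hS => hψ S (Finset.mem_filter.1 hS).2 _

lemma esymAvoid_insert_update (k : ℕ) {L : Finset n} {c : n} (X : n → n → ℝ)
    (Q : Matrix n n ℝ) (y : n → ℝ) :
    esymAvoid k (insert c L) (Matrix.of (Function.update X c y) * Q)
      = esymAvoid k (insert c L) (Matrix.of X * Q) := by
  rw [of_update_mul]
  refine Finset.sum_congr rfl fun S hS => pm_updateRow_of_notMem ?_ _ _
  simp only [Finset.mem_filter, Finset.disjoint_insert_right] at hS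
  exact hS.2.1

lemma measure_esymAvoid_insert_le (k : ℕ) {L : Finset n} (c : n) (Q : Matrix n n ℝ)
    {t : ℝ} (h1 : t ≤ 1 / 2) :
    gaussMat n {X | |esymAvoid k L (Matrix.of X * Q)| <
      t * |esymAvoid k (insert c L) (Matrix.of X * Q)|} ≤ ENNReal.ofReal (2 * t) := by
  set A : Set (n → n → ℝ) := {X | |esymAvoid k L (Matrix.of X * Q)| <
      t * |esymAvoid k (insert c L) (Matrix.of X * Q)|} with hA
  have hc1 : Continuous fun X : n → n → ℝ => |esymAvoid k L (Matrix.of X * Q)| := by fun_prop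
  have hc2 : Continuous fun X : n → n → ℝ =>
    t * |esymAvoid k (insert c L) (Matrix.of X * Q)| := by fun_prop
  have hAm : MeasurableSet A := measurableSet_lt hc1.measurable hc2.measurable
  rw [← lintegral_indicator_one hAm, gaussMat,
    lintegral_resample (gauss n) c _ (measurable_one.indicator hAm)]
  refine (lintegral_mono (g := fun _ => ENNReal.ofReal (2 * t)) fun X => ?_).trans (by simp)
  obtain ⟨φ, hφ⟩ := exists_esymAvoid_update k (L := L) c X Q
  refine le_trans (le_of_eq ?_)
    (gauss_linear_near_le φ (esymAvoid k (insert c L) (Matrix.of X * Q)) h1)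
  have hms : MeasurableSet {y | |esymAvoid k (insert c L) (Matrix.of X * Q) + φ y| <
      t * |esymAvoid k (insert c L) (Matrix.of X * Q)|} :=
    measurableSet_lt (by have := φ.continuous_of_finiteDimensional; fun_prop) (by fun_prop)
  rw [← lintegral_indicator_one hms]
  refine lintegral_congr fun y => ?_
  have : Function.update X c y ∈ A ↔ y ∈ {y | |esymAvoid k (insert c L) (Matrix.of X * Q) + φ y| <
      t * |esymAvoid k (insert c L) (Matrix.of X * Q)|} := by
    simp only [hA, Set.mem_ofPred_eq]
    rw [hφ, esymAvoid_insert_update]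
  simp only [Set.indicator, this, Pi.one_apply]

lemma measure_esymAvoid_empty_le (k : ℕ) (L : Finset n) (Q : Matrix n n ℝ)
    {t : ℝ} (h0 : 0 ≤ t) (h1 : t ≤ 1 / 2) :
    gaussMat n {X | |esymAvoid k ∅ (Matrix.of X * Q)| <
      t ^ L.card * |esymAvoid k L (Matrix.of X * Q)|} ≤ L.card * ENNReal.ofReal (2 * t) := by
  induction L using Finset.induction_on with
  | empty => simp
  | insert c L hc ih =>
    rw [Finset.card_insert_of_notMem hc]
    calc _ ≤ gaussMat n ({X | |esymAvoid k ∅ (Matrix.of X * Q)| <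
          t ^ L.card * |esymAvoid k L (Matrix.of X * Q)|} ∪
          {X | |esymAvoid k L (Matrix.of X * Q)| <
            t * |esymAvoid k (insert c L) (Matrix.of X * Q)|}) := by
          refine measure_mono fun X hX => ?_
          by_contra hcon
          simp only [Set.mem_union, Set.mem_ofPred_eq, not_or, not_lt] at hcon hX
          have := mul_le_mul_of_nonneg_left hcon.2 (pow_nonneg h0 L.card)
          rw [pow_succ, mul_assoc] at hX
          linarith [hcon.1]
      _ ≤ _ := measure_union_le _ _
      _ ≤ L.card * ENNReal.ofReal (2 * t) + ENNReal.ofReal (2 * t) :=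
          add_le_add ih (measure_esymAvoid_insert_le k c Q h1)
      _ = _ := by push_cast; ring

lemma abs_charpoly_coeff {M : Matrix n n ℝ} {i : ℕ} (hi : i ≤ Fintype.card n) :
    |M.charpoly.coeff i| = |esymAvoid (Fintype.card n - i) ∅ M| := by
  have h := Matrix.charpoly_coeff_eq_sum_minors M (Fintype.card n - i) (Nat.sub_le _ _)
  rw [Nat.sub_sub_self hi] at h
  rw [h, abs_mul, abs_pow, abs_neg, abs_one, one_pow, one_mul, esymAvoid]
  congr 1
  refine Finset.sum_congr ?_ fun S _ => (pm_eq_submatrix S M).symm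
  ext S; simp

/-- With high probability a coefficient of the characteristic polynomial of a product is not much
smaller than any given principal minor contributing to it. -/
lemma measure_coeff_lt_le (m : ℕ) (C : Finset n) {t : ℝ} (h0 : 0 ≤ t) (h1 : t ≤ 1 / 2) :
    gaussTuple n (m + 1) {ω | |(matProd ω).charpoly.coeff C.card| <
      t ^ C.card * |pm Cᶜ (matProd ω)|} ≤ C.card * ENNReal.ofReal (2 * t) := by
  have hC : C.card ≤ Fintype.card n := Finset.card_le_univ C
  set k := Fintype.card n - C.card with hk
  have hset : {ω : Fin (m + 1) → n → n → ℝ | |(matProd ω).charpoly.coeff C.card| <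
      t ^ C.card * |pm Cᶜ (matProd ω)|} = {ω | |esymAvoid k ∅ (matProd ω)| <
      t ^ C.card * |esymAvoid k C (matProd ω)|} := by
    ext ω
    simp only [Set.mem_ofPred_eq]
    rw [abs_charpoly_coeff hC, hk, esymAvoid_compl]
  rw [hset]
  set B : Set (Matrix n n ℝ) := {P | |esymAvoid k ∅ P| < t ^ C.card * |esymAvoid k C P|} with hB
  have hBo : IsOpen B := isOpen_lt (by fun_prop) (by fun_prop)
  have hm : MeasurableSet {ω : Fin (m + 1) → n → n → ℝ | matProd ω ∈ B} :=
    (hBo.preimage continuous_matProd).measurableSet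
  change gaussTuple n (m + 1) {ω | matProd ω ∈ B} ≤ _
  rw [← lintegral_indicator_one hm]
  refine (lintegral_gaussTuple_succ (B.indicator 1) ?_).trans_le ?_
  · exact measurable_one.indicator hm
  · refine (lintegral_mono (g := fun _ => C.card * ENNReal.ofReal (2 * t)) fun ω => ?_).trans
      (by simp)
    refine le_trans (le_of_eq ?_) (measure_esymAvoid_empty_le k C (matProd ω) h0 h1)
    have hc : Continuous fun X : n → n → ℝ => Matrix.of X * matProd ω := by fun_prop
    change _ = gaussMat n ((fun X : n → n → ℝ => Matrix.of X * matProd ω) ⁻¹' B)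
    rw [← lintegral_indicator_one (hBo.preimage hc).measurableSet]
    rfl

end AntiConcentration

section Domination

variable {n : Type*} [Fintype n] [DecidableEq n]

lemma ennreal_sum_rpow_le {ι : Type*} (T : Finset ι) (f : ι → ℝ≥0∞) {s : ℝ} (h0 : 0 < s)
    (h1 : s ≤ 1) : (∑ i ∈ T, f i) ^ s ≤ ∑ i ∈ T, f i ^ s := by
  classical
  induction T using Finset.induction_on with
  | empty => simp [h0]
  | insert a T ha ih =>
    rw [Finset.sum_insert ha, Finset.sum_insert ha]
    exact (ENNReal.rpow_add_le_add_rpow _ _ h0.le h1).trans (by gcongr)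

lemma ofReal_abs_charpoly_coeff_rpow_le (M : Matrix n n ℝ) {i : ℕ} (hi : i ≤ Fintype.card n)
    {s : ℝ} (h0 : 0 < s) (h1 : s ≤ 1) :
    ENNReal.ofReal |M.charpoly.coeff i| ^ s
      ≤ ∑ S ∈ (Finset.univ : Finset n).powersetCard (Fintype.card n - i),
        ENNReal.ofReal (colVol S M) ^ s := by
  have h2 : |M.charpoly.coeff i| ≤
      ∑ S ∈ (Finset.univ : Finset n).powersetCard (Fintype.card n - i), colVol S M := by
    rw [abs_charpoly_coeff hi, esymAvoid]
    simp only [Finset.disjoint_empty_right, Finset.filter_true]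
    exact (Finset.abs_sum_le_sum_abs _ _).trans
      (Finset.sum_le_sum fun S _ => abs_pm_le_colVol S M)
  calc _ ≤ (∑ S ∈ (Finset.univ : Finset n).powersetCard (Fintype.card n - i),
        ENNReal.ofReal (colVol S M)) ^ s := by
        rw [← ENNReal.ofReal_sum_of_nonneg fun S _ => colVol_nonneg S M]
        gcongr
    _ ≤ _ := ennreal_sum_rpow_le _ _ h0 h1

lemma lintegral_coeff_ratio_le (m : ℕ) {i : ℕ} (hi : i ≤ Fintype.card n)
    {s : ℝ} (h0 : 0 < s) (h1 : s ≤ 1) :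
    ∫⁻ ω, ENNReal.ofReal |(matProd ω).charpoly.coeff i| ^ s *
        ENNReal.ofReal |(matProd ω).det| ^ (-s) ∂gaussTuple n m
      ≤ (Fintype.card n).choose i * (∏ d ∈ Finset.Ioc 0 i, chiMoment d (-s)) ^ m := by
  have hc1 : ∀ S : Finset n, Continuous fun ω : Fin m → n → n → ℝ => colVol S (matProd ω) := by
    intro S; fun_prop
  have hc2 : Continuous fun ω : Fin m → n → n → ℝ => |(matProd ω).det| := by fun_prop
  calc _ ≤ ∫⁻ ω, ∑ S ∈ (Finset.univ : Finset n).powersetCard (Fintype.card n - i),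
        ENNReal.ofReal (colVol S (matProd ω)) ^ s *
          ENNReal.ofReal |(matProd ω).det| ^ (-s) ∂gaussTuple n m := by
        refine lintegral_mono fun ω => ?_
        rw [← Finset.sum_mul]
        gcongr
        exact ofReal_abs_charpoly_coeff_rpow_le _ hi h0 h1
    _ = ∑ S ∈ (Finset.univ : Finset n).powersetCard (Fintype.card n - i),
        (∏ d ∈ Finset.Ioc 0 i, chiMoment d (-s)) ^ m := by
        refine (lintegral_finsetSum _ fun S _ =>
          ((hc1 S).measurable.ennreal_ofReal.pow_const _).mul
            (hc2.measurable.ennreal_ofReal.pow_const _)).trans ?_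
        refine Finset.sum_congr rfl fun S hS => ?_
        have h := lintegral_colVol_det_ratio S (-s)
        rw [neg_neg, (Finset.mem_powersetCard.1 hS).2, Nat.sub_sub_self hi] at h
        exact (lintegral_colVol_det S s (-s) m).trans (by rw [h])
    _ = _ := by
        rw [Finset.sum_const, Finset.card_powersetCard, Finset.card_univ, Nat.choose_symm hi,
          nsmul_eq_mul]

lemma lintegral_det_ratio_le (m : ℕ) (S : Finset n) (s : ℝ) :
    ∫⁻ ω, ENNReal.ofReal |pm S (matProd ω)| ^ (-s) * ENNReal.ofReal |(matProd ω).det| ^ s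
        ∂gaussTuple n (m + 1)
      ≤ ((∏ d ∈ Finset.Ioc 0 (Fintype.card n), chiMoment d (2 * s)) *
          ∏ d ∈ Finset.Ioc 0 S.card, chiMoment d (-(2 * s))) ^ (1 / 2 : ℝ) *
        (∏ d ∈ Finset.Ioc 0 (Fintype.card n - S.card), chiMoment d s) ^ m := by
  rw [lintegral_pm_det_succ, lintegral_colVol_det, lintegral_colVol_det_ratio]
  gcongr
  have hc1 : Continuous fun X : n → n → ℝ => |pm S (Matrix.of X)| := by fun_prop
  have hc2 : Continuous fun X : n → n → ℝ => |(Matrix.of X).det| := by fun_prop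
  have h := ENNReal.lintegral_mul_norm_pow_le (μ := gaussMat n) (p := 1 / 2) (q := 1 / 2)
    (hc1.measurable.ennreal_ofReal.pow_const (-(2 * s))).aemeasurable
    (hc2.measurable.ennreal_ofReal.pow_const (2 * s)).aemeasurable (by norm_num) (by norm_num)
    (by norm_num)
  have hu := (pm_moment (Finset.univ : Finset n)).2 (2 * s)
  simp only [pm_univ, Finset.card_univ] at hu
  rw [(pm_moment S).2, hu, ← ENNReal.mul_rpow_of_nonneg _ _ (by norm_num),
    mul_comm (∏ d ∈ Finset.Ioc 0 S.card, chiMoment d (-(2 * s)))] at h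
  refine (le_of_eq (lintegral_congr fun X => ?_)).trans h
  rw [← ENNReal.rpow_mul, ← ENNReal.rpow_mul]
  congr 2 <;> ring

/-- The term of degree `j` dominates all other terms of `p` on the circle of radius `r`. -/
def Dominates (p : Polynomial ℝ) (N j : ℕ) (r : ℝ) : Prop :=
  ∑ i ∈ (Finset.range (N + 1)).erase j, |p.coeff i| * r ^ i < |p.coeff j| * r ^ j

lemma rpow_le_of_not_dominates {M : Matrix n n ℝ} {j : ℕ} {x τ r s : ℝ} (h0 : 0 < s) (h1 : s ≤ 1)
    (hr : 0 ≤ r) (hdet : M.det ≠ 0) (hx : τ * |x| ≤ |M.charpoly.coeff j|) (hx0 : x ≠ 0)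
    (hnd : ¬ Dominates M.charpoly (Fintype.card n) j r) :
    ENNReal.ofReal (τ * r ^ j) ^ s ≤
      (ENNReal.ofReal |x| ^ (-s) * ENNReal.ofReal |M.det| ^ s) *
      ∑ i ∈ (Finset.range (Fintype.card n + 1)).erase j,
        ENNReal.ofReal |M.charpoly.coeff i| ^ s * ENNReal.ofReal |M.det| ^ (-s) *
          ENNReal.ofReal (r ^ i) ^ s := by
  have hD : ENNReal.ofReal |M.det| ≠ 0 := by simpa using hdet
  have hX : ENNReal.ofReal |x| ≠ 0 := by simpa using hx0
  have key : ENNReal.ofReal (τ * r ^ j) ^ s * ENNReal.ofReal |x| ^ s ≤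
      ∑ i ∈ (Finset.range (Fintype.card n + 1)).erase j,
        ENNReal.ofReal |M.charpoly.coeff i| ^ s * ENNReal.ofReal (r ^ i) ^ s := by
    rw [← ENNReal.mul_rpow_of_nonneg _ _ h0.le, ← ENNReal.ofReal_mul' (abs_nonneg x)]
    simp_rw [← ENNReal.mul_rpow_of_nonneg _ _ h0.le, ← ENNReal.ofReal_mul (abs_nonneg _)]
    refine le_trans ?_ (ennreal_sum_rpow_le _ _ h0 h1)
    rw [← ENNReal.ofReal_sum_of_nonneg fun i _ => by positivity]
    gcongr
    refine le_trans ?_ (not_lt.1 hnd)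
    calc τ * r ^ j * |x| = τ * |x| * r ^ j := by ring
      _ ≤ _ := by gcongr
  have hcancel : ∀ {a : ℝ≥0∞}, a ≠ 0 → a ≠ ⊤ → a ^ s * a ^ (-s) = 1 := by
    intro a ha ha'
    rw [← ENNReal.rpow_add _ _ ha ha']
    simp
  calc ENNReal.ofReal (τ * r ^ j) ^ s
      = ENNReal.ofReal |x| ^ (-s) * (ENNReal.ofReal (τ * r ^ j) ^ s * ENNReal.ofReal |x| ^ s) := by
        rw [mul_comm (ENNReal.ofReal |x| ^ (-s)), mul_assoc, hcancel hX ENNReal.ofReal_ne_top, mul_one]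
    _ ≤ ENNReal.ofReal |x| ^ (-s) * ∑ i ∈ (Finset.range (Fintype.card n + 1)).erase j,
        ENNReal.ofReal |M.charpoly.coeff i| ^ s * ENNReal.ofReal (r ^ i) ^ s := by gcongr
    _ = _ := by
        rw [mul_assoc, Finset.mul_sum (a := ENNReal.ofReal |M.det| ^ s)]
        congr 1
        refine Finset.sum_congr rfl fun i _ => ?_
        calc _ = ENNReal.ofReal |M.charpoly.coeff i| ^ s * ENNReal.ofReal (r ^ i) ^ s *
              (ENNReal.ofReal |M.det| ^ s * ENNReal.ofReal |M.det| ^ (-s)) := by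
              rw [hcancel hD ENNReal.ofReal_ne_top, mul_one]
          _ = _ := by ring

lemma ae_pm_matProd_ne_zero (m : ℕ) (S : Finset n) :
    ∀ᵐ ω ∂gaussTuple n (m + 1), pm S (matProd ω) ≠ 0 := by
  have hc : Continuous fun P : Matrix n n ℝ => pm S P := by fun_prop
  have hcl : IsClosed {P : Matrix n n ℝ | pm S P = 0} := isClosed_eq hc continuous_const
  have hms := (hcl.preimage (continuous_matProd (n := n) (m := m + 1))).measurableSet
  rw [ae_iff]
  simp only [not_not]
  change gaussTuple n (m + 1) (matProd ⁻¹' {P : Matrix n n ℝ | pm S P = 0}) = 0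
  rw [← lintegral_indicator_one hms]
  refine (lintegral_gaussTuple_succ ({P : Matrix n n ℝ | pm S P = 0}.indicator 1)
    (measurable_one.indicator hms)).trans ?_
  refine (lintegral_congr_ae (g := 0) ?_).trans lintegral_zero
  filter_upwards [ae_det_matProd_ne_zero (n := n) m] with ω hω
  have h := lintegral_rotate hω S (fun _ y _ => ({0} : Set ℝ).indicator 1 y)
    (((measurable_one.indicator (measurableSet_singleton 0)).comp measurable_fst).comp
      measurable_snd)
  have h0 : ∫⁻ X, ({0} : Set ℝ).indicator (1 : ℝ → ℝ≥0∞)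
      (|pm S (Matrix.of X)| * colVol S (matProd ω)) ∂gaussMat n = 0 := by
    rw [← lintegral_zero (μ := gaussMat n)]
    refine lintegral_congr_ae ?_
    filter_upwards [(pm_moment S).1] with X hX
    simp [hX, colVol_ne_zero hω S]
  rw [h0] at h
  refine Eq.trans ?_ h
  refine lintegral_congr fun X => ?_
  simp [Set.indicator]

lemma measure_not_dominates_le (m : ℕ) (C : Finset n) {s t r : ℝ} (h0 : 0 < s) (h1 : s ≤ 1)
    (ht : 0 < t) (ht1 : t ≤ 1 / 2) (hr : 0 < r) :
    gaussTuple n (m + 1) {ω | ¬ Dominates (matProd ω).charpoly (Fintype.card n) C.card r} ≤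
      C.card * ENNReal.ofReal (2 * t) +
      ((((∏ d ∈ Finset.Ioc 0 (Fintype.card n), chiMoment d (2 * s)) *
          ∏ d ∈ Finset.Ioc 0 (Fintype.card n - C.card), chiMoment d (-(2 * s))) ^ (1 / 2 : ℝ) *
        (∏ d ∈ Finset.Ioc 0 C.card, chiMoment d s) ^ m) *
      (∑ i ∈ (Finset.range (Fintype.card n + 1)).erase C.card,
        (Fintype.card n).choose i * (∏ d ∈ Finset.Ioc 0 i, chiMoment d (-s)) ^ (m + 1) *
          ENNReal.ofReal (r ^ i) ^ s) /
      ENNReal.ofReal (t ^ C.card * r ^ C.card) ^ s) ^ (1 / 2 : ℝ) := by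
  set N := Fintype.card n
  set μ := gaussTuple n (m + 1)
  set Y : (Fin (m + 1) → n → n → ℝ) → ℝ≥0∞ := fun ω =>
    ENNReal.ofReal |pm Cᶜ (matProd ω)| ^ (-s) * ENNReal.ofReal |(matProd ω).det| ^ s with hY
  set Z : (Fin (m + 1) → n → n → ℝ) → ℝ≥0∞ := fun ω =>
    ∑ i ∈ (Finset.range (N + 1)).erase C.card,
        ENNReal.ofReal |(matProd ω).charpoly.coeff i| ^ s *
          ENNReal.ofReal |(matProd ω).det| ^ (-s) * ENNReal.ofReal (r ^ i) ^ s with hZ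
  set q := ENNReal.ofReal (t ^ C.card * r ^ C.card) ^ s with hq
  have hq0 : q ≠ 0 := by
    rw [hq, Ne, ENNReal.rpow_eq_zero_iff]
    have : 0 < t ^ C.card * r ^ C.card := by positivity
    simp [this]
  have hqt : q ≠ ⊤ := ENNReal.rpow_ne_top_of_nonneg h0.le ENNReal.ofReal_ne_top
  have hc1 : Continuous fun ω : Fin (m + 1) → n → n → ℝ => |pm Cᶜ (matProd ω)| := by fun_prop
  have hc2 : Continuous fun ω : Fin (m + 1) → n → n → ℝ => |(matProd ω).det| := by fun_prop
  have hc3 : ∀ i ∈ (Finset.range (N + 1)).erase C.card,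
      Measurable fun ω : Fin (m + 1) → n → n → ℝ => |(matProd ω).charpoly.coeff i| := by
    intro i hi
    have hi' : i ≤ Fintype.card n := by
      have := Finset.mem_range.1 (Finset.mem_of_mem_erase hi); omega
    simp_rw [abs_charpoly_coeff hi']
    have : Continuous fun ω : Fin (m + 1) → n → n → ℝ =>
      |esymAvoid (Fintype.card n - i) ∅ (matProd ω)| := by fun_prop
    exact this.measurable
  have hYm : Measurable Y := (hc1.measurable.ennreal_ofReal.pow_const _).mul
            (hc2.measurable.ennreal_ofReal.pow_const _)
  have hZi : ∀ i ∈ (Finset.range (N + 1)).erase C.card,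
      Measurable fun ω : Fin (m + 1) → n → n → ℝ =>
        ENNReal.ofReal |(matProd ω).charpoly.coeff i| ^ s *
          ENNReal.ofReal |(matProd ω).det| ^ (-s) := fun i hi =>
    ((hc3 i hi).ennreal_ofReal.pow_const _).mul (hc2.measurable.ennreal_ofReal.pow_const _)
  have hZm : Measurable Z := Finset.measurable_sum _ fun i hi => (hZi i hi).mul_const _
  have hEY := lintegral_det_ratio_le m Cᶜ s
  rw [Finset.card_compl, Nat.sub_sub_self (Finset.card_le_univ C)] at hEY
  have hEZ : ∫⁻ ω, Z ω ∂μ ≤ ∑ i ∈ (Finset.range (N + 1)).erase C.card,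
        N.choose i * (∏ d ∈ Finset.Ioc 0 i, chiMoment d (-s)) ^ (m + 1) *
          ENNReal.ofReal (r ^ i) ^ s := by
    rw [hZ, lintegral_finsetSum' _ fun i hi => ((hZi i hi).mul_const _).aemeasurable]
    refine Finset.sum_le_sum fun i hi => ?_
    rw [lintegral_mul_const _ (hZi i hi)]
    gcongr
    exact lintegral_coeff_ratio_le (m + 1)
      (by have := Finset.mem_range.1 (Finset.mem_of_mem_erase hi); omega) h0 h1
  have hsub : μ {ω | ¬ Dominates (matProd ω).charpoly N C.card r} ≤
      μ ({ω | |(matProd ω).charpoly.coeff C.card| < t ^ C.card * |pm Cᶜ (matProd ω)|} ∪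
        {ω | q ^ (1 / 2 : ℝ) ≤ Y ω ^ (1 / 2 : ℝ) * Z ω ^ (1 / 2 : ℝ)}) := by
    refine measure_mono_ae ?_
    filter_upwards [ae_det_matProd_ne_zero (n := n) (m + 1), ae_pm_matProd_ne_zero m Cᶜ]
      with ω hdet hpm hnd
    by_cases hlt : |(matProd ω).charpoly.coeff C.card| < t ^ C.card * |pm Cᶜ (matProd ω)|
    · exact Or.inl hlt
    · refine Or.inr ?_
      change q ^ (1 / 2 : ℝ) ≤ Y ω ^ (1 / 2 : ℝ) * Z ω ^ (1 / 2 : ℝ)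
      rw [← ENNReal.mul_rpow_of_nonneg _ _ (by norm_num)]
      gcongr
      exact rpow_le_of_not_dominates h0 h1 hr.le hdet (not_lt.1 hlt) hpm hnd
  refine hsub.trans ((measure_union_le _ _).trans (add_le_add (measure_coeff_lt_le m C ht.le ht1) ?_))
  refine (meas_ge_le_lintegral_div ((hYm.pow_const _).mul (hZm.pow_const _)).aemeasurable
    ?_ ?_).trans ?_
  · simp [hq0, hqt]
  · exact ENNReal.rpow_ne_top_of_nonneg (by norm_num) hqt
  · rw [ENNReal.div_rpow_of_nonneg _ _ (by norm_num : (0 : ℝ) ≤ 1 / 2)]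
    gcongr
    refine (ENNReal.lintegral_mul_norm_pow_le hYm.aemeasurable hZm.aemeasurable (by norm_num)
      (by norm_num) (by norm_num)).trans ?_
    rw [← ENNReal.mul_rpow_of_nonneg _ _ (by norm_num)]
    gcongr

end Domination

section DominationAsymptotics

lemma partialProd_mul_pow_le_add {v : ℕ → ℝ} (hv : ∀ d, d ≠ 0 → 0 < v d)
    (hanti : ∀ d e, d ≠ 0 → d ≤ e → v e ≤ v d) {j : ℕ} {ρ θ : ℝ} (hρ : 0 ≤ ρ)
    (h : v (j + 1) * ρ = θ) (k : ℕ) :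
    (∏ d ∈ Finset.Ioc 0 (j + k), v d) * ρ ^ (j + k)
      ≤ (∏ d ∈ Finset.Ioc 0 j, v d) * ρ ^ j * θ ^ k := by
  induction k with
  | zero => simp
  | succ k ih =>
    have hpos : ∀ i, 0 ≤ ∏ d ∈ Finset.Ioc 0 i, v d := fun i =>
      Finset.prod_nonneg fun d hd => (hv d (by have := (Finset.mem_Ioc.1 hd).1; omega)).le
    have h1 : v (j + k + 1) * ρ ≤ θ := by
      rw [← h]
      exact mul_le_mul_of_nonneg_right (hanti _ _ (by omega) (by omega)) hρ
    have h2 : 0 ≤ v (j + k + 1) * ρ := mul_nonneg (hv _ (by omega)).le hρ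
    rw [← add_assoc, Finset.prod_Ioc_succ_top (by omega : 0 ≤ j + k), pow_succ, pow_succ]
    calc _ = (∏ d ∈ Finset.Ioc 0 (j + k), v d) * ρ ^ (j + k) * (v (j + k + 1) * ρ) := by ring
      _ ≤ (∏ d ∈ Finset.Ioc 0 j, v d) * ρ ^ j * θ ^ k * θ :=
        mul_le_mul ih h1 h2 (le_trans (mul_nonneg (hpos _) (pow_nonneg hρ _)) ih)
      _ = _ := by ring

lemma partialProd_mul_pow_le_sub {v : ℕ → ℝ} (hv : ∀ d, d ≠ 0 → 0 < v d)
    (hanti : ∀ d e, d ≠ 0 → d ≤ e → v e ≤ v d) {j : ℕ} {ρ θ : ℝ} (hρ : 0 ≤ ρ) (hθ : 0 ≤ θ)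
    (h : v j * ρ * θ = 1) (i k : ℕ) (hik : i + k = j) :
    (∏ d ∈ Finset.Ioc 0 i, v d) * ρ ^ i
      ≤ (∏ d ∈ Finset.Ioc 0 j, v d) * ρ ^ j * θ ^ k := by
  induction k generalizing i with
  | zero => simp [show i = j by omega]
  | succ k ih =>
    have hpos : 0 ≤ ∏ d ∈ Finset.Ioc 0 i, v d :=
      Finset.prod_nonneg fun d hd => (hv d (by have := (Finset.mem_Ioc.1 hd).1; omega)).le
    have h1 : 1 ≤ v (i + 1) * ρ * θ := by
      rw [← h]
      gcongr
      exact hanti _ _ (by omega) (by omega)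
    have h2 := ih (i + 1) (by omega)
    rw [Finset.prod_Ioc_succ_top (by omega : 0 ≤ i), pow_succ] at h2
    calc (∏ d ∈ Finset.Ioc 0 i, v d) * ρ ^ i
        ≤ (∏ d ∈ Finset.Ioc 0 i, v d) * ρ ^ i * (v (i + 1) * ρ * θ) :=
          le_mul_of_one_le_right (mul_nonneg hpos (pow_nonneg hρ _)) h1
      _ = (∏ d ∈ Finset.Ioc 0 i, v d) * v (i + 1) * (ρ ^ i * ρ) * θ := by ring
      _ ≤ (∏ d ∈ Finset.Ioc 0 j, v d) * ρ ^ j * θ ^ k * θ := by gcongr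
      _ = _ := by ring

lemma choose_mul_partialProd_le {v : ℕ → ℝ} (hv : ∀ d, d ≠ 0 → 0 < v d)
    (hanti : ∀ d e, d ≠ 0 → d ≤ e → v e ≤ v d) {j : ℕ} {ρ θ : ℝ} (hρ : 0 ≤ ρ) (hθ : 0 ≤ θ)
    (hθ1 : θ ≤ 1) (h1 : v (j + 1) * ρ = θ) (h2 : v j * ρ * θ = 1) {N M i : ℕ} (hN : 1 ≤ N)
    (hNθ : N * θ ^ M ≤ 1) (hij : i ≠ j) :
    (N.choose i : ℝ) * ((∏ d ∈ Finset.Ioc 0 i, v d) * ρ ^ i) ^ M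
      ≤ N ^ (j + 1) * ((∏ d ∈ Finset.Ioc 0 j, v d) * ρ ^ j * θ) ^ M := by
  have hpos : ∀ i, 0 ≤ ∏ d ∈ Finset.Ioc 0 i, v d := fun i =>
      Finset.prod_nonneg fun d hd => (hv d (by have := (Finset.mem_Ioc.1 hd).1; omega)).le
  have hch : (N.choose i : ℝ) ≤ (N : ℝ) ^ i := by exact_mod_cast Nat.choose_le_pow N i
  have hN' : (1 : ℝ) ≤ N := by exact_mod_cast hN
  have hθM : 0 ≤ θ ^ M := pow_nonneg hθ M
  set A := (∏ d ∈ Finset.Ioc 0 j, v d) * ρ ^ j with hA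
  have hA0 : 0 ≤ A := mul_nonneg (hpos j) (pow_nonneg hρ j)
  have hB0 : 0 ≤ (∏ d ∈ Finset.Ioc 0 i, v d) * ρ ^ i := mul_nonneg (hpos i) (pow_nonneg hρ i)
  rcases lt_or_gt_of_ne hij with hlt | hgt
  · obtain ⟨k, rfl⟩ := Nat.exists_eq_add_of_lt hlt
    have h := partialProd_mul_pow_le_sub hv hanti hρ hθ h2 i (k + 1) (by omega)
    calc _ ≤ (N : ℝ) ^ i * (A * θ ^ (k + 1)) ^ M := by gcongr
      _ ≤ (N : ℝ) ^ (i + k + 1 + 1) * (A * θ) ^ M := by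
        gcongr ?_ * (A * ?_) ^ M
        · exact pow_le_pow_right₀ hN' (by omega)
        · exact (pow_le_pow_of_le_one hθ hθ1 (by omega : 1 ≤ k + 1)).trans (by simp)
  · obtain ⟨k, rfl⟩ := Nat.exists_eq_add_of_lt hgt
    have h := partialProd_mul_pow_le_add hv hanti hρ h1 (k + 1)
    calc _ ≤ (N : ℝ) ^ (j + k + 1) * (A * θ ^ (k + 1)) ^ M :=
        mul_le_mul hch (pow_le_pow_left₀ hB0 h M) (by positivity) (by positivity)
      _ = (N : ℝ) ^ j * A ^ M * (N * θ ^ M) ^ (k + 1) := by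
        rw [mul_pow, mul_pow, ← pow_mul, ← pow_mul, mul_comm (k + 1) M]; ring
      _ ≤ (N : ℝ) ^ j * A ^ M * (N * θ ^ M) := by
        gcongr
        exact (pow_le_pow_of_le_one (by positivity) hNθ (by omega : 1 ≤ k + 1)).trans (by simp)
      _ = _ := by rw [mul_pow A θ M]; ring

lemma prod_chiMoment_eq_ofReal {k : ℕ} {s : ℝ} (h1 : -1 < s) (h2 : s ≤ 2) :
    ∏ d ∈ Finset.Ioc 0 k, chiMoment d s = ENNReal.ofReal (∏ d ∈ Finset.Ioc 0 k, chiReal d s) := by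
  have hd : ∀ d ∈ Finset.Ioc 0 k, d ≠ 0 := fun d hd => by
    have := (Finset.mem_Ioc.1 hd).1; omega
  rw [ENNReal.ofReal_prod_of_nonneg fun d hd' => (chiReal_pos (hd d hd') h1 h2).le]
  exact Finset.prod_congr rfl fun d hd' => (ofReal_chiReal (hd d hd') h1 h2).symm

lemma exists_measure_not_dominates_le {j : ℕ} (hj : j ≠ 0) :
    ∃ (K θ g : ℝ) (r : ℕ → ℝ), 0 ≤ K ∧ 0 < θ ∧ θ < 1 ∧ 0 < g ∧ g < 1 ∧ (∀ M, 0 < r M) ∧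
      ∀ N m : ℕ, j + 2 ≤ N → N * θ ^ (m + 1) ≤ 1 →
        gaussTuple (Fin N) (m + 1) {ω | ¬ Dominates (matProd ω).charpoly N j (r (m + 1))} ≤
          j * ENNReal.ofReal (2 / N) +
            ENNReal.ofReal (K * N ^ (3 * j + 4) * g ^ (m + 1)) ^ (1 / 2 : ℝ) := by
  obtain ⟨s, hs0, hs1, hlt, hg⟩ := exists_good_exponent hj
  obtain ⟨K, hK, hKle⟩ := prod_chiMoment_le (j := j) hs0.le hs1
  set v : ℕ → ℝ := fun d => chiReal d (-s) with hv
  have hvpos : ∀ d, d ≠ 0 → 0 < v d := fun d hd => chiReal_pos hd (by linarith) (by linarith)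
  have hanti : ∀ d e, d ≠ 0 → d ≤ e → v e ≤ v d := fun d e hd hde =>
    chiReal_anti hs0.le (by linarith) hd hde
  set κ := ∏ d ∈ Finset.Ioc 0 j, v d with hκ
  set w := ∏ d ∈ Finset.Ioc 0 j, chiReal d s with hw
  have hκ0 : 0 < κ := Finset.prod_pos fun d hd => hvpos d (by have := (Finset.mem_Ioc.1 hd).1; omega)
  have hw0 : 0 < w := Finset.prod_pos fun d hd =>
    chiReal_pos (by have := (Finset.mem_Ioc.1 hd).1; omega) (by linarith) (by linarith)
  have hv1 := hvpos j hj
  have hv2 := hvpos (j + 1) (by omega)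
  set a := √(v j) with ha
  set b := √(v (j + 1)) with hb
  have ha0 : 0 < a := Real.sqrt_pos.2 hv1
  have hb0 : 0 < b := Real.sqrt_pos.2 hv2
  have ha2 : v j = a ^ 2 := (Real.sq_sqrt hv1.le).symm
  have hb2 : v (j + 1) = b ^ 2 := (Real.sq_sqrt hv2.le).symm
  have hab : b < a := Real.sqrt_lt_sqrt hv2.le hlt
  have hθe : √(chiReal (j + 1) (-s) / chiReal j (-s)) = b / a := Real.sqrt_div hv2.le _
  rw [hθe] at hg
  have hθ1 : b / a < 1 := (div_lt_one ha0).2 hab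
  set ρ := (a * b)⁻¹ with hρ
  have hρ0 : 0 < ρ := by positivity
  have h1 : v (j + 1) * ρ = b / a := by rw [hb2, hρ]; field_simp
  have h2 : v j * ρ * (b / a) = 1 := by rw [ha2, hρ]; field_simp
  refine ⟨(1 + K.toReal) * 2 * w⁻¹, b / a, b / a * (w * κ), fun M => ρ ^ ((M : ℝ) / s),
    by positivity, by positivity, hθ1, by positivity, hg, fun M => by positivity,
    fun N m hN hNθ => ?_⟩
  obtain ⟨C, -, hC⟩ := Finset.exists_subset_card_eq (s := (Finset.univ : Finset (Fin N))) (n := j)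
    (by simp; omega)
  have hN0 : (0 : ℝ) < N := by exact_mod_cast (by omega : 0 < N)
  have hN1 : (1 : ℝ) ≤ N := by exact_mod_cast (by omega : 1 ≤ N)
  have hN2 : (2 : ℝ) ≤ N := by exact_mod_cast (by omega : 2 ≤ N)
  have hmain := measure_not_dominates_le m C (s := s) (t := 1 / N)
    (r := ρ ^ (((m + 1 : ℕ) : ℝ) / s)) hs0 (by linarith) (by positivity)
    (by rw [div_le_div_iff₀ hN0 (by norm_num)]; linarith) (by positivity)
  rw [hC, Fintype.card_fin] at hmain
  refine hmain.trans ?_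
  rw [mul_one_div]
  gcongr
  have hrpow : ∀ i : ℕ, ENNReal.ofReal ((ρ ^ (((m + 1 : ℕ) : ℝ) / s)) ^ i) ^ s
      = ENNReal.ofReal ((ρ ^ i) ^ (m + 1)) := by
    intro i
    rw [ENNReal.ofReal_rpow_of_nonneg (by positivity) hs0.le]
    congr 1
    rw [← Real.rpow_natCast, ← Real.rpow_mul hρ0.le, ← Real.rpow_mul hρ0.le, ← pow_mul,
      ← Real.rpow_natCast]
    congr 1
    push_cast
    field_simp
  have hsum : ∑ i ∈ (Finset.range (N + 1)).erase j,
        (N.choose i : ℝ≥0∞) * (∏ d ∈ Finset.Ioc 0 i, chiMoment d (-s)) ^ (m + 1) *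
          ENNReal.ofReal ((ρ ^ (((m + 1 : ℕ) : ℝ) / s)) ^ i) ^ s
      ≤ ENNReal.ofReal (2 * N * (N ^ (j + 1) * (κ * ρ ^ j * (b / a)) ^ (m + 1))) := by
    calc _ ≤ ∑ i ∈ (Finset.range (N + 1)).erase j,
          ENNReal.ofReal (N ^ (j + 1) * (κ * ρ ^ j * (b / a)) ^ (m + 1)) := by
          refine Finset.sum_le_sum fun i hi => ?_
          rw [hrpow, prod_chiMoment_eq_ofReal (by linarith) (by linarith), mul_assoc,
            ← ENNReal.ofReal_pow (Finset.prod_nonneg fun d hd =>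
              (hvpos d (by have := (Finset.mem_Ioc.1 hd).1; omega)).le),
            ← ENNReal.ofReal_mul (pow_nonneg (Finset.prod_nonneg fun d hd =>
              (hvpos d (by have := (Finset.mem_Ioc.1 hd).1; omega)).le) _),
            ← mul_pow, ← ENNReal.ofReal_natCast, ← ENNReal.ofReal_mul (by positivity)]
          exact ENNReal.ofReal_le_ofReal (choose_mul_partialProd_le hvpos hanti hρ0.le
            (by positivity) hθ1.le h1 h2 (by omega) hNθ (Finset.ne_of_mem_erase hi))
      _ ≤ _ := by
          rw [Finset.sum_const, nsmul_eq_mul, ENNReal.ofReal_mul (by positivity : (0 : ℝ) ≤ 2 * N)]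
          gcongr
          rw [← ENNReal.ofReal_natCast]
          refine ENNReal.ofReal_le_ofReal ?_
          have := (Finset.card_erase_le (s := Finset.range (N + 1)) (a := j))
          rw [Finset.card_range] at this
          have : (((Finset.range (N + 1)).erase j).card : ℝ) ≤ N + 1 := by exact_mod_cast this
          linarith
  have hroot : ((∏ d ∈ Finset.Ioc 0 N, chiMoment d (2 * s)) *
      ∏ d ∈ Finset.Ioc 0 (N - j), chiMoment d (-(2 * s))) ^ (1 / 2 : ℝ)
      ≤ ENNReal.ofReal ((1 + K.toReal) * N ^ (j + 2)) := by
    refine (ENNReal.rpow_le_rpow (hKle N hN) (by norm_num)).trans ?_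
    rw [← ENNReal.ofReal_toReal hK, ← ENNReal.ofReal_natCast, ← ENNReal.ofReal_pow hN0.le,
      ← ENNReal.ofReal_mul ENNReal.toReal_nonneg, ENNReal.ofReal_rpow_of_nonneg (by positivity)
      (by norm_num)]
    refine ENNReal.ofReal_le_ofReal ?_
    rw [← Real.sqrt_eq_rpow, ENNReal.toReal_ofReal ENNReal.toReal_nonneg]
    have hp : (1 : ℝ) ≤ N ^ (j + 2) := one_le_pow₀ hN1
    have hk : 0 ≤ K.toReal * N ^ (j + 2) := by positivity
    refine Real.sqrt_le_iff.2 ⟨by positivity, ?_⟩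
    nlinarith
  have hden : ENNReal.ofReal ((1 / N) ^ j * (ρ ^ j) ^ (m + 1)) ≤
      ENNReal.ofReal ((1 / N) ^ j * (ρ ^ (((m + 1 : ℕ) : ℝ) / s)) ^ j) ^ s := by
    rw [ENNReal.ofReal_mul (by positivity), ENNReal.ofReal_mul (by positivity),
      ENNReal.mul_rpow_of_nonneg _ _ hs0.le, hrpow]
    gcongr
    rw [ENNReal.ofReal_rpow_of_nonneg (by positivity) hs0.le]
    refine ENNReal.ofReal_le_ofReal ?_
    have hle : (1 / N : ℝ) ^ j ≤ 1 := pow_le_one₀ (by positivity) ((div_le_one hN0).2 hN1)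
    calc (1 / N : ℝ) ^ j = ((1 / N : ℝ) ^ j) ^ (1 : ℝ) := (Real.rpow_one _).symm
      _ ≤ _ := Real.rpow_le_rpow_of_exponent_ge (by positivity) hle (by linarith)
  rw [prod_chiMoment_eq_ofReal (k := j) (s := s) (by linarith) (by linarith)]
  calc _ ≤ ENNReal.ofReal ((1 + K.toReal) * N ^ (j + 2)) * ENNReal.ofReal w ^ m *
        ENNReal.ofReal (2 * N * (N ^ (j + 1) * (κ * ρ ^ j * (b / a)) ^ (m + 1))) /
        ENNReal.ofReal ((1 / N) ^ j * (ρ ^ j) ^ (m + 1)) := by gcongr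
    _ = _ := by
      rw [← ENNReal.ofReal_pow hw0.le, ← ENNReal.ofReal_mul (by positivity),
        ← ENNReal.ofReal_mul (by positivity), ← ENNReal.ofReal_div_of_pos (by positivity)]
      congr 1
      rw [show 3 * j + 4 = j + 2 + (j + 1) + 1 + j by ring, pow_add _ _ j, mul_pow, mul_pow κ,
        mul_pow (b / a), mul_pow w, one_div_pow, pow_succ w m]
      have hT : (ρ ^ j) ^ (m + 1) ≠ 0 := by positivity
      generalize (ρ ^ j) ^ (m + 1) = T at hT
      generalize (b / a) ^ (m + 1) = R
      generalize κ ^ (m + 1) = R'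
      field_simp
      ring

lemma tendsto_pow_mul_pow_of_ratio (c : ℕ) {g α : ℝ} (hg0 : 0 < g) (hg1 : g < 1) (hα : 0 < α)
    {m : ℕ → ℕ} (hlim : Tendsto (fun n : ℕ => (m n : ℝ) / (2 * n : ℕ)) atTop (nhds α)) :
    Tendsto (fun n : ℕ => ((2 * n : ℕ) : ℝ) ^ c * g ^ m n) atTop (nhds 0) := by
  have h1 : g ^ (α / 2) < 1 := Real.rpow_lt_one hg0.le hg1 (by positivity)
  have h0 : 0 < g ^ (α / 2) := Real.rpow_pos_of_pos hg0 _
  have h2 : Tendsto (fun n : ℕ => ((2 * n : ℕ) : ℝ) ^ c * (g ^ (α / 2)) ^ (2 * n)) atTop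
      (nhds 0) :=
    (tendsto_pow_const_mul_const_pow_of_abs_lt_one c (by rwa [abs_of_pos h0])).comp
      (tendsto_id.const_mul_atTop' (by norm_num : 0 < 2))
  refine squeeze_zero' (Eventually.of_forall fun n => by positivity) ?_ h2
  filter_upwards [hlim.eventually_const_lt (half_lt_self hα), eventually_gt_atTop 0] with n hn hn0
  have hN : (0 : ℝ) < (2 * n : ℕ) := by exact_mod_cast (by omega : 0 < 2 * n)
  gcongr
  rw [← Real.rpow_natCast, ← Real.rpow_natCast, ← Real.rpow_mul hg0.le]
  exact Real.rpow_le_rpow_of_exponent_ge hg0 hg1.le ((lt_div_iff₀ hN).1 hn).le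

/-- With probability tending to one the term of degree `j` dominates the characteristic polynomial
on a suitable circle. -/
lemma exists_tendsto_measure_not_dominates {j : ℕ} (hj : j ≠ 0) {α : ℝ} (hα : 0 < α)
    {m : ℕ → ℕ} (hm : ∀ n, 0 < m n)
    (hlim : Tendsto (fun n : ℕ => (m n : ℝ) / (2 * n : ℕ)) atTop (nhds α)) :
    ∃ r : ℕ → ℝ, (∀ n, 0 < r n) ∧ Tendsto (fun n => gaussTuple (Fin (2 * n)) (m n)
      {ω | ¬ Dominates (matProd ω).charpoly (2 * n) j (r n)}) atTop (nhds 0) := by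
  obtain ⟨K, θ, g, r, hK, hθ0, hθ1, hg0, hg1, hr, h⟩ := exists_measure_not_dominates_le hj
  refine ⟨fun n => r (m n), fun n => hr _, ?_⟩
  have e1 := tendsto_pow_mul_pow_of_ratio 1 hθ0 hθ1 hα hlim
  have e2 := (tendsto_pow_mul_pow_of_ratio (3 * j + 4) hg0 hg1 hα hlim).const_mul K
  have hN : Tendsto (fun n : ℕ => ((2 * n : ℕ) : ℝ)) atTop atTop :=
    tendsto_natCast_atTop_atTop.comp (tendsto_id.const_mul_atTop' (by norm_num : 0 < 2))
  have e3 : Tendsto (fun n : ℕ => (j : ℝ≥0∞) * ENNReal.ofReal (2 / (2 * n : ℕ)) +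
      ENNReal.ofReal (K * ((2 * n : ℕ) ^ (3 * j + 4) * g ^ m n)) ^ (1 / 2 : ℝ)) atTop (nhds 0) := by
    have a1 := ENNReal.tendsto_ofReal (hN.const_div_atTop 2)
    have a2 := (ENNReal.tendsto_ofReal e2).ennrpow_const (1 / 2)
    have a3 := (ENNReal.Tendsto.const_mul (a := (j : ℝ≥0∞)) a1
      (Or.inr (ENNReal.natCast_ne_top j))).add a2
    simpa using a3
  refine tendsto_of_tendsto_of_tendsto_of_le_of_le' tendsto_const_nhds e3
    (Eventually.of_forall fun n => zero_le) ?_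
  filter_upwards [e1.eventually_lt_const one_pos, eventually_ge_atTop (j + 2)] with n hn hnj
  obtain ⟨k, hk⟩ := Nat.exists_eq_succ_of_ne_zero (hm n).ne'
  have := h (2 * n) k (by omega) (by rw [← Nat.succ_eq_add_one, ← hk]; simpa using hn.le)
  rw [← Nat.succ_eq_add_one, ← hk, mul_assoc] at this
  exact this

end DominationAsymptotics

section RootCount

lemma Dominates.mul_eval_pos {p : Polynomial ℝ} {N j : ℕ} {r : ℝ} (h : Dominates p N j r)
    (hp : p.natDegree ≤ N) (hj : j ≤ N) {x : ℝ} (hx : |x| = r) :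
    0 < p.coeff j * x ^ j * p.eval x := by
  have hsplit : p.eval x = p.coeff j * x ^ j +
      ∑ i ∈ (Finset.range (N + 1)).erase j, p.coeff i * x ^ i := by
    rw [Polynomial.eval_eq_sum_range' (Nat.lt_succ_of_le hp),
      Finset.add_sum_erase _ (fun i => p.coeff i * x ^ i) (Finset.mem_range.2 (by omega))]
  have hlt : |∑ i ∈ (Finset.range (N + 1)).erase j, p.coeff i * x ^ i| < |p.coeff j * x ^ j| := by
    refine (Finset.abs_sum_le_sum_abs _ _).trans_lt ?_
    simp only [abs_mul, abs_pow, hx]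
    exact h
  rw [hsplit]
  set u := p.coeff j * x ^ j
  set w := ∑ i ∈ (Finset.range (N + 1)).erase j, p.coeff i * x ^ i
  have h1 : |u * w| < u * u := by
    rw [abs_mul, ← abs_mul_abs_self u]
    exact mul_lt_mul_of_pos_left hlt ((abs_nonneg w).trans_lt hlt)
  rw [mul_add]
  linarith [(abs_lt.1 h1).1]

lemma Dominates.term_lt {p : Polynomial ℝ} {N j i : ℕ} {r : ℝ} (h : Dominates p N j r)
    (hr : 0 < r) (hi : i ≤ N) (hij : i ≠ j) : |p.coeff i| * r ^ i < |p.coeff j| * r ^ j := by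
  refine lt_of_le_of_lt ?_ h
  exact Finset.single_le_sum (f := fun i => |p.coeff i| * r ^ i) (fun i _ => by positivity)
    (Finset.mem_erase.2 ⟨hij, Finset.mem_range.2 (by omega)⟩)

lemma Dominates.radius_lt {p : Polynomial ℝ} {N j : ℕ} {r r' : ℝ} (h : Dominates p N j r)
    (h' : Dominates p N (j + 1) r') (hr : 0 < r) (hr' : 0 < r') (hj : j + 1 ≤ N) : r < r' := by
  have h1 := h.term_lt hr hj (by omega)
  have h2 := h'.term_lt hr' (by omega : j ≤ N) (by omega)
  have h3 : |p.coeff (j + 1)| * r < |p.coeff j| := by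
    rw [pow_succ', ← mul_assoc] at h1
    exact lt_of_mul_lt_mul_right h1 (by positivity)
  have h4 : |p.coeff j| < |p.coeff (j + 1)| * r' := by
    rw [pow_succ', ← mul_assoc] at h2
    exact lt_of_mul_lt_mul_right h2 (by positivity)
  exact lt_of_mul_lt_mul_left (h3.trans h4) (abs_nonneg _)

lemma exists_zero_of_mul_neg {f : ℝ → ℝ} (hf : Continuous f) {a b : ℝ} (hab : a < b)
    (h : f a * f b < 0) : ∃ x ∈ Set.Ioo a b, f x = 0 := by
  rcases mul_neg_iff.1 h with ⟨h1, h2⟩ | ⟨h1, h2⟩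
  · obtain ⟨x, hx, h0⟩ := intermediate_value_Ioo' hab.le hf.continuousOn ⟨h2, h1⟩
    exact ⟨x, hx, h0⟩
  · obtain ⟨x, hx, h0⟩ := intermediate_value_Ioo hab.le hf.continuousOn ⟨h1, h2⟩
    exact ⟨x, hx, h0⟩

lemma exists_root_of_dominates {p : Polynomial ℝ} {N j : ℕ} {r r' : ℝ} (h : Dominates p N j r)
    (h' : Dominates p N (j + 1) r') (hr : 0 < r) (hr' : 0 < r') (hp : p.natDegree ≤ N)
    (hj : j + 1 ≤ N) : ∃ x, p.eval x = 0 ∧ r < |x| ∧ |x| < r' := by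
  have hlt := h.radius_lt h' hr hr' hj
  suffices ∃ σ : ℝ, |σ| = 1 ∧ p.eval (σ * r) * p.eval (σ * r') < 0 by
    obtain ⟨σ, hσ, hneg⟩ := this
    obtain ⟨y, hy, h0⟩ := exists_zero_of_mul_neg (f := fun y => p.eval (σ * y))
      (by fun_prop) hlt hneg
    have hy0 : |σ * y| = y := by rw [abs_mul, hσ, one_mul, abs_of_pos (hr.trans hy.1)]
    exact ⟨σ * y, h0, by rw [hy0]; exact hy.1, by rw [hy0]; exact hy.2⟩
  have key : ∀ σ : ℝ, |σ| = 1 →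
      0 < p.coeff j * p.coeff (j + 1) * σ * (p.eval (σ * r) * p.eval (σ * r')) := by
    intro σ hσ
    have h1 := h.mul_eval_pos hp (by omega) (x := σ * r) (by rw [abs_mul, hσ, one_mul, abs_of_pos hr])
    have h2 := h'.mul_eval_pos hp hj (x := σ * r') (by rw [abs_mul, hσ, one_mul, abs_of_pos hr'])
    have h3 := mul_pos h1 h2
    have hσ2 : σ * σ = 1 := by rw [← abs_mul_abs_self, hσ, one_mul]
    have hσj : σ ^ j * σ ^ j = 1 := by rw [← mul_pow, hσ2, one_pow]
    have h4 : p.coeff j * (σ * r) ^ j * p.eval (σ * r) *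
        (p.coeff (j + 1) * (σ * r') ^ (j + 1) * p.eval (σ * r')) =
        r ^ j * r' ^ (j + 1) *
          (p.coeff j * p.coeff (j + 1) * σ * (p.eval (σ * r) * p.eval (σ * r'))) := by
      rw [mul_pow, mul_pow, pow_succ σ]
      linear_combination (p.coeff j * p.coeff (j + 1) * σ * p.eval (σ * r) * p.eval (σ * r') *
        r ^ j * r' ^ (j + 1)) * hσj
    rw [h4] at h3
    exact pos_of_mul_pos_right h3 (by positivity)
  have k1 := key 1 (by simp)
  have k2 := key (-1) (by simp)
  rcases lt_trichotomy (p.coeff j * p.coeff (j + 1)) 0 with hc | hc | hc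
  · refine ⟨1, by simp, ?_⟩
    rw [mul_one] at k1
    exact neg_of_mul_pos_right k1 hc.le
  · simp [hc] at k1
  · refine ⟨-1, by simp, ?_⟩
    refine neg_of_mul_pos_right k2 ?_
    linarith

lemma le_card_roots_of_dominates {p : Polynomial ℝ} (hp0 : p ≠ 0) {N J : ℕ} {r : ℕ → ℝ}
    (hr : ∀ j, 0 < r j) (hp : p.natDegree ≤ N) (hJ : J + 1 ≤ N)
    (h : ∀ j ∈ Finset.Icc 1 (J + 1), Dominates p N j (r j)) : J ≤ p.roots.card := by
  have hex : ∀ j : ℕ, ∃ x : ℝ, j < J → p.eval x = 0 ∧ r (j + 1) < |x| ∧ |x| < r (j + 2) := by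
    intro j
    by_cases hj : j < J
    · obtain ⟨x, hx⟩ := exists_root_of_dominates (h (j + 1) (by simp; omega))
        (h (j + 1 + 1) (by simp; omega)) (hr _) (hr _) hp (by omega)
      exact ⟨x, fun _ => hx⟩
    · exact ⟨0, fun h => absurd h hj⟩
  choose x hx using hex
  have hmono : ∀ i j, i ≤ j → j ≤ J → r (i + 1) ≤ r (j + 1) := by
    intro i j hij
    induction j, hij using Nat.le_induction with
    | base => exact fun _ => le_rfl
    | succ j hij ih =>
      intro hj
      refine (ih (by omega)).trans (Dominates.radius_lt (h (j + 1) (by simp; omega))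
        (h (j + 1 + 1) (by simp; omega)) (hr _) (hr _) (by omega)).le
  have hlt : ∀ i j, i < j → j < J → |x i| < |x j| := fun i j hij hj =>
    ((hx i (by omega)).2.2.trans_le (hmono (i + 1) j hij hj.le)).trans (hx j hj).2.1
  have hinj : Set.InjOn x (Finset.range J) := by
    intro i hi j hj hij
    simp only [Finset.coe_range, Set.mem_Iio] at hi hj
    by_contra hne
    rcases lt_or_gt_of_ne hne with hl | hl
    · exact (hlt i j hl hj).ne (by rw [hij])
    · exact (hlt j i hl hi).ne (by rw [hij])
  calc J = ((Finset.range J).image x).card := by rw [Finset.card_image_of_injOn hinj]; simp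
    _ ≤ p.roots.toFinset.card := by
      refine Finset.card_le_card fun y hy => ?_
      obtain ⟨j, hj, rfl⟩ := Finset.mem_image.1 hy
      rw [Multiset.mem_toFinset, Polynomial.mem_roots hp0]
      exact (hx j (Finset.mem_range.1 hj)).1
    _ ≤ _ := Multiset.toFinset_card_le _

end RootCount

section RootMeasurability

variable {n : Type*} [Fintype n] [DecidableEq n]

lemma isClosed_factorization (f : ℝ → ℝ) (hf : Continuous f) (c : ℝ) (k l R : ℕ) :
    IsClosed {P : Matrix n n ℝ | ∃ z ∈ Metric.closedBall (0 : (Fin k → ℝ) × (Fin l → ℝ)) R,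
      (∀ t : ℝ, (Matrix.scalar n t - P).det = (∏ i, (t - z.1 i)) * ∑ i, z.2 i * t ^ (i : ℕ)) ∧
        c ≤ ∑ i, f (z.1 i)} := by
  have : CompactSpace (Metric.closedBall (0 : (Fin k → ℝ) × (Fin l → ℝ)) R) :=
    isCompact_iff_compactSpace.1 (isCompact_closedBall _ _)
  set A : Set (Metric.closedBall (0 : (Fin k → ℝ) × (Fin l → ℝ)) R × Matrix n n ℝ) :=
    {q | (∀ t : ℝ, (Matrix.scalar n t - q.2).det =
      (∏ i, (t - q.1.1.1 i)) * ∑ i, q.1.1.2 i * t ^ (i : ℕ)) ∧ c ≤ ∑ i, f (q.1.1.1 i)} with hA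
  have hAc : IsClosed A := by
    rw [hA, Set.ofPred_and, Set.ofPred_forall]
    refine IsClosed.inter ?_ (isClosed_le continuous_const (by fun_prop))
    exact isClosed_iInter fun t => isClosed_eq (by fun_prop) (by fun_prop)
  convert isClosedMap_snd_of_compactSpace _ hAc using 1
  ext P
  constructor
  · rintro ⟨z, hz, h1, h2⟩
    exact ⟨(⟨z, hz⟩, P), ⟨h1, h2⟩, rfl⟩
  · rintro ⟨⟨⟨z, hz⟩, P⟩, ⟨h1, h2⟩, rfl⟩
    exact ⟨z, hz, h1, h2⟩

lemma le_linearStat_iff {f : ℝ → ℝ} (hf0 : ∀ x, 0 ≤ f x) (c : ℝ) (P : Matrix n n ℝ) :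
    c ≤ (P.charpoly.roots.map f).sum ↔ ∃ k R : ℕ,
      ∃ z ∈ Metric.closedBall (0 : (Fin k → ℝ) × (Fin (Fintype.card n + 1) → ℝ)) R,
      (∀ t : ℝ, (Matrix.scalar n t - P).det = (∏ i, (t - z.1 i)) * ∑ i, z.2 i * t ^ (i : ℕ)) ∧
        c ≤ ∑ i, f (z.1 i) := by
  have hne : P.charpoly ≠ 0 := P.charpoly_monic.ne_zero
  constructor
  · intro h
    obtain ⟨q, hq⟩ := (Multiset.prod_X_sub_C_dvd_iff_le_roots hne P.charpoly.roots).2 le_rfl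
    set L := P.charpoly.roots.toList with hL
    have hLc : (L : Multiset ℝ) = P.charpoly.roots := Multiset.coe_toList _
    have hqd : q.natDegree < Fintype.card n + 1 := by
      have hq0 : q ≠ 0 := by rintro rfl; simp at hq; exact hne hq
      have := Polynomial.natDegree_le_of_dvd (Dvd.intro_left _ hq.symm) hne
      rw [P.charpoly_natDegree_eq_dim] at this
      omega
    set z : (Fin L.length → ℝ) × (Fin (Fintype.card n + 1) → ℝ) :=
      (fun i => L.get i, fun i => q.coeff i) with hz
    obtain ⟨R, hR⟩ := exists_nat_ge ‖z‖
    refine ⟨L.length, R, z, by simpa using hR, fun t => ?_, ?_⟩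
    · rw [← Matrix.eval_charpoly, hq, Polynomial.eval_mul, ← hLc]
      congr 1
      · rw [Polynomial.eval_multiset_prod, Multiset.map_map, Multiset.map_coe, Multiset.prod_coe]
        refine Eq.trans ?_ (Fin.prod_univ_fun_getElem L fun x => t - x).symm
        simp [Function.comp_def]
      · rw [Polynomial.eval_eq_sum_range' hqd, Finset.sum_range]
    · refine h.trans (le_of_eq ?_)
      rw [← hLc, Multiset.map_coe, Multiset.sum_coe]
      exact (Fin.sum_univ_fun_getElem L f).symm
  · rintro ⟨k, R, z, -, h1, h2⟩
    refine h2.trans ?_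
    set s : Multiset ℝ := Finset.univ.val.map z.1 with hs
    have hle : s ≤ P.charpoly.roots := by
      rw [← Multiset.prod_X_sub_C_dvd_iff_le_roots hne]
      refine ⟨∑ i, Polynomial.C (z.2 i) * Polynomial.X ^ (i : ℕ), Polynomial.funext fun t => ?_⟩
      rw [Matrix.eval_charpoly, h1, Polynomial.eval_mul, Polynomial.eval_finsetSum]
      congr 1
      · rw [Polynomial.eval_multiset_prod, hs, Multiset.map_map, Multiset.map_map, Finset.prod]
        simp [Function.comp_def]
      · simp
    obtain ⟨u, hu⟩ := Multiset.le_iff_exists_add.1 hle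
    rw [hu, Multiset.map_add, Multiset.sum_add, hs, Multiset.map_map]
    refine le_add_of_nonneg_right (Multiset.sum_nonneg fun y hy => ?_)
    obtain ⟨x, -, rfl⟩ := Multiset.mem_map.1 hy
    exact hf0 x

lemma measurable_linearStat {Ω : Type*} [TopologicalSpace Ω] [MeasurableSpace Ω] [BorelSpace Ω]
    {f : ℝ → ℝ} (hf : Continuous f) (hf0 : ∀ x, 0 ≤ f x) {g : Ω → Matrix n n ℝ}
    (hg : Continuous g) : Measurable fun ω => ((g ω).charpoly.roots.map f).sum := by
  refine measurable_of_Ici fun c => ?_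
  have : (fun ω => ((g ω).charpoly.roots.map f).sum) ⁻¹' Set.Ici c = ⋃ k : ℕ, ⋃ R : ℕ,
      g ⁻¹' {P : Matrix n n ℝ |
        ∃ z ∈ Metric.closedBall (0 : (Fin k → ℝ) × (Fin (Fintype.card n + 1) → ℝ)) R,
      (∀ t : ℝ, (Matrix.scalar n t - P).det = (∏ i, (t - z.1 i)) * ∑ i, z.2 i * t ^ (i : ℕ)) ∧
        c ≤ ∑ i, f (z.1 i)} := by
    ext ω
    simp only [Set.mem_preimage, Set.mem_Ici, le_linearStat_iff hf0, Set.mem_iUnion,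
      Set.mem_ofPred_eq]
  rw [this]
  exact MeasurableSet.iUnion fun k => MeasurableSet.iUnion fun R =>
    ((isClosed_factorization f hf c k _ R).preimage hg).measurableSet

end RootMeasurability

section Scaling

variable {n : Type*} [Fintype n] [DecidableEq n]

lemma measurePreserving_gaussTuple_mul {m : ℕ} (s : Fin m → n → n → ℝ) (v : NNReal)
    (hs : ∀ i a b, s i a b ^ 2 = v) :
    MeasurePreserving (fun (ω : Fin m → n → n → ℝ) i a b => s i a b * ω i a b) (gaussTuple n m)
      (Measure.pi fun _ => Measure.pi fun _ => Measure.pi fun _ => gaussianReal 0 v) := by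
  unfold gaussTuple gaussMat gauss
  refine measurePreserving_pi _ _ (f := fun i (x : n → n → ℝ) a b => s i a b * x a b) fun i =>
    measurePreserving_pi _ _ (f := fun a (x : n → ℝ) b => s i a b * x b) fun a =>
    measurePreserving_pi _ _ (f := fun b (x : ℝ) => s i a b * x) fun b => ⟨by fun_prop, ?_⟩
  rw [gaussianReal_map_const_mul]
  congr 1
  · simp
  · ext
    simp [hs]

lemma matProd_const_mul (c : ℝ) : ∀ {m : ℕ} (ω : Fin m → n → n → ℝ),
    matProd (fun i a b => c * ω i a b) = c ^ m • matProd ω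
  | 0, ω => by simp
  | m + 1, ω => by
    have h1 : ω = Fin.cons (ω 0) (Fin.tail ω) := (Fin.cons_self_tail ω).symm
    have h2 : (fun i a b => c * ω i a b : Fin (m + 1) → n → n → ℝ) =
        Fin.cons (c • ω 0) (fun i a b => c * Fin.tail ω i a b) := by
      funext i
      refine Fin.cases ?_ (fun i => ?_) i
      · rfl
      · rfl
    rw [h2, matProd_cons, matProd_const_mul c (Fin.tail ω), ← Matrix.smul_of, Matrix.smul_mul,
      Matrix.mul_smul, smul_smul, ← pow_succ', ← matProd_cons, ← h1]

lemma abs_charpoly_coeff_smul {c : ℝ} (hc : 0 ≤ c) (P : Matrix n n ℝ) {i : ℕ}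
    (hi : i ≤ Fintype.card n) :
    |(c • P).charpoly.coeff i| = c ^ (Fintype.card n - i) * |P.charpoly.coeff i| := by
  rw [abs_charpoly_coeff hi, abs_charpoly_coeff hi, ← abs_of_nonneg (pow_nonneg hc _), ← abs_mul]
  congr 1
  rw [esymAvoid, esymAvoid, Finset.mul_sum]
  refine Finset.sum_congr rfl fun S hS => ?_
  rw [pm_smul, (Finset.mem_powersetCard.1 (Finset.mem_filter.1 hS).1).2]

lemma Dominates.smul {P : Matrix n n ℝ} {j : ℕ} {r c : ℝ}
    (h : Dominates P.charpoly (Fintype.card n) j r) (hj : j ≤ Fintype.card n) (hc : 0 < c) :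
    Dominates (c • P).charpoly (Fintype.card n) j (c * r) := by
  have key : ∀ i ≤ Fintype.card n, |(c • P).charpoly.coeff i| * (c * r) ^ i =
      c ^ Fintype.card n * (|P.charpoly.coeff i| * r ^ i) := by
    intro i hi
    rw [abs_charpoly_coeff_smul hc.le P hi, mul_pow]
    have : c ^ Fintype.card n = c ^ (Fintype.card n - i) * c ^ i := by
      rw [← pow_add, Nat.sub_add_cancel hi]
    rw [this]
    ring
  unfold Dominates at h ⊢
  rw [key j hj, Finset.sum_congr rfl fun i hi => key i (by
    have := Finset.mem_range.1 (Finset.mem_of_mem_erase hi); omega), ← Finset.mul_sum]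
  exact mul_lt_mul_of_pos_left h (by positivity)

/-- The ensemble with variance `1 / N` is a rescaling of the standard one. -/
lemma measurePreserving_ensemble (N m : ℕ) :
    MeasurePreserving (fun (ω : Fin m → Fin N → Fin N → ℝ) i a b => √(1 / N) * ω i a b)
      (gaussTuple (Fin N) m) (ensembleMeasure N m) := by
  refine measurePreserving_gaussTuple_mul _ _ fun _ _ _ => ?_
  rw [Real.sq_sqrt (by positivity)]
  simp

lemma prodMatrix_scale (N m : ℕ) (ω : Fin m → Fin N → Fin N → ℝ) :
    prodMatrix N m (fun i a b => √(1 / N) * ω i a b) = √(1 / N) ^ m • matProd ω :=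
  matProd_const_mul _ ω

instance (N m : ℕ) : IsProbabilityMeasure (ensembleMeasure N m) := by
  unfold ensembleMeasure; infer_instance

lemma continuous_prodMatrix (N m : ℕ) : Continuous (prodMatrix N m) := continuous_matProd

lemma numRealEigs_le (N : ℕ) (P : Matrix (Fin N) (Fin N) ℝ) : numRealEigs N P ≤ N := by
  refine (Polynomial.card_roots' _).trans (le_of_eq ?_)
  rw [Matrix.charpoly_natDegree_eq_dim, Fintype.card_fin]

lemma linearStat_const (N : ℕ) (c : ℝ) (P : Matrix (Fin N) (Fin N) ℝ) :
    linearStat N (fun _ => c) P = numRealEigs N P * c := by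
  simp [linearStat, numRealEigs]

lemma linearStat_add (N : ℕ) (f g : ℝ → ℝ) (P : Matrix (Fin N) (Fin N) ℝ) :
    linearStat N (fun x => f x + g x) P = linearStat N f P + linearStat N g P := by
  simp [linearStat]

lemma abs_linearStat_le (N : ℕ) {f : ℝ → ℝ} {C : ℝ} (hf : ∀ x, |f x| ≤ C)
    (P : Matrix (Fin N) (Fin N) ℝ) : |linearStat N f P| ≤ numRealEigs N P * C := by
  unfold linearStat numRealEigs
  refine (Multiset.abs_sum_le_sum_abs).trans ?_
  rw [Multiset.map_map, ← nsmul_eq_mul]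
  refine (Multiset.sum_le_card_nsmul _ C fun x hx => ?_).trans (by simp)
  obtain ⟨y, -, rfl⟩ := Multiset.mem_map.1 hx
  exact hf y

lemma measurable_linearStat_prodMatrix (N m : ℕ) {f : ℝ → ℝ} (hf : Continuous f) {C : ℝ}
    (hC : ∀ x, |f x| ≤ C) : Measurable fun ω => linearStat N f (prodMatrix N m ω) := by
  have h1 := measurable_linearStat (f := fun x => f x + C) (by fun_prop)
    (fun x => by linarith [neg_le_of_abs_le (hC x)]) (continuous_prodMatrix N m)
  have h2 := measurable_linearStat (f := fun _ => C) (by fun_prop)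
    (fun x => (abs_nonneg _).trans (hC x)) (continuous_prodMatrix N m)
  convert h1.sub h2 using 1
  funext ω
  have := linearStat_add N f (fun _ => C) (prodMatrix N m ω)
  simp only [linearStat] at this ⊢
  simp only [Pi.sub_apply]
  rw [this, add_sub_cancel_right]

lemma integrable_linearStat (N m : ℕ) {f : ℝ → ℝ} (hf : Continuous f) {C : ℝ}
    (hC : ∀ x, |f x| ≤ C) :
    Integrable (fun ω => linearStat N f (prodMatrix N m ω)) (ensembleMeasure N m) := by
  refine Integrable.of_bound (measurable_linearStat_prodMatrix N m hf hC).aestronglyMeasurable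
    (N * C) (Eventually.of_forall fun ω => (abs_linearStat_le N hC _).trans ?_)
  have hC0 : 0 ≤ C := (abs_nonneg _).trans (hC 0)
  gcongr
  exact numRealEigs_le N _

lemma integrable_numRealEigs (N m : ℕ) :
    Integrable (fun ω => (numRealEigs N (prodMatrix N m ω) : ℝ)) (ensembleMeasure N m) := by
  simpa [linearStat_const] using
    integrable_linearStat N m (f := fun _ => 1) continuous_const (C := 1) (by simp)

/-- If the terms of degree `1, …, J + 1` dominate with large probability, the expected number of
real eigenvalues is large. -/
lemma half_le_EN {N m J : ℕ} (hN : 0 < N) (hJ : J + 1 ≤ N) {r : ℕ → ℝ} (hr : ∀ j, 0 < r j)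
    (h : ∑ j ∈ Finset.Icc 1 (J + 1), gaussTuple (Fin N) m
      {ω | ¬ Dominates (matProd ω).charpoly N j (r j)} ≤ 1 / 2) : (J : ℝ) / 2 ≤ EN N m := by
  have hc : 0 < √(1 / N : ℝ) ^ m := by positivity
  have hbad : ensembleMeasure N m {ω | numRealEigs N (prodMatrix N m ω) < J} ≤ 1 / 2 := by
    have hms : MeasurableSet {ω | numRealEigs N (prodMatrix N m ω) < J} := by
      have := measurable_linearStat_prodMatrix N m (f := fun _ => 1) continuous_const (C := 1)
        (by simp)
      simp only [linearStat_const, mul_one] at this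
      have h2 := measurableSet_lt this (measurable_const (a := (J : ℝ)))
      simpa only [Nat.cast_lt] using h2
    rw [← (measurePreserving_ensemble N m).measure_preimage hms.nullMeasurableSet]
    refine (measure_mono fun ω hω => ?_).trans ((measure_biUnion_finset_le _ _).trans h)
    simp only [Set.mem_preimage, Set.mem_ofPred_eq, prodMatrix_scale] at hω
    by_contra hcon
    simp only [Set.mem_iUnion, Set.mem_ofPred_eq, not_exists, not_not] at hcon
    refine hω.not_ge ?_
    refine le_card_roots_of_dominates (Matrix.charpoly_monic _).ne_zero
      (r := fun j => √(1 / N : ℝ) ^ m * r j) (fun j => mul_pos hc (hr j))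
      (N := N) (by rw [Matrix.charpoly_natDegree_eq_dim, Fintype.card_fin]) hJ fun j hj => ?_
    have h1 := hcon j hj
    have h2 := Dominates.smul (n := Fin N) (P := matProd ω) (j := j) (r := r j)
      (by rwa [Fintype.card_fin]) (by
        rw [Fintype.card_fin]; have := (Finset.mem_Icc.1 hj).2; omega) hc
    rwa [Fintype.card_fin] at h2
  have hgood : (1 : ℝ) / 2 ≤ (ensembleMeasure N m).real
      {ω | (J : ℝ) ≤ numRealEigs N (prodMatrix N m ω)} := by
    have hcover : (Set.univ : Set (Fin m → Fin N → Fin N → ℝ)) ⊆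
        {ω | numRealEigs N (prodMatrix N m ω) < J} ∪
          {ω | (J : ℝ) ≤ numRealEigs N (prodMatrix N m ω)} := fun ω _ => by
      rcases lt_or_ge (numRealEigs N (prodMatrix N m ω)) J with h | h
      · exact Or.inl h
      · exact Or.inr (by simpa using h)
    have h1 := (measureReal_mono (μ := ensembleMeasure N m) hcover).trans
      (measureReal_union_le _ _)
    have h2 : (ensembleMeasure N m).real {ω | numRealEigs N (prodMatrix N m ω) < J} ≤ 1 / 2 := by
      have := ENNReal.toReal_mono (by simp) hbad
      simpa [measureReal_def] using this
    rw [probReal_univ] at h1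
    linarith
  have hM := mul_meas_ge_le_integral_of_nonneg (μ := ensembleMeasure N m)
    (Eventually.of_forall fun ω => Nat.cast_nonneg (numRealEigs N (prodMatrix N m ω)))
    (integrable_numRealEigs N m) (J : ℝ)
  unfold EN
  refine le_trans ?_ hM
  rw [div_eq_mul_one_div]
  gcongr

lemma tendsto_EN {α : ℝ} (hα : 0 < α) {m : ℕ → ℕ} (hm : ∀ n, 0 < m n)
    (hlim : Tendsto (fun n : ℕ => (m n : ℝ) / (2 * n : ℕ)) atTop (nhds α)) :
    Tendsto (fun n => EN (2 * n) (m n)) atTop atTop := by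
  have hex : ∀ j : ℕ, ∃ r : ℕ → ℝ, (∀ n, 0 < r n) ∧ (j ≠ 0 →
      Tendsto (fun n => gaussTuple (Fin (2 * n)) (m n)
        {ω | ¬ Dominates (matProd ω).charpoly (2 * n) j (r n)}) atTop (nhds 0)) := by
    intro j
    by_cases hj : j = 0
    · exact ⟨fun _ => 1, fun _ => one_pos, fun h => absurd hj h⟩
    · obtain ⟨r, h1, h2⟩ := exists_tendsto_measure_not_dominates hj hα hm hlim
      exact ⟨r, h1, fun _ => h2⟩
  choose r hr0 hr using hex
  refine tendsto_atTop.2 fun b => ?_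
  obtain ⟨J, hJ⟩ := exists_nat_ge (2 * b)
  have hsum : Tendsto (fun n => ∑ j ∈ Finset.Icc 1 (J + 1), gaussTuple (Fin (2 * n)) (m n)
      {ω | ¬ Dominates (matProd ω).charpoly (2 * n) j (r j n)}) atTop (nhds 0) := by
    have := tendsto_finsetSum (Finset.Icc 1 (J + 1)) fun j hj =>
      hr j (by have := (Finset.mem_Icc.1 hj).1; omega)
    simpa using this
  filter_upwards [hsum.eventually_le_const (by simp : (0 : ℝ≥0∞) < 1 / 2),
    eventually_ge_atTop (J + 1)] with n hn hnJ
  refine le_trans ?_ (half_le_EN (by omega) (by omega) (fun j => hr0 j n) hn)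
  linarith

end Scaling

section LargeRoots

lemma sum_indicator_add_one_le_prod (s : Multiset ℝ) {l ε : ℝ} (hl : 0 < l) (h : 2 ≤ l * ε) :
    0 ≤ (s.map fun x => if ε ≤ |x| then (1 : ℝ) else 0).sum ∧
      (s.map fun x => if ε ≤ |x| then (1 : ℝ) else 0).sum + 1 ≤
        (s.map fun x => max 1 (l * |x|)).prod := by
  induction s using Multiset.induction with
  | empty => simp
  | cons a s ih =>
    obtain ⟨h0, h1⟩ := ih
    simp only [Multiset.map_cons, Multiset.sum_cons, Multiset.prod_cons]
    split_ifs with ha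
    · refine ⟨by linarith, ?_⟩
      have h2 : 2 ≤ max 1 (l * |a|) :=
        (h.trans (mul_le_mul_of_nonneg_left ha hl.le)).trans (le_max_right _ _)
      nlinarith
    · refine ⟨by linarith, ?_⟩
      have h2 : 1 ≤ max 1 (l * |a|) := le_max_left _ _
      nlinarith

/-- The number of large real roots is controlled by the squares of the coefficients. -/
lemma sum_indicator_roots_le {p : Polynomial ℝ} (hp : p.Monic) {l ε : ℝ} (hl : 0 < l)
    (h : 2 ≤ l * ε) :
    (p.roots.map fun x => if ε ≤ |x| then (1 : ℝ) else 0).sum ≤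
      ∑ i ∈ Finset.range (p.natDegree + 1), (l ^ (p.natDegree - i) * |p.coeff i|) ^ 2 := by
  obtain ⟨h0, h1⟩ := sum_indicator_add_one_le_prod p.roots hl h
  set A := (p.roots.map fun x => if ε ≤ |x| then (1 : ℝ) else 0).sum
  set B := (p.roots.map fun x => max 1 (l * |x|)).prod
  set q : Polynomial ℂ := (p.scaleRoots l).map Complex.ofRealHom with hq
  have hsm : (p.scaleRoots l).Monic := (Polynomial.monic_scaleRoots_iff l).2 hp
  have hqm : q.Monic := hsm.map _
  have hle : p.roots.map (fun x => ((l * x : ℝ) : ℂ)) ≤ q.roots := by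
    have := Polynomial.map_roots_le (p := p.scaleRoots l) (f := Complex.ofRealHom) hqm.ne_zero
    rw [Polynomial.roots_scaleRoots p (IsUnit.mk0 l hl.ne'), Multiset.map_map] at this
    exact this
  have hB : B ≤ q.mahlerMeasure := by
    rw [Polynomial.mahlerMeasure_eq_leadingCoeff_mul_prod_roots, hqm.leadingCoeff, norm_one,
      one_mul]
    obtain ⟨u, hu⟩ := Multiset.le_iff_exists_add.1 hle
    rw [hu, Multiset.map_add, Multiset.prod_add, Multiset.map_map]
    have e1 : (Multiset.map ((fun a => max 1 ‖a‖) ∘ fun x => ((l * x : ℝ) : ℂ)) p.roots).prod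
        = B := by
      simp only [Function.comp_def, Complex.norm_real, Real.norm_eq_abs, abs_mul, abs_of_pos hl, B]
    have e2 : 1 ≤ (Multiset.map (fun a => max 1 ‖a‖) u).prod :=
      Multiset.one_le_prod fun a ha => by
        obtain ⟨z, -, rfl⟩ := Multiset.mem_map.1 ha
        exact le_max_left _ _
    rw [e1]
    exact le_mul_of_one_le_right (by linarith) e2
  have hqd : q.natDegree = p.natDegree := by
    rw [hq, hsm.natDegree_map, Polynomial.natDegree_scaleRoots]
  calc A ≤ B ^ 2 := by nlinarith
    _ ≤ q.mahlerMeasure ^ 2 := by gcongr; linarith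
    _ ≤ q.sum fun _ a => ‖a‖ ^ 2 := by
      refine (pow_le_pow_left₀ q.mahlerMeasure_nonneg
        q.mahlerMeasure_le_sqrt_sum_sq_norm_coeff 2).trans (le_of_eq (Real.sq_sqrt ?_))
      exact Finset.sum_nonneg fun i _ => by positivity
    _ = _ := by
      rw [Polynomial.sum_over_range _ (by simp), hqd]
      refine Finset.sum_congr rfl fun i _ => ?_
      rw [hq, Polynomial.coeff_map, Polynomial.coeff_scaleRoots, Complex.ofRealHom_eq_coe,
        Complex.norm_real, Real.norm_eq_abs, abs_mul, abs_pow, abs_of_pos hl, mul_comm]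

end LargeRoots

section CoefficientMoments

variable {n : Type*} [Fintype n] [DecidableEq n]

lemma pm_updateRow_neg {S : Finset n} {c : n} (hc : c ∈ S) (M : Matrix n n ℝ) :
    pm S (M.updateRow c (-M c)) = -pm S M := by
  obtain ⟨φ, hφ⟩ := exists_pm_updateRow hc M
  rw [hφ, map_neg, ← hφ, Matrix.updateRow_eq_self]

lemma lintegral_pm_sq (S : Finset n) (m : ℕ) :
    ∫⁻ ω, ENNReal.ofReal |pm S (matProd ω)| ^ (2 : ℝ) ∂gaussTuple n (m + 1) =
      ((S.card).factorial * ((Fintype.card n).descFactorial S.card) ^ m : ℕ) := by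
  have h := lintegral_pm_det_succ S 2 0 m
  simp only [ENNReal.rpow_zero, mul_one] at h
  have h2 := lintegral_colVol_det S 2 0 m
  simp only [ENNReal.rpow_zero, mul_one] at h2
  rw [h, h2, lintegral_colVol_moment, (pm_moment S).2]
  simp only [chiMoment_two]
  have hcard : S.card ≤ Fintype.card n := Finset.card_le_univ S
  have h3 : ∀ N k : ℕ, k ≤ N → ∏ d ∈ Finset.Ioc (N - k) N, d = N.descFactorial k := by
    intro N k hk
    induction k with
    | zero => simp
    | succ k ih =>
      have hins : Finset.Ioc (N - (k + 1)) N = insert (N - k) (Finset.Ioc (N - k) N) := by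
        ext d
        simp only [Finset.mem_insert, Finset.mem_Ioc]
        omega
      rw [Nat.descFactorial_succ, ← ih (by omega), hins, Finset.prod_insert (by simp)]
  have h4 := h3 S.card S.card le_rfl
  have h5 := h3 (Fintype.card n) S.card hcard
  rw [Nat.sub_self, Nat.descFactorial_self] at h4
  rw [← Nat.cast_prod, ← Nat.cast_prod, h4, h5]
  push_cast
  rfl

lemma memLp_pm (S : Finset n) (m : ℕ) :
    MemLp (fun ω : Fin (m + 1) → n → n → ℝ => pm S (matProd ω)) 2 (gaussTuple n (m + 1)) := by
  have hc : Continuous fun ω : Fin (m + 1) → n → n → ℝ => pm S (matProd ω) := by fun_prop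
  refine (eLpNorm_lt_top_iff_lintegral_rpow_enorm_lt_top (by simp) (by simp)).2 ?_ |>
    fun h => ⟨hc.measurable.aestronglyMeasurable, h⟩
  simp only [ENNReal.toReal_ofNat, Real.enorm_eq_ofReal_abs]
  rw [lintegral_pm_sq]
  exact ENNReal.natCast_lt_top _

lemma integral_pm_sq (S : Finset n) (m : ℕ) :
    ∫ ω, pm S (matProd ω) * pm S (matProd ω) ∂gaussTuple n (m + 1) =
      ((S.card).factorial * ((Fintype.card n).descFactorial S.card) ^ m : ℕ) := by
  have hc : Continuous fun ω : Fin (m + 1) → n → n → ℝ =>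
    pm S (matProd ω) * pm S (matProd ω) := by fun_prop
  rw [integral_eq_lintegral_of_nonneg_ae (Eventually.of_forall fun ω => mul_self_nonneg _)
    hc.measurable.aestronglyMeasurable, ← ENNReal.toReal_natCast, ← lintegral_pm_sq]
  congr 1
  refine lintegral_congr fun ω => ?_
  rw [ENNReal.ofReal_rpow_of_nonneg (abs_nonneg _) (by norm_num), ← abs_mul_abs_self]
  congr 1
  rw [Real.rpow_two, sq]

lemma measurePreserving_flip (m : ℕ) (c : n) :
    MeasurePreserving (fun (ω : Fin (m + 1) → n → n → ℝ) i a b =>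
      (if i = 0 ∧ a = c then -1 else 1) * ω i a b) (gaussTuple n (m + 1)) (gaussTuple n (m + 1)) :=
  measurePreserving_gaussTuple_mul (fun i a _ => if i = 0 ∧ a = c then -1 else 1) 1 fun i a b => by
    split_ifs <;> simp

lemma matProd_flip {m : ℕ} (c : n) (ω : Fin (m + 1) → n → n → ℝ) :
    matProd (fun i a b => (if i = 0 ∧ a = c then -1 else 1) * ω i a b) =
      (matProd ω).updateRow c (-(matProd ω) c) := by
  have h1 : ω = Fin.cons (ω 0) (Fin.tail ω) := (Fin.cons_self_tail ω).symm
  have h2 : (fun i a b => (if i = 0 ∧ a = c then -1 else 1) * ω i a b :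
      Fin (m + 1) → n → n → ℝ) = Fin.cons (Function.update (ω 0) c (-ω 0 c)) (Fin.tail ω) := by
    funext i
    refine Fin.cases ?_ (fun i => ?_) i
    · funext a b
      by_cases ha : a = c
      · subst ha; simp
      · simp [ha]
    · funext a b
      simp [Fin.succ_ne_zero, Fin.tail]
  rw [h2, matProd_cons, of_update_mul, ← matProd_cons, ← h1, Matrix.neg_vecMul]
  congr 2
  conv_rhs => rw [h1, matProd_cons]
  ext b
  simp [Matrix.mul_apply, Matrix.vecMul, dotProduct]

lemma integral_pm_mul_pm_of_mem {S T : Finset n} {c : n} (hS : c ∈ S) (hT : c ∉ T) (m : ℕ) :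
    ∫ ω, pm S (matProd ω) * pm T (matProd ω) ∂gaussTuple n (m + 1) = 0 := by
  have hc : Continuous fun ω : Fin (m + 1) → n → n → ℝ =>
    pm S (matProd ω) * pm T (matProd ω) := by fun_prop
  have hmp := measurePreserving_flip (n := n) m c
  have h := integral_map (μ := gaussTuple n (m + 1)) hmp.measurable.aemeasurable
    (f := fun ω => pm S (matProd ω) * pm T (matProd ω)) hc.measurable.aestronglyMeasurable
  rw [hmp.map_eq] at h
  simp only [matProd_flip, pm_updateRow_neg hS, pm_updateRow_of_notMem hT, neg_mul] at h
  rw [integral_neg] at h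
  linarith

lemma integral_pm_mul_pm {S T : Finset n} (hST : S ≠ T) (m : ℕ) :
    ∫ ω, pm S (matProd ω) * pm T (matProd ω) ∂gaussTuple n (m + 1) = 0 := by
  by_cases h : S ⊆ T
  · have h' : ¬ T ⊆ S := fun h' => hST (h.antisymm h')
    obtain ⟨c, hT, hS⟩ := Finset.not_subset.1 h'
    simp only [mul_comm (pm S _)]
    exact integral_pm_mul_pm_of_mem hT hS m
  · obtain ⟨c, hS, hT⟩ := Finset.not_subset.1 h
    exact integral_pm_mul_pm_of_mem hS hT m

lemma integrable_pm_mul_pm (S T : Finset n) (m : ℕ) :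
    Integrable (fun ω : Fin (m + 1) → n → n → ℝ => pm S (matProd ω) * pm T (matProd ω))
      (gaussTuple n (m + 1)) :=
  (memLp_pm S m).integrable_mul (memLp_pm T m)

lemma abs_charpoly_coeff_sq {M : Matrix n n ℝ} {i : ℕ} (hi : i ≤ Fintype.card n) :
    |M.charpoly.coeff i| ^ 2 = ∑ S ∈ Finset.univ.powersetCard (Fintype.card n - i),
      ∑ T ∈ Finset.univ.powersetCard (Fintype.card n - i), pm S M * pm T M := by
  rw [abs_charpoly_coeff hi, sq_abs, sq, esymAvoid, Finset.sum_mul_sum]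
  simp

lemma integrable_charpoly_coeff_sq (m : ℕ) {i : ℕ} (hi : i ≤ Fintype.card n) :
    Integrable (fun ω : Fin (m + 1) → n → n → ℝ => |(matProd ω).charpoly.coeff i| ^ 2)
      (gaussTuple n (m + 1)) := by
  simp only [abs_charpoly_coeff_sq hi]
  exact integrable_finsetSum _ fun S _ => integrable_finsetSum _ fun T _ =>
    integrable_pm_mul_pm S T m

/-- The second moments of the coefficients of the characteristic polynomial. -/
lemma integral_charpoly_coeff_sq (m : ℕ) {i : ℕ} (hi : i ≤ Fintype.card n) :
    ∫ ω, |(matProd ω).charpoly.coeff i| ^ 2 ∂gaussTuple n (m + 1) =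
      ((Fintype.card n).descFactorial (Fintype.card n - i) : ℝ) ^ (m + 1) := by
  simp only [abs_charpoly_coeff_sq hi]
  rw [integral_finsetSum _ fun S _ => integrable_finsetSum _ fun T _ => integrable_pm_mul_pm S T m]
  have : ∀ S ∈ (Finset.univ : Finset n).powersetCard (Fintype.card n - i),
      ∫ ω, ∑ T ∈ Finset.univ.powersetCard (Fintype.card n - i), pm S (matProd ω) * pm T (matProd ω)
        ∂gaussTuple n (m + 1) = (((Fintype.card n - i).factorial *
          ((Fintype.card n).descFactorial (Fintype.card n - i)) ^ m : ℕ) : ℝ) := by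
    intro S hS
    rw [integral_finsetSum _ fun T _ => integrable_pm_mul_pm S T m,
      Finset.sum_eq_single S (fun T _ hT => integral_pm_mul_pm hT.symm m) (fun h => absurd hS h),
      integral_pm_sq, (Finset.mem_powersetCard.1 hS).2]
  rw [Finset.sum_congr rfl this, Finset.sum_const, Finset.card_powersetCard, Finset.card_univ,
    nsmul_eq_mul, ← Nat.cast_mul, ← Nat.cast_pow]
  congr 1
  rw [Nat.descFactorial_eq_factorial_mul_choose, pow_succ]
  ring

end CoefficientMoments

section Concentration

lemma descFactorial_div_pow_le {N : ℕ} (hN : 0 < N) (k : ℕ) :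
    (N.descFactorial k : ℝ) / N ^ k ≤ Real.exp (-1 / (2 * N)) ^ (k * (k - 1)) := by
  have hN' : (0 : ℝ) < N := by exact_mod_cast hN
  induction k with
  | zero => simp
  | succ k ih =>
    have h1 : ((N - k : ℕ) : ℝ) / N ≤ Real.exp (-1 / (2 * N)) ^ (2 * k) := by
      rw [← Real.exp_nat_mul]
      have h2 := Real.add_one_le_exp (-(k : ℝ) / N)
      have h3 : ((2 * k : ℕ) : ℝ) * (-1 / (2 * N)) = -(k : ℝ) / N := by
        push_cast; field_simp
      rw [h3]
      rcases le_or_gt k N with hk | hk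
      · refine le_trans (le_of_eq ?_) h2
        rw [Nat.cast_sub hk]
        field_simp
        ring
      · rw [Nat.sub_eq_zero_of_le hk.le]
        simp [Real.exp_nonneg]
    have h4 : (k + 1) * (k + 1 - 1) = 2 * k + k * (k - 1) := by
      rcases k with - | k
      · simp
      · simp only [Nat.add_sub_cancel]; ring
    rw [Nat.descFactorial_succ, Nat.cast_mul, pow_succ', mul_div_mul_comm, h4, pow_add]
    exact mul_le_mul h1 ih (by positivity) (by positivity)

lemma summable_pow_mul_pow_sq {L q : ℝ} (hL : 0 < L) (hq0 : 0 < q) (hq1 : q < 1) :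
    Summable fun k : ℕ => L ^ k * q ^ (k * (k - 1)) := by
  refine summable_of_ratio_test_tendsto_lt_one (l := 0) one_pos
    (Eventually.of_forall fun k => by positivity) ?_
  have h : Tendsto (fun k : ℕ => L * (q ^ 2) ^ k) atTop (nhds 0) := by
    simpa using (tendsto_pow_atTop_nhds_zero_of_lt_one (by positivity)
      (by nlinarith : q ^ 2 < 1)).const_mul L
  refine h.congr fun k => ?_
  have h4 : (k + 1) * (k + 1 - 1) = 2 * k + k * (k - 1) := by
    rcases k with - | k
    · simp
    · simp only [Nat.add_sub_cancel]; ring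
  rw [Real.norm_of_nonneg (by positivity), Real.norm_of_nonneg (by positivity), h4, pow_add q,
    pow_mul q 2]
  have : q ^ (k * (k - 1)) ≠ 0 := by positivity
  generalize q ^ (k * (k - 1)) = Q at this
  field_simp
  rw [pow_succ']

/-- The weighted sum of squares of coefficients that controls the number of large eigenvalues. -/
noncomputable def coeffEnergy (N : ℕ) (l : ℝ) (P : Matrix (Fin N) (Fin N) ℝ) : ℝ :=
  ∑ i ∈ Finset.range (N + 1), (l ^ (N - i) * |P.charpoly.coeff i|) ^ 2

lemma continuous_coeffEnergy (N : ℕ) (l : ℝ) : Continuous (coeffEnergy N l) := by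
  unfold coeffEnergy
  refine continuous_finsetSum _ fun i hi => ?_
  have hi' : i ≤ Fintype.card (Fin N) := by
    rw [Fintype.card_fin]; have := Finset.mem_range.1 hi; omega
  simp only [abs_charpoly_coeff hi']
  fun_prop

lemma coeffEnergy_scale (N m : ℕ) (l : ℝ) (ω : Fin m → Fin N → Fin N → ℝ) :
    coeffEnergy N l (prodMatrix N m fun i a b => √(1 / N) * ω i a b) =
      ∑ i ∈ Finset.range (N + 1),
        (l ^ 2) ^ (N - i) * ((1 / N : ℝ) ^ (N - i)) ^ m * |(matProd ω).charpoly.coeff i| ^ 2 := by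
  unfold coeffEnergy
  refine Finset.sum_congr rfl fun i hi => ?_
  have hi' : i ≤ Fintype.card (Fin N) := by
    rw [Fintype.card_fin]; have := Finset.mem_range.1 hi; omega
  have hs : (1 / N : ℝ) = √(1 / N) ^ 2 := (Real.sq_sqrt (by positivity)).symm
  rw [prodMatrix_scale, abs_charpoly_coeff_smul (by positivity) _ hi', Fintype.card_fin]
  conv_rhs => rw [hs]
  simp only [← pow_mul, mul_pow]
  rw [← mul_assoc]
  congr 3
  · ring
  · ring

lemma integrable_coeffEnergy (N m : ℕ) (l : ℝ) :
    Integrable (fun ω => coeffEnergy N l (prodMatrix N (m + 1) ω)) (ensembleMeasure N (m + 1)) := by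
  have hc : Continuous fun ω => coeffEnergy N l (prodMatrix N (m + 1) ω) :=
    (continuous_coeffEnergy N l).comp (continuous_prodMatrix N (m + 1))
  rw [← (measurePreserving_ensemble N (m + 1)).integrable_comp
    hc.measurable.aestronglyMeasurable]
  simp only [Function.comp_def, coeffEnergy_scale]
  refine integrable_finsetSum _ fun i hi => (integrable_charpoly_coeff_sq m ?_).const_mul _
  rw [Fintype.card_fin]; have := Finset.mem_range.1 hi; omega

lemma integral_coeffEnergy_le {N m : ℕ} (hN : 0 < N) {l β : ℝ} (hl : 0 < l) (hβ : 0 < β)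
    (h : β ≤ (m + 1 : ℕ) / N) :
    ∫ ω, coeffEnergy N l (prodMatrix N (m + 1) ω) ∂ensembleMeasure N (m + 1) ≤
      ∑' k : ℕ, (l ^ 2) ^ k * Real.exp (-β / 2) ^ (k * (k - 1)) := by
  have hN' : (0 : ℝ) < N := by exact_mod_cast hN
  have hc : Continuous fun ω => coeffEnergy N l (prodMatrix N (m + 1) ω) :=
    (continuous_coeffEnergy N l).comp (continuous_prodMatrix N (m + 1))
  have hmp := measurePreserving_ensemble N (m + 1)
  have hmap := integral_map (μ := gaussTuple (Fin N) (m + 1)) hmp.measurable.aemeasurable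
    (f := fun ω => coeffEnergy N l (prodMatrix N (m + 1) ω)) hc.measurable.aestronglyMeasurable
  rw [hmp.map_eq] at hmap
  have hi' : ∀ i ∈ Finset.range (N + 1), i ≤ Fintype.card (Fin N) := fun i hi => by
    rw [Fintype.card_fin]; have := Finset.mem_range.1 hi; omega
  rw [hmap]
  simp only [coeffEnergy_scale]
  rw [integral_finsetSum _ fun i hi => (integrable_charpoly_coeff_sq m (hi' i hi)).const_mul _]
  calc _ = ∑ i ∈ Finset.range (N + 1),
        (l ^ 2) ^ (N - i) * ((N.descFactorial (N - i) : ℝ) / N ^ (N - i)) ^ (m + 1) := by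
        refine Finset.sum_congr rfl fun i hi => ?_
        rw [integral_const_mul, integral_charpoly_coeff_sq m (hi' i hi), Fintype.card_fin,
          mul_assoc, ← mul_pow, one_div_pow, one_div_mul_eq_div]
    _ = ∑ k ∈ Finset.range (N + 1),
        (l ^ 2) ^ k * ((N.descFactorial k : ℝ) / N ^ k) ^ (m + 1) :=
        Finset.sum_range_reflect
          (fun k => (l ^ 2) ^ k * ((N.descFactorial k : ℝ) / N ^ k) ^ (m + 1)) (N + 1)
    _ ≤ ∑ k ∈ Finset.range (N + 1), (l ^ 2) ^ k * Real.exp (-β / 2) ^ (k * (k - 1)) := by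
        refine Finset.sum_le_sum fun k _ => mul_le_mul_of_nonneg_left ?_ (by positivity)
        refine (pow_le_pow_left₀ (by positivity) (descFactorial_div_pow_le hN k) _).trans ?_
        rw [pow_right_comm]
        refine pow_le_pow_left₀ (by positivity) ?_ _
        rw [← Real.exp_nat_mul, Real.exp_le_exp]
        have : ((m + 1 : ℕ) : ℝ) * (-1 / (2 * N)) = -((m + 1 : ℕ) / N) / 2 := by field_simp
        rw [this]
        linarith
    _ ≤ _ := Summable.sum_le_tsum _ (fun k _ => by positivity)
        (summable_pow_mul_pow_sq (by positivity) (Real.exp_pos _)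
          (Real.exp_lt_one_iff.2 (by linarith)))

lemma abs_linearStat_sub_le {f : ℝ → ℝ} {C δ ε l : ℝ} (hC : ∀ x, |f x| ≤ C) (hδ : 0 ≤ δ)
    (hε : ∀ x, |x| < ε → |f x - f 0| ≤ δ) (hl : 0 < l) (h : 2 ≤ l * ε) (N : ℕ)
    (P : Matrix (Fin N) (Fin N) ℝ) :
    |linearStat N f P - f 0 * numRealEigs N P| ≤
      δ * numRealEigs N P + 2 * C * coeffEnergy N l P := by
  have hC0 : 0 ≤ C := (abs_nonneg _).trans (hC 0)
  have h1 : linearStat N f P - f 0 * numRealEigs N P =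
      (P.charpoly.roots.map fun x => f x - f 0).sum := by
    simp [linearStat, numRealEigs, Multiset.sum_map_sub, mul_comm]
  have h2 := sum_indicator_roots_le (Matrix.charpoly_monic P) hl h
  rw [Matrix.charpoly_natDegree_eq_dim, Fintype.card_fin] at h2
  calc |linearStat N f P - f 0 * numRealEigs N P|
      ≤ (P.charpoly.roots.map fun x => |f x - f 0|).sum := by
        rw [h1]
        refine Multiset.abs_sum_le_sum_abs.trans (le_of_eq ?_)
        rw [Multiset.map_map]
        rfl
    _ ≤ (P.charpoly.roots.map fun x => δ + 2 * C * (if ε ≤ |x| then (1 : ℝ) else 0)).sum := by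
        refine Multiset.sum_map_le_sum_map _ _ fun x _ => ?_
        split_ifs with hx
        · have := abs_sub (f x) (f 0)
          linarith [hC x, hC 0]
        · simpa using hε x (not_le.1 hx)
    _ = δ * numRealEigs N P +
        2 * C * (P.charpoly.roots.map fun x => if ε ≤ |x| then (1 : ℝ) else 0).sum := by
        rw [Multiset.sum_map_add, Multiset.sum_map_mul_left]
        simp [numRealEigs, mul_comm]
    _ ≤ _ := by
        gcongr
        exact h2

end Concentration

end RealEigs

/-- In the critical regime `m = αN`, the normalized density of real
eigenvalues converges weakly to the Dirac delta at `0`: for every bounded continuous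
`f`, `E[Σ_x f(x)] / E_N(m_N) → f(0)`. -/
theorem density_real_eigenvalues_tendsto_delta
    (α : ℝ) (hα : 0 < α) (f : ℝ → ℝ) (hf_cont : Continuous f)
    (hf_bdd : ∃ C : ℝ, ∀ x, |f x| ≤ C)
    (m : ℕ → ℕ) (hm : ∀ n, 0 < m n)
    (hlim : Tendsto (fun n : ℕ => (m n : ℝ) / (2 * n : ℕ)) atTop (nhds α)) :
    Tendsto
      (fun n => (∫ ω, linearStat (2 * n) f (prodMatrix (2 * n) (m n) ω)
        ∂(ensembleMeasure (2 * n) (m n))) / EN (2 * n) (m n))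
      atTop (nhds (f 0)) := by
  obtain ⟨C, hC⟩ := hf_bdd
  have hC0 : 0 ≤ C := (abs_nonneg _).trans (hC 0)
  have hEN := RealEigs.tendsto_EN hα hm hlim
  refine Metric.tendsto_atTop'.2 fun η hη => ?_
  obtain ⟨ε, hε0, hε⟩ := Metric.continuousAt_iff.1 (hf_cont.continuousAt (x := 0)) (η / 2) (half_pos hη)
  set l := 2 / ε with hl
  have hl0 : 0 < l := by positivity
  set K := ∑' k : ℕ, (l ^ 2) ^ k * Real.exp (-(α / 2) / 2) ^ (k * (k - 1)) with hK
  obtain ⟨n₀, h₀⟩ := eventually_atTop.1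
    ((hEN.eventually_gt_atTop (max 0 (2 * (2 * C * K) / η))).and
      ((hlim.eventually_const_lt (half_lt_self hα)).and (eventually_gt_atTop 0)))
  refine ⟨n₀, fun n hn => ?_⟩
  obtain ⟨h1, h2, h3⟩ := h₀ n hn.le
  have hE0 : 0 < EN (2 * n) (m n) := (le_max_left _ _).trans_lt h1
  have hE1 : 2 * (2 * C * K) / η < EN (2 * n) (m n) := (le_max_right _ _).trans_lt h1
  obtain ⟨k, hk⟩ := Nat.exists_eq_succ_of_ne_zero (hm n).ne'
  have hintegr : |(∫ ω, linearStat (2 * n) f (prodMatrix (2 * n) (m n) ω)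
      ∂(ensembleMeasure (2 * n) (m n))) - f 0 * EN (2 * n) (m n)| ≤
      η / 2 * EN (2 * n) (m n) + 2 * C * K := by
    rw [hk, Nat.succ_eq_add_one] at h2 ⊢
    have i1 := RealEigs.integrable_linearStat (2 * n) (k + 1) hf_cont hC
    have i2 := RealEigs.integrable_numRealEigs (2 * n) (k + 1)
    have i3 := RealEigs.integrable_coeffEnergy (2 * n) k l
    unfold EN
    rw [← integral_const_mul, ← integral_const_mul, ← integral_sub i1 (i2.const_mul _)]
    refine (abs_integral_le_integral_abs).trans ?_
    calc _ ≤ ∫ ω, (η / 2 * numRealEigs (2 * n) (prodMatrix (2 * n) (k + 1) ω) +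
          2 * C * RealEigs.coeffEnergy (2 * n) l (prodMatrix (2 * n) (k + 1) ω))
            ∂ensembleMeasure (2 * n) (k + 1) := by
          refine integral_mono (i1.sub (i2.const_mul _)).abs
            ((i2.const_mul _).add (i3.const_mul _)) fun ω => ?_
          refine RealEigs.abs_linearStat_sub_le (ε := ε) hC (by positivity) (fun x hx => ?_) hl0 ?_ _ _
          · have := hε (x := x) (by simpa using hx)
            rw [Real.dist_eq] at this
            exact this.le
          · rw [hl, div_mul_cancel₀ _ hε0.ne']
      _ ≤ _ := by
          rw [integral_add (i2.const_mul _) (i3.const_mul _), integral_const_mul,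
            integral_const_mul]
          gcongr
          exact RealEigs.integral_coeffEnergy_le (by omega) hl0 (half_pos hα) h2.le
  rw [Real.dist_eq, div_sub' hE0.ne', abs_div, abs_of_pos hE0, div_lt_iff₀ hE0, mul_comm _ (f 0)]
  rw [div_lt_iff₀ hη] at hE1
  linarith
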